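/- arXiv:1706.07319 — 2 statements merged into one kernel-verified Lean document; each statement's English description precedes it below -/
import Mathlib

section
/- Let c > 1 with c not an integer, F(t) = t^c, F'(t) = c t^{c−1}, f(k) = ⌊F(k)⌋. For every A > 1 there exist B > 0, κ > 0 and x₀ ≥ 2 (depending only on c and A) such that for all x ≥ x₀, with y₁ defined by y₁^c = x (log x)^{−B}, and all y with y₁ < y and F(y) ≤ x, one has | V′ − ( 2S₀ − x² Φ + f(y) Σ_{p ≤ x} (log p)² ) | ≤ κ x² (log x)^{−A}, where V′ = Σ_{y₁ < k ≤ y} F'(k) Σ_{ℓ=1, gcd(ℓ,f(k))=1}^{f(k)} E(x; f(k), ℓ)², S₀ = Σ_{y₁ < k ≤ y} F'(k) Σ_{p₁ < p₂ ≤ x, p₁ ≡ p₂ (mod f(k))} (log p₁)(log p₂), and Φ = Σ_{y₁ < k ≤ y} F'(k)/φ(f(k)) (p, p₁, p₂ primes; k integer). -/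
/-- `E(x; h, ℓ) = Σ_{p ≤ x, p ≡ ℓ (mod h)} log p − x/φ(h)`. -/
noncomputable def Ef (x : ℝ) (h ℓ : ℕ) : ℝ :=
  (∑ p ∈ (Finset.range (⌊x⌋₊ + 1)).filter (fun p => p.Prime ∧ p % h = ℓ % h), Real.log p)
    - x / (Nat.totient h)

/-- `Σ_{ℓ=1, gcd(ℓ,m)=1}^{m} E(x; m, ℓ)²`. -/
noncomputable def varSum (x : ℝ) (m : ℕ) : ℝ :=
  ∑ ℓ ∈ (Finset.Icc 1 m).filter (fun ℓ => Nat.gcd ℓ m = 1), Ef x m ℓ ^ 2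

/-- The primes `p ≤ x`. -/
noncomputable def primesLe (x : ℝ) : Finset ℕ :=
  (Finset.range (⌊x⌋₊ + 1)).filter (fun p => p.Prime)

/-- `f(k) = ⌊k^c⌋`. -/
noncomputable def fc (c : ℝ) (k : ℤ) : ℕ := ⌊(k : ℝ) ^ c⌋₊

/-- `V′ = Σ_{y₁ < k ≤ y} F'(k) Σ_{ℓ=1, gcd(ℓ,f(k))=1}^{f(k)} E(x; f(k), ℓ)²`. -/
noncomputable def Vprime (c x y₁ y : ℝ) : ℝ :=
  ∑ k ∈ Finset.Ioc ⌊y₁⌋ ⌊y⌋, c * (k : ℝ) ^ (c - 1) * varSum x (fc c k)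

/-- `S₀ = Σ_{y₁ < k ≤ y} F'(k) Σ_{p₁ < p₂ ≤ x, p₁ ≡ p₂ (mod f(k))} (log p₁)(log p₂)`. -/
noncomputable def S0 (c x y₁ y : ℝ) : ℝ :=
  ∑ k ∈ Finset.Ioc ⌊y₁⌋ ⌊y⌋,
    c * (k : ℝ) ^ (c - 1) *
      ∑ p₁ ∈ primesLe x,
        ∑ p₂ ∈ (primesLe x).filter (fun p₂ => p₁ < p₂ ∧ p₁ % fc c k = p₂ % fc c k),
          Real.log p₁ * Real.log p₂

/-- `Φ = Σ_{y₁ < k ≤ y} F'(k)/φ(f(k))`. -/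
noncomputable def PhiF (c y₁ y : ℝ) : ℝ :=
  ∑ k ∈ Finset.Ioc ⌊y₁⌋ ⌊y⌋, c * (k : ℝ) ^ (c - 1) / (Nat.totient (fc c k) : ℝ)

section ZetaBounds

open Complex Filter Topology

/-- The `n`-th Euler–Maclaurin correction term of `(s - 1) * ζ s`. -/
noncomputable def zetaCorrection (n : ℕ) (s : ℂ) : ℂ :=
  (s - 1) * ((n + 1 : ℕ) : ℂ) ^ (-s) + (((n + 2 : ℕ) : ℂ) ^ (1 - s) - ((n + 1 : ℕ) : ℂ) ^ (1 - s))

lemma norm_cpow_sub_cpow_le {a u : ℝ} (ha : 0 < a) (hau : a ≤ u) {s : ℂ} (hs : 0 < s.re) :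
    ‖(u : ℂ) ^ (-s) - (a : ℂ) ^ (-s)‖ ≤ ‖s‖ * a ^ (-s.re - 1) * (u - a) := by
  have hs0 : -s ≠ 0 := by
    rintro h
    rw [neg_eq_zero] at h
    simp [h] at hs
  have key := Convex.norm_image_sub_le_of_norm_hasDerivWithin_le (𝕜 := ℝ)
    (f := fun v : ℝ => (v : ℂ) ^ (-s)) (f' := fun v : ℝ => -s * (v : ℂ) ^ (-s - 1))
    (s := Set.Icc a u) (x := a) (y := u) (C := ‖s‖ * a ^ (-s.re - 1)) ?_ ?_ (convex_Icc a u)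
    (Set.left_mem_Icc.2 hau) (Set.right_mem_Icc.2 hau)
  · simpa [abs_of_nonneg (sub_nonneg.2 hau)] using key
  · intro v hv
    exact (hasDerivAt_ofReal_cpow_const (ha.trans_le hv.1).ne' hs0).hasDerivWithinAt
  · intro v hv
    have hv0 : 0 < v := ha.trans_le hv.1
    rw [norm_mul, norm_neg, norm_cpow_eq_rpow_re_of_pos hv0]
    have : v ^ (-s - 1).re ≤ a ^ (-s.re - 1) := by
      simp only [sub_re, neg_re, one_re]
      exact Real.rpow_le_rpow_of_nonpos ha hv.1 (by linarith)
    gcongr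

lemma norm_zetaCorrection_le (n : ℕ) {s : ℂ} (hs : 0 < s.re) :
    ‖zetaCorrection n s‖ ≤ ‖s - 1‖ * ‖s‖ * ((n : ℝ) + 1) ^ (-s.re - 1) := by
  rcases eq_or_ne s 1 with rfl | h1
  · simp [zetaCorrection]
  have h1' : 1 - s ≠ 0 := sub_ne_zero.2 h1.symm
  set a : ℝ := (n : ℝ) + 1 with hadef
  have ha : 0 < a := by positivity
  have key := Convex.norm_image_sub_le_of_norm_hasDerivWithin_le (𝕜 := ℝ)
    (f := fun v : ℝ => (v : ℂ) * ((s - 1) * (a : ℂ) ^ (-s)) + (v : ℂ) ^ (1 - s))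
    (f' := fun v : ℝ => 1 * ((s - 1) * (a : ℂ) ^ (-s)) + (1 - s) * (v : ℂ) ^ (1 - s - 1))
    (s := Set.Icc a (a + 1)) (x := a) (y := a + 1) (C := ‖s - 1‖ * ‖s‖ * a ^ (-s.re - 1))
    ?_ ?_ (convex_Icc _ _) (Set.left_mem_Icc.2 (by linarith)) (Set.right_mem_Icc.2 (by linarith))
  · have e : zetaCorrection n s =
        (((a + 1 : ℝ) : ℂ) * ((s - 1) * (a : ℂ) ^ (-s)) + ((a + 1 : ℝ) : ℂ) ^ (1 - s))
          - ((a : ℂ) * ((s - 1) * (a : ℂ) ^ (-s)) + (a : ℂ) ^ (1 - s)) := by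
      simp only [zetaCorrection, hadef]
      push_cast
      rw [show (n : ℂ) + 1 + 1 = n + 2 by ring]
      ring
    rw [e]
    simpa using key
  · intro v hv
    have hv0 : v ≠ 0 := (ha.trans_le hv.1).ne'
    have hd : HasDerivAt (fun v : ℝ => (v : ℂ)) 1 v := by
      simpa using (hasDerivAt_id v).ofReal_comp
    exact ((hd.mul_const _).add (hasDerivAt_ofReal_cpow_const hv0 h1')).hasDerivWithinAt
  · intro v hv
    have hv0 : 0 < v := ha.trans_le hv.1
    have e : 1 * ((s - 1) * (a : ℂ) ^ (-s)) + (1 - s) * (v : ℂ) ^ (1 - s - 1)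
        = -(s - 1) * ((v : ℂ) ^ (-s) - (a : ℂ) ^ (-s)) := by
      rw [show 1 - s - 1 = -s by ring]
      ring
    rw [e, norm_mul, norm_neg, mul_assoc]
    gcongr
    refine (norm_cpow_sub_cpow_le ha hv.1 hs).trans ?_
    have h2 : v - a ≤ 1 := by linarith [hv.2]
    have h3 : 0 ≤ ‖s‖ * a ^ (-s.re - 1) := by positivity
    nlinarith

lemma summable_add_one_rpow {p : ℝ} (hp : p < -1) : Summable fun n : ℕ => ((n : ℝ) + 1) ^ p := by
  have := (summable_nat_add_iff 1).2 (Real.summable_nat_rpow.2 hp)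
  simpa using this

lemma summable_zetaCorrection {s : ℂ} (hs : 0 < s.re) :
    Summable fun n => zetaCorrection n s :=
  Summable.of_norm_bounded ((summable_add_one_rpow (by linarith)).mul_left _)
    fun n => norm_zetaCorrection_le n hs

lemma sum_range_zetaCorrection (N : ℕ) (s : ℂ) :
    ∑ n ∈ Finset.range N, zetaCorrection n s =
      (s - 1) * ∑ n ∈ Finset.range N, ((n + 1 : ℕ) : ℂ) ^ (-s) + ((N + 1 : ℕ) : ℂ) ^ (1 - s) - 1 := by
  have h := Finset.sum_range_sub (fun n : ℕ => ((n + 1 : ℕ) : ℂ) ^ (1 - s)) N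
  simp only [zetaCorrection, Finset.sum_add_distrib, ← Finset.mul_sum]
  rw [show (∑ x ∈ Finset.range N, (((x + 2 : ℕ) : ℂ) ^ (1 - s) - ((x + 1 : ℕ) : ℂ) ^ (1 - s)))
    = ((N + 1 : ℕ) : ℂ) ^ (1 - s) - 1 from h.trans (by simp)]
  ring

lemma differentiableAt_zetaCorrection (n : ℕ) (s : ℂ) : DifferentiableAt ℂ (zetaCorrection n) s := by
  unfold zetaCorrection
  have h1 : ((n + 1 : ℕ) : ℂ) ≠ 0 := Nat.cast_ne_zero.2 (by omega)
  have h2 : ((n + 2 : ℕ) : ℂ) ≠ 0 := Nat.cast_ne_zero.2 (by omega)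
  fun_prop (disch := simp_all)

lemma differentiableAt_tsum_zetaCorrection {s₀ : ℂ} (hs : 0 < s₀.re) :
    DifferentiableAt ℂ (fun s => ∑' n, zetaCorrection n s) s₀ := by
  set U : Set ℂ := {s | s₀.re / 2 < s.re} ∩ Metric.ball s₀ 1 with hU
  have hUo : IsOpen U := (isOpen_lt continuous_const continuous_re).inter Metric.isOpen_ball
  have hmem : s₀ ∈ U := ⟨by simp; linarith, Metric.mem_ball_self one_pos⟩
  refine DifferentiableOn.differentiableAt (s := U) ?_ (hUo.mem_nhds hmem)
  refine differentiableOn_tsum_of_summable_norm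
    (u := fun n : ℕ => (‖s₀‖ + 2) * (‖s₀‖ + 1) * ((n : ℝ) + 1) ^ (-(s₀.re / 2) - 1)) ?_
    (fun n s _ => (differentiableAt_zetaCorrection n s).differentiableWithinAt) hUo ?_
  · exact (summable_add_one_rpow (by linarith)).mul_left _
  · rintro n s ⟨h1, h2⟩
    simp only [Set.mem_ofPred_eq] at h1
    rw [Metric.mem_ball, dist_eq_norm] at h2
    have h3 : ‖s‖ ≤ ‖s₀‖ + 1 := by
      have := norm_add_le (s - s₀) s₀
      rw [sub_add_cancel] at this
      linarith
    have h4 : ‖s - 1‖ ≤ ‖s₀‖ + 2 := by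
      have := norm_sub_le s 1
      rw [norm_one] at this
      linarith
    refine (norm_zetaCorrection_le n (by linarith)).trans ?_
    gcongr
    linarith [show (0 : ℝ) ≤ n from n.cast_nonneg]

lemma riemannZeta₁_eq_of_one_lt_re {s : ℂ} (hs : 1 < s.re) :
    riemannZeta₁ s = 1 + ∑' n, zetaCorrection n s := by
  have h1 : s ≠ 1 := by
    rintro rfl
    simp at hs
  have hz : riemannZeta₁ s = (s - 1) * riemannZeta s := by
    rw [riemannZeta_eq_inv_sub_mul h1, ← mul_assoc, mul_inv_cancel₀ (sub_ne_zero.2 h1), one_mul]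
  have t1 := (summable_zetaCorrection (s := s) (by linarith)).hasSum.tendsto_sum_nat
  have hsum : Summable fun n : ℕ => ((n + 1 : ℕ) : ℂ) ^ (-s) := by
    have := (summable_nat_add_iff 1).2 (Complex.summable_one_div_nat_cpow.2 hs)
    simpa [Complex.cpow_neg] using this
  have hzs : ∑' n : ℕ, ((n + 1 : ℕ) : ℂ) ^ (-s) = riemannZeta s := by
    rw [zeta_eq_tsum_one_div_nat_add_one_cpow hs]
    simp [Complex.cpow_neg]
  have t3 : Tendsto (fun N : ℕ => ((N + 1 : ℕ) : ℂ) ^ (1 - s)) atTop (𝓝 0) := by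
    rw [tendsto_zero_iff_norm_tendsto_zero]
    have e : ∀ N : ℕ, ‖((N + 1 : ℕ) : ℂ) ^ (1 - s)‖ = ((N + 1 : ℕ) : ℝ) ^ (-(s.re - 1)) := by
      intro N
      rw [Complex.norm_natCast_cpow_of_pos (by omega)]
      simp
    simp only [e]
    exact ((tendsto_rpow_neg_atTop (by linarith)).comp tendsto_natCast_atTop_atTop).comp
      (tendsto_add_atTop_nat 1)
  have t2 := ((hsum.hasSum.tendsto_sum_nat.const_mul (s - 1)).add t3).sub_const 1
  have heq := tendsto_nhds_unique t1
    (t2.congr fun N => (sum_range_zetaCorrection N s).symm)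
  rw [heq, hzs, hz]
  ring

lemma riemannZeta₁_eq {s : ℂ} (hs : 0 < s.re) :
    riemannZeta₁ s = 1 + ∑' n, zetaCorrection n s := by
  have hUo : IsOpen {s : ℂ | 0 < s.re} := isOpen_lt continuous_const continuous_re
  have hconv : Convex ℝ {s : ℂ | 0 < s.re} := convex_halfSpace_re_gt 0
  refine AnalyticOnNhd.eqOn_of_preconnected_of_eventuallyEq (𝕜 := ℂ) (U := {s : ℂ | 0 < s.re})
    (f := riemannZeta₁) (g := fun s => 1 + ∑' n, zetaCorrection n s) (z₀ := 2) ?_ ?_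
    hconv.isPreconnected (by simp) ?_ hs
  · exact differentiable_riemannZeta₁.differentiableOn.analyticOnNhd hUo
  · refine DifferentiableOn.analyticOnNhd (fun s hs => ?_) hUo
    exact ((differentiableAt_tsum_zetaCorrection hs).const_add 1).differentiableWithinAt
  · filter_upwards [(isOpen_lt continuous_const continuous_re).mem_nhds
      (show (1 : ℝ) < (2 : ℂ).re by simp)] with s hs
    exact riemannZeta₁_eq_of_one_lt_re hs

lemma riemannZeta₁_eq_sum_add {s : ℂ} (hs : 0 < s.re) (N : ℕ) :
    riemannZeta₁ s = (s - 1) * ∑ n ∈ Finset.range N, ((n + 1 : ℕ) : ℂ) ^ (-s)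
      + ((N + 1 : ℕ) : ℂ) ^ (1 - s) + ∑' n, zetaCorrection (n + N) s := by
  rw [riemannZeta₁_eq hs, ← (summable_zetaCorrection hs).sum_add_tsum_nat_add N,
    sum_range_zetaCorrection]
  ring

/-- Sub-polynomial growth of `ζ` slightly to the left of the line `re s = 1`. -/
lemma exists_norm_riemannZeta_le {ε : ℝ} (hε : 0 < ε) (hε2 : ε ≤ 1 / 2) :
    ∃ C > 0, ∀ s : ℂ, 1 - ε ≤ s.re → s.re ≤ 4 → 1 ≤ |s.im| →
      ‖riemannZeta s‖ ≤ C * |s.im| ^ (2 * ε) := by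
  set Z : ℝ := ∑' n : ℕ, ((n : ℝ) + 1) ^ (-1 - ε) with hZ
  have hsumm := summable_add_one_rpow (p := -1 - ε) (by linarith)
  have hZ0 : 0 ≤ Z := tsum_nonneg fun n => by positivity
  refine ⟨(6 * Z + 1) * 2 ^ (2 * ε), by positivity, fun s h1 h2 h3 => ?_⟩
  set t := |s.im| with ht
  have hs0 : 0 < s.re := by linarith
  have hs1 : s ≠ 1 := by
    rintro rfl
    simp [ht] at h3
    linarith
  set N : ℕ := ⌊t⌋₊ with hN
  have hN1 : (N : ℝ) ≤ t := Nat.floor_le (by linarith)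
  have hN2 : t ≤ (N : ℝ) + 1 := (Nat.lt_floor_add_one t).le
  set M : ℝ := (N : ℝ) + 1 with hM
  have hM1 : 1 ≤ M := by linarith
  have hM0 : 0 < M := by linarith
  have hts : t ≤ ‖s - 1‖ := by
    have := abs_im_le_norm (s - 1)
    simpa using this
  have hst : ‖s‖ ≤ 5 * t := by
    have := norm_le_abs_re_add_abs_im s
    rw [abs_of_pos hs0] at this
    linarith
  have b1 : ‖∑ n ∈ Finset.range N, ((n + 1 : ℕ) : ℂ) ^ (-s)‖ ≤ M ^ (2 * ε) * Z := by
    calc _ ≤ ∑ n ∈ Finset.range N, M ^ (2 * ε) * ((n : ℝ) + 1) ^ (-1 - ε) := by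
          refine norm_sum_le_of_le _ fun n hn => ?_
          rw [Complex.norm_natCast_cpow_of_pos (by omega)]
          have hn' : (n : ℝ) + 1 ≤ M := by
            have : (n : ℝ) + 1 ≤ N := by exact_mod_cast Finset.mem_range.1 hn
            linarith
          have hn1 : (1 : ℝ) ≤ (n : ℝ) + 1 := by linarith [show (0 : ℝ) ≤ n from n.cast_nonneg]
          calc ((n + 1 : ℕ) : ℝ) ^ (-s).re ≤ ((n : ℝ) + 1) ^ (2 * ε + (-1 - ε)) := by
                push_cast
                exact Real.rpow_le_rpow_of_exponent_le hn1 (by simp; linarith)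
            _ = ((n : ℝ) + 1) ^ (2 * ε) * ((n : ℝ) + 1) ^ (-1 - ε) := Real.rpow_add (by linarith) _ _
            _ ≤ _ := by gcongr
      _ = M ^ (2 * ε) * ∑ n ∈ Finset.range N, ((n : ℝ) + 1) ^ (-1 - ε) := by rw [Finset.mul_sum]
      _ ≤ _ := by
          gcongr
          exact hsumm.sum_le_tsum _ fun n _ => by positivity
  have b2 : ‖((N + 1 : ℕ) : ℂ) ^ (1 - s)‖ ≤ M ^ (2 * ε) := by
    rw [Complex.norm_natCast_cpow_of_pos (by omega)]
    push_cast
    exact Real.rpow_le_rpow_of_exponent_le hM1 (by simp; linarith)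
  have b3 : ‖∑' n, zetaCorrection (n + N) s‖ ≤ ‖s - 1‖ * (5 * M ^ (2 * ε) * Z) := by
    have hb : ∀ n : ℕ, ‖zetaCorrection (n + N) s‖ ≤
        ‖s - 1‖ * (5 * M ^ (2 * ε)) * ((n : ℝ) + 1) ^ (-1 - ε) := by
      intro n
      have hn0 : (0 : ℝ) ≤ n := n.cast_nonneg
      refine (norm_zetaCorrection_le _ hs0).trans ?_
      rw [mul_assoc, mul_assoc]
      gcongr ?_ * ?_
      have hpos : 0 < ((n + N : ℕ) : ℝ) + 1 := by positivity
      have hge1 : (n : ℝ) + 1 ≤ ((n + N : ℕ) : ℝ) + 1 := by push_cast; linarith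
      have hgeM : M ≤ ((n + N : ℕ) : ℝ) + 1 := by push_cast; linarith
      calc ‖s‖ * (((n + N : ℕ) : ℝ) + 1) ^ (-s.re - 1)
          ≤ (5 * M) * (((n + N : ℕ) : ℝ) + 1) ^ ((-1 + 2 * ε) + (-1 - ε)) := by
            gcongr
            · linarith
            · linarith
            · linarith
        _ = (5 * M) * ((((n + N : ℕ) : ℝ) + 1) ^ (-1 + 2 * ε) *
              (((n + N : ℕ) : ℝ) + 1) ^ (-1 - ε)) := by rw [Real.rpow_add hpos]
        _ ≤ (5 * M) * (M ^ (-1 + 2 * ε) * ((n : ℝ) + 1) ^ (-1 - ε)) := by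
            gcongr ?_ * (?_ * ?_)
            · exact Real.rpow_le_rpow_of_nonpos hM0 hgeM (by linarith)
            · exact Real.rpow_le_rpow_of_nonpos (by linarith) hge1 (by linarith)
        _ = _ := by
            rw [Real.rpow_add hM0, Real.rpow_neg_one]
            field_simp
    have := tsum_of_norm_bounded ((hsumm.hasSum).mul_left (‖s - 1‖ * (5 * M ^ (2 * ε)))) hb
    refine this.trans (le_of_eq ?_)
    ring
  have hbig : ‖s - 1‖ * ‖riemannZeta s‖ ≤ ‖s - 1‖ * ((6 * Z + 1) * M ^ (2 * ε)) := by
    rw [← norm_mul, riemannZeta_eq_inv_sub_mul hs1, ← mul_assoc,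
      mul_inv_cancel₀ (sub_ne_zero.2 hs1), one_mul, riemannZeta₁_eq_sum_add hs0 N]
    have hP : 0 ≤ M ^ (2 * ε) := by positivity
    calc _ ≤ ‖s - 1‖ * (M ^ (2 * ε) * Z) + M ^ (2 * ε) + ‖s - 1‖ * (5 * M ^ (2 * ε) * Z) := by
          refine (norm_add_le _ _).trans (add_le_add ((norm_add_le _ _).trans ?_) b3)
          rw [norm_mul]
          gcongr
      _ ≤ _ := by nlinarith
  have hpos : 0 < ‖s - 1‖ := by linarith
  refine (le_of_mul_le_mul_left hbig hpos).trans ?_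
  rw [mul_assoc, ← Real.mul_rpow (by norm_num) (by linarith)]
  gcongr
  linarith

end ZetaBounds

section ZetaBounds

open Complex Filter Topology

lemma exists_norm_deriv_riemannZeta_le {ε : ℝ} (hε : 0 < ε) (hε2 : ε ≤ 1 / 2) :
    ∃ C > 0, ∀ s : ℂ, 1 - ε / 2 ≤ s.re → s.re ≤ 3 → 2 ≤ |s.im| →
      ‖deriv riemannZeta s‖ ≤ C * |s.im| ^ (2 * ε) := by
  obtain ⟨C, hC, h⟩ := exists_norm_riemannZeta_le hε hε2
  refine ⟨C * 2 ^ (2 * ε) / (ε / 2), by positivity, fun s h1 h2 h3 => ?_⟩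
  have hR : 0 < ε / 2 := by positivity
  have hball : ∀ z ∈ Metric.closedBall s (ε / 2), 1 - ε ≤ z.re ∧ z.re ≤ 4 ∧ 1 ≤ |z.im| ∧
      |z.im| ≤ 2 * |s.im| := by
    intro z hz
    rw [Metric.mem_closedBall, dist_eq_norm] at hz
    have a1 := (abs_le.1 ((abs_re_le_norm (z - s)).trans hz))
    have a2 := (abs_im_le_norm (z - s)).trans hz
    rw [sub_re] at a1
    rw [sub_im] at a2
    have a3 := abs_sub_abs_le_abs_sub z.im s.im
    have a4 := abs_sub_abs_le_abs_sub s.im z.im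
    rw [abs_sub_comm] at a4
    refine ⟨?_, ?_, ?_, ?_⟩ <;> linarith
  have key := norm_deriv_le_of_forall_mem_sphere_norm_le (c := s) (f := riemannZeta)
    (C := C * (2 * |s.im|) ^ (2 * ε)) hR ?_ ?_
  · rw [Real.mul_rpow (by norm_num) (abs_nonneg _)] at key
    refine key.trans (le_of_eq ?_)
    ring
  · refine DifferentiableOn.diffContOnCl_ball (U := Metric.closedBall s (ε / 2)) ?_ subset_rfl
    intro z hz
    refine (differentiableAt_riemannZeta ?_).differentiableWithinAt
    rintro rfl
    have := (hball _ hz).2.2.1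
    simp at this
    linarith
  · intro z hz
    obtain ⟨b1, b2, b3, b4⟩ := hball z (Metric.sphere_subset_closedBall hz)
    refine (h z b1 b2 b3).trans ?_
    gcongr

lemma exists_norm_riemannZeta_one_add_le :
    ∃ C > 0, ∀ x : ℝ, 0 < x → x ≤ 2 → ‖riemannZeta (1 + x)‖ ≤ C / x := by
  have hcont : ContinuousOn (fun x : ℝ => riemannZeta₀ (1 + x)) (Set.Icc 0 2) := by
    have := differentiable_riemannZeta₀.continuous
    fun_prop
  obtain ⟨C, hC⟩ := isCompact_Icc.exists_bound_of_continuousOn hcont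
  have hC0 : 0 ≤ C := (norm_nonneg _).trans (hC 0 (by simp))
  refine ⟨1 + 2 * C, by positivity, fun x h0 h2 => ?_⟩
  have h1 : (1 : ℂ) + x ≠ 1 := by simpa using h0.ne'
  rw [riemannZeta_eq_inv_sub_add h1]
  have e1 : ‖((1 : ℂ) + x - 1)⁻¹‖ = 1 / x := by simp [abs_of_pos h0]
  refine (norm_add_le _ _).trans ?_
  rw [e1, add_div]
  gcongr
  refine (hC x ⟨h0.le, h2⟩).trans ?_
  rw [le_div_iff₀ h0]
  nlinarith

lemma one_le_norm_riemannZeta_product {x : ℝ} (hx : 0 < x) (y : ℝ) :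
    1 ≤ ‖riemannZeta (1 + x)‖ ^ 3 * ‖riemannZeta (1 + x + I * y)‖ ^ 4 *
      ‖riemannZeta (1 + x + 2 * I * y)‖ := by
  have := DirichletCharacter.norm_LFunction_product_ge_one (N := 1) 1 hx y
  simpa [DirichletCharacter.LFunctionTrivChar, DirichletCharacter.LFunction_modOne_eq]
    using this

/-- Bounds for `ζ`, `ζ'` and `1 / ζ` in a region slightly larger than `1 ≤ re s`. -/
lemma exists_riemannZeta_bounds {δ : ℝ} (hδ : 0 < δ) (hδ1 : δ ≤ 1) :
    ∃ c > 0, c ≤ 1 / 2 ∧ ∃ C > 0, ∀ s : ℂ, 1 - c * |s.im| ^ (-δ) ≤ s.re → s.re ≤ 3 →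
      3 ≤ |s.im| → c * |s.im| ^ (-δ) ≤ ‖riemannZeta s‖ ∧ ‖riemannZeta s‖ ≤ C * |s.im| ^ δ ∧
        ‖deriv riemannZeta s‖ ≤ C * |s.im| ^ δ := by
  set ε : ℝ := δ / 10 with hεdef
  have hε : 0 < ε := by positivity
  have hε2 : ε ≤ 1 / 2 := by linarith
  set e : ℝ := 2 * ε with he
  have he0 : 0 < e := by positivity
  obtain ⟨C₁, hC₁, h₁⟩ := exists_norm_riemannZeta_le hε hε2
  obtain ⟨C₂, hC₂, h₂⟩ := exists_norm_deriv_riemannZeta_le hε hε2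
  obtain ⟨C₃, hC₃, h₃⟩ := exists_norm_riemannZeta_one_add_le
  rw [← he] at h₁ h₂
  set D : ℝ := C₃ ^ 3 * (C₁ * 2) with hD
  have hD0 : 0 < D := by positivity
  set κ : ℝ := min (1 / (256 * C₂ ^ 4 * D)) (min (ε / 2) (1 / 2)) with hκ
  have hκ0 : 0 < κ := by positivity
  have hκ1 : κ ≤ 1 / (256 * C₂ ^ 4 * D) := min_le_left _ _
  have hκ2 : κ ≤ ε / 2 := (min_le_right _ _).trans (min_le_left _ _)
  have hκ3 : κ ≤ 1 / 2 := (min_le_right _ _).trans (min_le_right _ _)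
  set q : ℝ := 4 * κ * C₂ with hq
  have hq0 : 0 < q := by positivity
  have hqD : q ^ 4 * D ≤ κ ^ 3 := by
    rw [le_div_iff₀ (by positivity)] at hκ1
    calc q ^ 4 * D = κ ^ 3 * (κ * (256 * C₂ ^ 4 * D)) := by rw [hq]; ring
      _ ≤ κ ^ 3 * 1 := by gcongr
      _ = κ ^ 3 := mul_one _
  -- the bound to the right of `1 + κ |t| ^ (-5 e)`
  have right : ∀ x y : ℝ, 3 ≤ |y| → κ * |y| ^ (-(5 * e)) ≤ x → x ≤ 2 →
      q * |y| ^ (-(4 * e)) ≤ ‖riemannZeta (1 + x + I * y)‖ := by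
    intro x y hy hx hx2
    have hy0 : 0 < |y| := by linarith
    have hx0 : 0 < x := lt_of_lt_of_le (by positivity) hx
    have p := one_le_norm_riemannZeta_product hx0 y
    set w := ‖riemannZeta (1 + x + I * y)‖ with hw
    have b1 := h₃ x hx0 hx2
    have b2 : ‖riemannZeta (1 + x + 2 * I * y)‖ ≤ C₁ * 2 * |y| ^ e := by
      have := h₁ (1 + x + 2 * I * y) (by simp; linarith) (by simp; linarith)
        (by simp [abs_mul]; linarith)
      refine this.trans ?_
      have e1 : |(1 + (x : ℂ) + 2 * I * y).im| = 2 * |y| := by simp [abs_mul]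
      rw [e1, Real.mul_rpow (by norm_num) hy0.le, mul_assoc]
      gcongr
      calc (2 : ℝ) ^ e ≤ 2 ^ (1 : ℝ) := Real.rpow_le_rpow_of_exponent_le (by norm_num) (by linarith)
        _ = 2 := Real.rpow_one 2
    have p2 : 1 ≤ (C₃ / x) ^ 3 * w ^ 4 * (C₁ * 2 * |y| ^ e) := by
      refine p.trans ?_
      gcongr
    have p3 : x ^ 3 ≤ D * w ^ 4 * |y| ^ e := by
      have : (C₃ / x) ^ 3 * w ^ 4 * (C₁ * 2 * |y| ^ e) = D * w ^ 4 * |y| ^ e / x ^ 3 := by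
        rw [hD]; field_simp
      rwa [this, le_div_iff₀ (by positivity), one_mul] at p2
    have p4 : (κ * |y| ^ (-(5 * e))) ^ 3 ≤ D * w ^ 4 * |y| ^ e :=
      (pow_le_pow_left₀ (by positivity) hx 3).trans p3
    have e3 : (|y| ^ (-(5 * e))) ^ 3 = (|y| ^ (-(4 * e))) ^ 4 * |y| ^ e := by
      rw [← Real.rpow_natCast, ← Real.rpow_natCast, ← Real.rpow_mul hy0.le, ← Real.rpow_mul hy0.le,
        ← Real.rpow_add hy0]
      congr 1
      push_cast
      ring
    have p5 : D * (q * |y| ^ (-(4 * e))) ^ 4 ≤ D * w ^ 4 := by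
      have hpos : 0 < |y| ^ e := by positivity
      rw [mul_pow, e3, ← mul_assoc] at p4
      have := le_of_mul_le_mul_right p4 hpos
      refine le_trans ?_ this
      rw [mul_pow]
      nlinarith [show 0 ≤ (|y| ^ (-(4 * e))) ^ 4 by positivity]
    have p6 := le_of_mul_le_mul_left p5 hD0
    exact le_of_pow_le_pow_left₀ (by norm_num) (norm_nonneg _) p6
  have main : ∀ s : ℂ, 1 - κ * |s.im| ^ (-(5 * e)) ≤ s.re → s.re ≤ 3 → 3 ≤ |s.im| →
      q / 2 * |s.im| ^ (-(4 * e)) ≤ ‖riemannZeta s‖ := by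
    intro s hs1 hs2 hs3
    have hy0 : 0 < |s.im| := by linarith
    set x₀ := κ * |s.im| ^ (-(5 * e)) with hx₀
    have hx₀0 : 0 < x₀ := by positivity
    have hle1 : |s.im| ^ (-(5 * e)) ≤ 1 :=
      Real.rpow_le_one_of_one_le_of_nonpos (by linarith) (by linarith)
    have hx₀κ : x₀ ≤ κ := by
      calc x₀ ≤ κ * 1 := by rw [hx₀]; gcongr
        _ = κ := mul_one _
    have hq4 : 0 ≤ |s.im| ^ (-(4 * e)) := by positivity
    rcases le_total (1 + x₀) s.re with h | h
    · have := right (s.re - 1) s.im hs3 (by linarith) (by linarith)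
      have e1 : (1 : ℂ) + ((s.re - 1 : ℝ) : ℂ) + I * s.im = s := by
        apply Complex.ext <;> simp
      rw [e1] at this
      nlinarith
    · have hr := right x₀ s.im hs3 le_rfl (by linarith)
      set s' : ℂ := 1 + x₀ + I * s.im with hs'
      have hs're : s'.re = 1 + x₀ := by simp [hs']
      have hs'im : s'.im = s.im := by simp [hs']
      have hmv := Convex.norm_image_sub_le_of_norm_deriv_le (𝕜 := ℂ) (f := riemannZeta)
        (s := Set.Icc (1 - x₀) (1 + x₀) ×ℂ {s.im}) (x := s) (y := s') (C := C₂ * |s.im| ^ e)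
        ?_ ?_ (((convex_Icc _ _).linear_preimage reLm).inter ((convex_singleton _).linear_preimage imLm)) ?_ ?_
      · have hd : ‖s' - s‖ ≤ 2 * x₀ := by
          refine (norm_le_abs_re_add_abs_im _).trans ?_
          rw [sub_re, sub_im, hs're, hs'im, sub_self, abs_zero, add_zero, abs_of_nonneg] <;> linarith
        have hmv2 : ‖riemannZeta s' - riemannZeta s‖ ≤ q / 2 * |s.im| ^ (-(4 * e)) := by
          calc _ ≤ C₂ * |s.im| ^ e * (2 * x₀) := hmv.trans (by gcongr)
            _ = q / 2 * (|s.im| ^ e * |s.im| ^ (-(5 * e))) := by rw [hx₀, hq]; ring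
            _ = _ := by
              rw [← Real.rpow_add hy0]
              congr 2
              ring
        have tri := norm_sub_norm_le (riemannZeta s') (riemannZeta s)
        linarith
      · rintro z ⟨hz1, hz2⟩
        refine differentiableAt_riemannZeta ?_
        rintro rfl
        simp at hz2
        rw [← hz2] at hs3
        norm_num at hs3
      · rintro z ⟨hz1, hz2⟩
        have hz2' : z.im = s.im := hz2
        have := h₂ z (by linarith [hz1.1]) (by linarith [hz1.2]) (by rw [hz2']; linarith)
        rwa [hz2'] at this
      · exact ⟨⟨hs1, h⟩, rfl⟩
      · exact ⟨⟨by linarith, hs're.le⟩, hs'im⟩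
  refine ⟨min κ (q / 2), by positivity, (min_le_left _ _).trans hκ3, max C₁ C₂, by positivity,
    fun s hs1 hs2 hs3 => ?_⟩
  have hy1 : 1 ≤ |s.im| := by linarith
  have hδe : δ = 5 * e := by rw [he, hεdef]; ring
  have hs1' : 1 - κ * |s.im| ^ (-(5 * e)) ≤ s.re := by
    rw [← hδe]
    refine le_trans ?_ hs1
    gcongr
    exact min_le_left _ _
  have hle1 : κ * |s.im| ^ (-(5 * e)) ≤ ε / 2 := by
    have : |s.im| ^ (-(5 * e)) ≤ 1 :=
      Real.rpow_le_one_of_one_le_of_nonpos (by linarith) (by linarith)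
    calc _ ≤ κ * 1 := by gcongr
      _ ≤ ε / 2 := by linarith
  have hee : |s.im| ^ e ≤ |s.im| ^ δ := Real.rpow_le_rpow_of_exponent_le hy1 (by linarith)
  refine ⟨le_trans ?_ (main s hs1' hs2 hs3), ?_, ?_⟩
  · gcongr
    · exact min_le_right _ _
    · linarith
  · refine (h₁ s (by linarith) (by linarith) hy1).trans ?_
    gcongr
    exact le_max_left _ _
  · refine (h₂ s (by linarith) (by linarith) (by linarith)).trans ?_
    gcongr
    exact le_max_right _ _

/-- The analytic function equal to `-ζ'/ζ - ζ` away from `s = 1`. -/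
noncomputable def zetaDiff (s : ℂ) : ℂ := -(deriv riemannZeta₁ s / riemannZeta₁ s) - riemannZeta₀ s

lemma riemannZeta₁_ne_zero {s : ℂ} (hs : s ≠ 1) (h : riemannZeta s ≠ 0) : riemannZeta₁ s ≠ 0 := by
  intro h0
  rw [riemannZeta_eq_inv_sub_mul hs, h0, mul_zero] at h
  exact h rfl

lemma zetaDiff_eq {s : ℂ} (hs : s ≠ 1) (h : riemannZeta s ≠ 0) :
    zetaDiff s = -(deriv riemannZeta s / riemannZeta s) - riemannZeta s := by
  have h1 := riemannZeta₁_ne_zero hs h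
  have h2 := sub_ne_zero.2 hs
  have h3 : riemannZeta₀ s = riemannZeta s - (s - 1)⁻¹ := by
    rw [riemannZeta_eq_inv_sub_add hs]; ring
  rw [zetaDiff, deriv_riemannZeta_eq_neg_inv_sub_sq_mul_add hs, h3, riemannZeta_eq_inv_sub_mul hs]
  field_simp
  ring

lemma analyticOnNhd_zetaDiff : AnalyticOnNhd ℂ zetaDiff {s | riemannZeta₁ s ≠ 0} := by
  have h1 : AnalyticOnNhd ℂ riemannZeta₁ Set.univ :=
    differentiable_riemannZeta₁.differentiableOn.analyticOnNhd isOpen_univ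
  have h0 : AnalyticOnNhd ℂ riemannZeta₀ Set.univ :=
    differentiable_riemannZeta₀.differentiableOn.analyticOnNhd isOpen_univ
  intro s hs
  exact (((h1.deriv s trivial).div (h1 s trivial) hs).neg).sub (h0 s trivial)

lemma riemannZeta₁_ne_zero_of_one_le_re {s : ℂ} (hs : 1 ≤ s.re) : riemannZeta₁ s ≠ 0 := by
  rcases eq_or_ne s 1 with rfl | h
  · simp
  · exact riemannZeta₁_ne_zero h (riemannZeta_ne_zero_of_one_le_re hs)

lemma exists_norm_iteratedDeriv_zetaDiff_le_of_im (k : ℕ) :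
    ∃ C > 0, ∀ s : ℂ, 1 ≤ s.re → s.re ≤ 2 → 4 ≤ |s.im| →
      ‖iteratedDeriv k zetaDiff s‖ ≤ C * |s.im| ^ (1 / 2 : ℝ) := by
  set δ : ℝ := 1 / (2 * (k + 2)) with hδ
  have hδ0 : 0 < δ := by positivity
  have hδ1 : δ ≤ 1 := by
    rw [hδ, div_le_one (by positivity)]
    linarith [show (0 : ℝ) ≤ k from k.cast_nonneg]
  obtain ⟨c, hc, hc2, C, hC, h⟩ := exists_riemannZeta_bounds hδ0 hδ1
  refine ⟨k.factorial * (C * 2 / (c / 2) + C * 2) / (c / 2) ^ k, by positivity,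
    fun s h1 h2 h3 => ?_⟩
  set t := |s.im| with ht
  have ht0 : 0 < t := by linarith
  have htδ : 0 < t ^ (-δ) := by positivity
  have htδ1 : t ^ (-δ) ≤ 1 := Real.rpow_le_one_of_one_le_of_nonpos (by linarith) (by linarith)
  have ht1δ : 1 ≤ t ^ δ := Real.one_le_rpow (by linarith) hδ0.le
  set R : ℝ := c / 2 * t ^ (-δ) with hR
  have hR0 : 0 < R := by positivity
  have hR1 : R ≤ 1 / 4 := by nlinarith
  have h2δ : (2 : ℝ) ^ δ ≤ 2 := by
    calc (2 : ℝ) ^ δ ≤ 2 ^ (1 : ℝ) := Real.rpow_le_rpow_of_exponent_le (by norm_num) hδ1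
      _ = 2 := Real.rpow_one 2
  have hball : ∀ z ∈ Metric.closedBall s R, R ≤ ‖riemannZeta z‖ ∧
      ‖riemannZeta z‖ ≤ C * 2 * t ^ δ ∧ ‖deriv riemannZeta z‖ ≤ C * 2 * t ^ δ ∧ z ≠ 1 := by
    intro z hz
    rw [Metric.mem_closedBall, dist_eq_norm] at hz
    have a1 := (abs_le.1 ((abs_re_le_norm (z - s)).trans hz))
    have a2 := (abs_im_le_norm (z - s)).trans hz
    rw [sub_re] at a1
    rw [sub_im] at a2
    have a3 := abs_sub_abs_le_abs_sub z.im s.im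
    have a4 := abs_sub_abs_le_abs_sub s.im z.im
    rw [abs_sub_comm] at a4
    have a5 : |z.im| ≤ 2 * t := by linarith
    have a6 : 3 ≤ |z.im| := by linarith
    have a7 : R ≤ c * |z.im| ^ (-δ) := by
      have : (2 * t) ^ (-δ) ≤ |z.im| ^ (-δ) :=
        Real.rpow_le_rpow_of_nonpos (by linarith) a5 (by linarith)
      rw [Real.mul_rpow (by norm_num) ht0.le, Real.rpow_neg (by norm_num)] at this
      have h3 : (1 / 2 : ℝ) ≤ (2 ^ δ)⁻¹ := by
        rw [one_div]
        exact inv_anti₀ (by positivity) h2δ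
      calc R = c * (1 / 2 * t ^ (-δ)) := by rw [hR]; ring
        _ ≤ c * ((2 ^ δ)⁻¹ * t ^ (-δ)) := by gcongr
        _ ≤ _ := by gcongr
    obtain ⟨b1, b2, b3⟩ := h z (by linarith) (by linarith) a6
    have a8 : C * |z.im| ^ δ ≤ C * 2 * t ^ δ := by
      rw [mul_assoc]
      gcongr
      calc |z.im| ^ δ ≤ (2 * t) ^ δ := by gcongr
        _ = 2 ^ δ * t ^ δ := Real.mul_rpow (by norm_num) ht0.le
        _ ≤ _ := by gcongr
    refine ⟨a7.trans b1, b2.trans a8, b3.trans a8, ?_⟩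
    rintro rfl
    norm_num at a6
  have key := norm_iteratedDeriv_le_of_forall_mem_sphere_norm_le (c := s) (R := R)
    (f := zetaDiff) (C := (C * 2 / (c / 2) + C * 2) * t ^ (2 * δ)) k hR0 ?_ ?_
  · refine key.trans (le_of_eq ?_)
    rw [hR, mul_pow, ← Real.rpow_natCast (t ^ (-δ)), ← Real.rpow_mul ht0.le]
    have e1 : t ^ (1 / 2 : ℝ) = t ^ (2 * δ) / t ^ (-δ * k) := by
      rw [← Real.rpow_sub ht0]
      congr 1
      rw [hδ]
      field_simp
      ring
    rw [e1]
    have : 0 < t ^ (-δ * k) := by positivity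
    field_simp
  · refine DifferentiableOn.diffContOnCl_ball (U := Metric.closedBall s R) ?_ subset_rfl
    intro z hz
    obtain ⟨b1, -, -, b4⟩ := hball z hz
    exact (analyticOnNhd_zetaDiff z (riemannZeta₁_ne_zero b4
      (norm_pos_iff.1 (hR0.trans_le b1)))).differentiableAt.differentiableWithinAt
  · intro z hz
    obtain ⟨b1, b2, b3, b4⟩ := hball z (Metric.sphere_subset_closedBall hz)
    have hz0 : 0 < ‖riemannZeta z‖ := hR0.trans_le b1
    rw [zetaDiff_eq b4 (norm_pos_iff.1 hz0)]
    refine (norm_sub_le _ _).trans ?_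
    rw [norm_neg, norm_div]
    calc ‖deriv riemannZeta z‖ / ‖riemannZeta z‖ + ‖riemannZeta z‖
        ≤ C * 2 * t ^ δ / R + C * 2 * t ^ δ := by gcongr
      _ = C * 2 / (c / 2) * t ^ (2 * δ) + C * 2 * t ^ δ := by
          rw [hR, Real.rpow_neg ht0.le, two_mul, Real.rpow_add ht0]
          field_simp
      _ ≤ C * 2 / (c / 2) * t ^ (2 * δ) + C * 2 * t ^ (2 * δ) := by
          gcongr
          · linarith
          · linarith
      _ = _ := by ring

/-- Every derivative of `-ζ'/ζ - ζ` grows at most like `√|t|` in the strip `1 ≤ re s ≤ 2`. -/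
lemma exists_norm_iteratedDeriv_zetaDiff_le (k : ℕ) :
    ∃ C > 0, ∀ s : ℂ, 1 ≤ s.re → s.re ≤ 2 →
      ‖iteratedDeriv k zetaDiff s‖ ≤ C * (1 + |s.im|) ^ (1 / 2 : ℝ) := by
  obtain ⟨C₁, hC₁, h₁⟩ := exists_norm_iteratedDeriv_zetaDiff_le_of_im k
  have hcont : ContinuousOn (iteratedDeriv k zetaDiff)
      (Set.Icc (1 : ℝ) 2 ×ℂ Set.Icc (-4 : ℝ) 4) := by
    rw [iteratedDeriv_eq_iterate]
    refine (analyticOnNhd_zetaDiff.iterated_deriv k).continuousOn.mono ?_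
    rintro s ⟨hs, -⟩
    exact riemannZeta₁_ne_zero_of_one_le_re hs.1
  obtain ⟨C₂, hC₂⟩ := (isCompact_Icc.reProdIm isCompact_Icc).exists_bound_of_continuousOn hcont
  refine ⟨max C₁ C₂, by positivity, fun s h1 h2 => ?_⟩
  have hpow : 1 ≤ (1 + |s.im|) ^ (1 / 2 : ℝ) :=
    Real.one_le_rpow (by linarith [abs_nonneg s.im]) (by norm_num)
  rcases le_total 4 |s.im| with h | h
  · refine (h₁ s h1 h2 h).trans ?_
    gcongr
    · exact le_max_left _ _
    · linarith
  · have := hC₂ s ⟨⟨h1, h2⟩, abs_le.1 h⟩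
    have h3 : C₂ ≤ max C₁ C₂ := le_max_right _ _
    have h4 : 0 < max C₁ C₂ := by positivity
    nlinarith

end ZetaBounds

section SmoothedPerron

open Complex Filter Topology MeasureTheory

lemma hasMellin_max_one_sub {s : ℂ} (hs : 0 < s.re) :
    HasMellin (fun u : ℝ => ((max (1 - u) 0 : ℝ) : ℂ)) s (1 / (s * (s + 1))) := by
  have h1 := hasMellin_one_Ioc hs
  have h2 := hasMellin_cpow_Ioc 1 (s := s) (by simp; linarith)
  have h3 := hasMellin_sub h1.1 h2.1
  have hs0 : s ≠ 0 := by rintro rfl; simp at hs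
  have hs1 : s + 1 ≠ 0 := by
    intro h
    have := congrArg re h
    simp at this
    linarith
  have hEq : Set.EqOn (fun t : ℝ => (Set.Ioc (0 : ℝ) 1).indicator (fun _ => (1 : ℂ)) t -
      (Set.Ioc (0 : ℝ) 1).indicator (fun t : ℝ => (t : ℂ) ^ (1 : ℂ)) t)
      (fun u : ℝ => ((max (1 - u) 0 : ℝ) : ℂ)) (Set.Ioi 0) := by
    intro t ht
    have ht0 : (0 : ℝ) < t := ht
    by_cases h : t ≤ 1
    · have hm : t ∈ Set.Ioc (0 : ℝ) 1 := ⟨ht0, h⟩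
      simp [hm, max_eq_left (by linarith : (0 : ℝ) ≤ 1 - t)]
    · have hm : t ∉ Set.Ioc (0 : ℝ) 1 := fun h' => h h'.2
      simp only [Set.indicator_of_notMem hm, max_eq_right (by linarith : 1 - t ≤ 0)]
      simp
  have hc : ∀ s : ℂ, Set.EqOn (fun t : ℝ => (t : ℂ) ^ (s - 1) •
      ((Set.Ioc (0 : ℝ) 1).indicator (fun _ => (1 : ℂ)) t -
      (Set.Ioc (0 : ℝ) 1).indicator (fun t : ℝ => (t : ℂ) ^ (1 : ℂ)) t))
      (fun t : ℝ => (t : ℂ) ^ (s - 1) • ((max (1 - t) 0 : ℝ) : ℂ)) (Set.Ioi 0) := by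
    intro s t ht
    have := hEq ht
    simp only at this ⊢
    rw [this]
  refine ⟨h3.1.congr_fun (hc s) measurableSet_Ioi, ?_⟩
  rw [mellin, ← setIntegral_congr_fun measurableSet_Ioi (hc s)]
  refine h3.2.trans ?_
  rw [h1.2, h2.2]
  field_simp
  ring

lemma norm_one_div_mul_le {σ : ℝ} (hσ : 1 ≤ σ) (y : ℝ) :
    ‖1 / (((σ : ℂ) + y * I) * ((σ : ℂ) + y * I + 1))‖ ≤ 2 * (1 + ‖y‖) ^ (-2 : ℝ) := by
  have hy := norm_nonneg y
  have key : ∀ τ : ℝ, 1 ≤ τ → (1 + ‖y‖) ^ 2 ≤ 2 * ‖(τ : ℂ) + y * I‖ ^ 2 := by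
    intro τ hτ
    rw [Complex.sq_norm, Complex.normSq_add_mul_I]
    have : ‖y‖ ^ 2 = y ^ 2 := by simp
    nlinarith [sq_nonneg (1 - ‖y‖)]
  have k1 := key σ hσ
  have k2 := key (σ + 1) (by linarith)
  have e : ((σ + 1 : ℝ) : ℂ) + y * I = (σ : ℂ) + y * I + 1 := by push_cast; ring
  rw [e] at k2
  rw [norm_div, norm_mul, norm_one, Real.rpow_neg (by positivity), ← div_eq_mul_inv,
    Real.rpow_two]
  have k3 : (1 + ‖y‖) ^ 2 ≤ 2 * (‖(σ : ℂ) + y * I‖ * ‖(σ : ℂ) + y * I + 1‖) := by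
    refine (abs_le_of_sq_le_sq' ?_ (by positivity)).2
    nlinarith [mul_le_mul k1 k2 (by positivity) (by positivity)]
  have h0 : 0 < (1 + ‖y‖) ^ 2 := by positivity
  rw [div_le_div_iff₀ (by linarith) h0]
  linarith

lemma continuous_one_div_mul {σ : ℝ} (hσ : 1 ≤ σ) :
    Continuous fun y : ℝ => 1 / (((σ : ℂ) + y * I) * ((σ : ℂ) + y * I + 1)) := by
  refine Continuous.div (by fun_prop) (by fun_prop) fun y => mul_ne_zero ?_ ?_ <;> intro h <;>
  · have := congrArg re h
    simp at this
    linarith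

lemma integral_cpow_mul_one_div_mul {σ u : ℝ} (hσ : 1 ≤ σ) (hu : 0 < u) :
    ∫ y : ℝ, (u : ℂ) ^ (-((σ : ℂ) + y * I)) * (1 / (((σ : ℂ) + y * I) * ((σ : ℂ) + y * I + 1))) =
      2 * Real.pi * ((max (1 - u) 0 : ℝ) : ℂ) := by
  have hm : ∀ y : ℝ, mellin (fun u : ℝ => ((max (1 - u) 0 : ℝ) : ℂ)) ((σ : ℂ) + y * I) =
      1 / (((σ : ℂ) + y * I) * ((σ : ℂ) + y * I + 1)) := fun y =>
    (hasMellin_max_one_sub (by simp; linarith)).2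
  have h := mellinInv_mellin_eq σ (fun u : ℝ => ((max (1 - u) 0 : ℝ) : ℂ)) hu
    (hasMellin_max_one_sub (by simp; linarith)).1 ?_ (by fun_prop)
  · rw [mellinInv] at h
    simp only [hm, smul_eq_mul] at h
    have hπ : (Real.pi : ℂ) ≠ 0 := by exact_mod_cast Real.pi_ne_zero
    have e : 2 * (Real.pi : ℂ) * ((1 / (2 * Real.pi) : ℝ) : ℂ) = 1 := by
      push_cast
      field_simp
    rw [← h, real_smul, ← mul_assoc, e, one_mul]
  · unfold VerticalIntegrable
    simp only [hm]
    refine Integrable.mono' ((integrable_one_add_norm (E := ℝ) (r := 2) (by simp)).const_mul 2)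
      (continuous_one_div_mul hσ).aestronglyMeasurable (ae_of_all _ (norm_one_div_mul_le hσ))

lemma exists_norm_sum_mul_one_sub_le :
    ∃ C > 0, ∀ (b : ℕ → ℂ) (σ K x : ℝ), 1 ≤ σ → 0 < x → 0 ≤ K → LSeriesSummable b σ →
      (∀ y : ℝ, ‖LSeries b (σ + y * I)‖ ≤ K * (1 + |y|) ^ (1 / 2 : ℝ)) →
      ‖∑ n ∈ Finset.Ioc 0 ⌊x⌋₊, b n * ((1 - n / x : ℝ) : ℂ)‖ ≤ C * K * x ^ σ := by
  set J : ℝ := ∫ y : ℝ, 2 * (1 + ‖y‖) ^ (-(3 / 2) : ℝ) with hJ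
  have hJi : Integrable fun y : ℝ => 2 * (1 + ‖y‖) ^ (-(3 / 2) : ℝ) :=
    (integrable_one_add_norm (E := ℝ) (r := 3 / 2) (by norm_num)).const_mul 2
  have hJ0 : 0 ≤ J := integral_nonneg fun y => by positivity
  refine ⟨J + 1, by positivity, fun b σ K x hσ hx hK hb hL => ?_⟩
  set k : ℝ → ℂ := fun y => 1 / (((σ : ℂ) + y * I) * ((σ : ℂ) + y * I + 1)) with hk
  have hkc : Continuous k := continuous_one_div_mul hσ
  have hki : Integrable k :=
    Integrable.mono' ((integrable_one_add_norm (E := ℝ) (r := 2) (by simp)).const_mul 2)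
      hkc.aestronglyMeasurable (ae_of_all _ (norm_one_div_mul_le hσ))
  have hx' : (x : ℂ) ≠ 0 := by exact_mod_cast hx.ne'
  set F : ℕ → ℝ → ℂ := fun n y =>
    LSeries.term b ((σ : ℂ) + y * I) n * ((x : ℂ) ^ ((σ : ℂ) + y * I) * k y) with hF
  have hxn : ∀ y : ℝ, ‖(x : ℂ) ^ ((σ : ℂ) + y * I)‖ = x ^ σ := fun y => by
    rw [norm_cpow_eq_rpow_re_of_pos hx]; simp
  have htn : ∀ n (y : ℝ), ‖LSeries.term b ((σ : ℂ) + y * I) n‖ = ‖LSeries.term b σ n‖ :=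
    fun n y => by rw [LSeries.norm_term_eq, LSeries.norm_term_eq]; simp
  have hFn : ∀ n y, ‖F n y‖ = ‖LSeries.term b σ n‖ * x ^ σ * ‖k y‖ := fun n y => by
    rw [hF, norm_mul, norm_mul, hxn, htn, mul_assoc]
  have hFc : ∀ n, Continuous (F n) := by
    intro n
    rcases Nat.eq_zero_or_pos n with rfl | hn
    · simp only [hF, LSeries.term_zero, zero_mul]
      exact continuous_const
    · have hn' : (n : ℂ) ≠ 0 := by exact_mod_cast hn.ne'
      simp only [hF, LSeries.term_of_ne_zero hn.ne']
      refine Continuous.mul (Continuous.div continuous_const ?_ ?_) (Continuous.mul ?_ hkc)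
      · exact Continuous.const_cpow (by fun_prop) (Or.inl hn')
      · intro y
        simp [cpow_eq_zero_iff, hn']
      · exact Continuous.const_cpow (by fun_prop) (Or.inl hx')
  have hFi : ∀ n, Integrable (F n) := fun n =>
    Integrable.mono' (hki.norm.const_mul (‖LSeries.term b σ n‖ * x ^ σ))
      (hFc n).aestronglyMeasurable (ae_of_all _ fun y => (hFn n y).le)
  have hsum : Summable fun n => ∫ y, ‖F n y‖ := by
    simp only [hFn, integral_const_mul]
    exact ((hb.norm).mul_right _).mul_right _
  have hS := hasSum_integral_of_summable_integral_norm hFi hsum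
  have hint : ∀ n, ∫ y, F n y = if n = 0 then 0 else
      2 * Real.pi * (b n * ((max (1 - n / x) 0 : ℝ) : ℂ)) := by
    intro n
    rcases Nat.eq_zero_or_pos n with rfl | hn
    · simp [hF]
    · have hn' : (n : ℂ) ≠ 0 := by exact_mod_cast hn.ne'
      have hnr : (0 : ℝ) < n := by exact_mod_cast hn
      have e : ∀ y, F n y = b n * (((n / x : ℝ) : ℂ) ^ (-((σ : ℂ) + y * I)) * k y) := by
        intro y
        simp only [hF, LSeries.term_of_ne_zero hn.ne']
        push_cast
        rw [← ofReal_natCast, div_cpow_ofReal_nonneg hnr.le hx.le, cpow_neg, cpow_neg]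
        have h1 : (x : ℂ) ^ ((σ : ℂ) + y * I) ≠ 0 := by simp [cpow_eq_zero_iff, hx']
        have h2 : ((n : ℝ) : ℂ) ^ ((σ : ℂ) + y * I) ≠ 0 := by simp [cpow_eq_zero_iff, hn']
        field_simp
      simp only [e, integral_const_mul, if_neg hn.ne']
      rw [integral_cpow_mul_one_div_mul hσ (by positivity)]
      ring
  have hfin : HasSum (fun n => ∫ y, F n y)
      (2 * Real.pi * ∑ n ∈ Finset.Ioc 0 ⌊x⌋₊, b n * ((1 - n / x : ℝ) : ℂ)) := by
    rw [Finset.mul_sum]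
    have : ∀ n ∈ Finset.Ioc 0 ⌊x⌋₊, 2 * Real.pi * (b n * ((1 - n / x : ℝ) : ℂ)) =
        ∫ y, F n y := by
      intro n hn
      rw [Finset.mem_Ioc] at hn
      have h1 : (n : ℝ) ≤ x := (Nat.le_floor_iff hx.le).1 hn.2
      have h2 : (n : ℝ) / x ≤ 1 := (div_le_one hx).2 h1
      rw [hint, if_neg (by omega), max_eq_left (by linarith)]
    rw [Finset.sum_congr rfl this]
    refine hasSum_sum_of_ne_finset_zero fun n hn => ?_
    rw [hint]
    split_ifs with h0
    · rfl
    · rw [Finset.mem_Ioc, not_and_or, not_lt, not_le] at hn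
      rcases hn with hn | hn
      · omega
      · have h1 : x < n := (Nat.floor_lt hx.le).1 hn
        have h2 : 1 < (n : ℝ) / x := (one_lt_div hx).2 h1
        rw [max_eq_right (by linarith)]
        simp
  have hEq := hfin.unique hS
  have hbd : ∀ y, ‖∑' n, F n y‖ ≤ K * x ^ σ * (2 * (1 + ‖y‖) ^ (-(3 / 2) : ℝ)) := by
    intro y
    have e : ∑' n, F n y = LSeries b (σ + y * I) * ((x : ℂ) ^ ((σ : ℂ) + y * I) * k y) := by
      rw [LSeries, ← tsum_mul_right]
    rw [e, norm_mul, norm_mul, hxn]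
    have hy : 0 < 1 + ‖y‖ := by positivity
    calc _ ≤ (K * (1 + ‖y‖) ^ (1 / 2 : ℝ)) * (x ^ σ * (2 * (1 + ‖y‖) ^ (-2 : ℝ))) := by
          gcongr
          · exact hL y
          · exact norm_one_div_mul_le hσ y
      _ = K * x ^ σ * (2 * ((1 + ‖y‖) ^ (1 / 2 : ℝ) * (1 + ‖y‖) ^ (-2 : ℝ))) := by ring
      _ = _ := by rw [← Real.rpow_add hy]; norm_num
  have hI : ‖∫ y, ∑' n, F n y‖ ≤ K * x ^ σ * J := by
    refine (norm_integral_le_of_norm_le (hJi.const_mul (K * x ^ σ)) (ae_of_all _ hbd)).trans ?_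
    rw [integral_const_mul]
  rw [← hEq, norm_mul] at hI
  have h2π : 1 ≤ ‖(2 * Real.pi : ℂ)‖ := by
    rw [norm_mul, norm_real, Real.norm_of_nonneg Real.pi_pos.le]
    simp
    linarith [Real.pi_gt_three]
  have hxσ : 0 < x ^ σ := by positivity
  calc _ ≤ K * x ^ σ * J := by
        refine le_trans ?_ hI
        exact le_mul_of_one_le_left (norm_nonneg _) h2π
    _ ≤ (J + 1) * K * x ^ σ := by nlinarith [mul_nonneg hK hxσ.le]

lemma LSeriesSummable_vonMangoldt_sub_one {s : ℂ} (hs : 1 < s.re) :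
    LSeriesSummable (fun n => ((ArithmeticFunction.vonMangoldt n - 1 : ℝ) : ℂ)) s := by
  have := (ArithmeticFunction.LSeriesSummable_vonMangoldt hs).sub (LSeriesSummable_one_iff.2 hs)
  convert this using 2
  simp

lemma LSeries_vonMangoldt_sub_one {s : ℂ} (hs : 1 < s.re) :
    LSeries (fun n => ((ArithmeticFunction.vonMangoldt n - 1 : ℝ) : ℂ)) s = zetaDiff s := by
  have hs1 : s ≠ 1 := by rintro rfl; simp at hs
  rw [zetaDiff_eq hs1 (riemannZeta_ne_zero_of_one_le_re hs.le), ← LSeries_one_eq_riemannZeta hs,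
    ← neg_div, LSeries_one_eq_riemannZeta hs,
    ← ArithmeticFunction.LSeries_vonMangoldt_eq_deriv_riemannZeta_div hs,
    ← LSeries_one_eq_riemannZeta hs,
    ← LSeries_sub (ArithmeticFunction.LSeriesSummable_vonMangoldt hs) (LSeriesSummable_one_iff.2 hs)]
  congr 1
  ext n
  simp

lemma logMul_iterate (f : ℕ → ℝ) (k n : ℕ) :
    LSeries.logMul^[k] (fun n => (f n : ℂ)) n = ((f n * Real.log n ^ k : ℝ) : ℂ) := by
  induction k generalizing n with
  | zero => simp
  | succ k ih =>
    rw [Function.iterate_succ_apply', LSeries.logMul, ih, ← ofReal_natCast,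
      ← ofReal_log n.cast_nonneg]
    push_cast
    ring

lemma exists_abs_sum_vonMangoldt_sub_one_mul_log_pow_le (k : ℕ) :
    ∃ C > 0, ∀ x : ℝ, Real.exp 1 ≤ x →
      |∑ n ∈ Finset.Ioc 0 ⌊x⌋₊, (ArithmeticFunction.vonMangoldt n - 1) * Real.log n ^ k *
        (x - n)| ≤ C * x ^ 2 := by
  obtain ⟨C, hC, h⟩ := exists_norm_sum_mul_one_sub_le
  obtain ⟨K, hK, hK'⟩ := exists_norm_iteratedDeriv_zetaDiff_le k
  refine ⟨C * K * Real.exp 1, by positivity, fun x hx => ?_⟩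
  have hx0 : 0 < x := (Real.exp_pos 1).trans_le hx
  have hlog : 1 ≤ Real.log x := (Real.le_log_iff_exp_le hx0).2 hx
  set f : ℕ → ℂ := fun n => ((ArithmeticFunction.vonMangoldt n - 1 : ℝ) : ℂ) with hf
  set σ : ℝ := 1 + 1 / Real.log x with hσ
  have hσ1 : 1 < σ := by rw [hσ]; linarith [show 0 < 1 / Real.log x by positivity]
  have hσ2 : σ ≤ 2 := by
    have : 1 / Real.log x ≤ 1 := (div_le_one (by linarith)).2 hlog
    linarith
  have hab : LSeries.abscissaOfAbsConv f ≤ 1 :=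
    LSeries.abscissaOfAbsConv_le_of_forall_lt_LSeriesSummable fun y hy =>
      LSeriesSummable_vonMangoldt_sub_one (by simpa using hy)
  have hab' : ∀ s : ℂ, 1 < s.re → LSeries.abscissaOfAbsConv f < s.re := fun s hs =>
    hab.trans_lt (by exact_mod_cast hs)
  have hderiv : ∀ s : ℂ, 1 < s.re → LSeries (LSeries.logMul^[k] f) s =
      (-1) ^ k * iteratedDeriv k zetaDiff s := by
    intro s hs
    have h1 := LSeries_iteratedDeriv k (hab' s hs)
    have h2 : LSeries f =ᶠ[𝓝 s] zetaDiff := by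
      filter_upwards [(isOpen_lt continuous_const continuous_re).mem_nhds hs] with z hz
      exact LSeries_vonMangoldt_sub_one hz
    rw [← h2.iteratedDeriv_eq k, h1, ← mul_assoc, ← mul_pow]
    simp
  have hs := h (LSeries.logMul^[k] f) σ K x hσ1.le hx0 hK.le ?_ ?_
  · have e : ∑ n ∈ Finset.Ioc 0 ⌊x⌋₊, LSeries.logMul^[k] f n * ((1 - n / x : ℝ) : ℂ) =
        (((∑ n ∈ Finset.Ioc 0 ⌊x⌋₊, (ArithmeticFunction.vonMangoldt n - 1) * Real.log n ^ k *
        (x - n)) / x : ℝ) : ℂ) := by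
      rw [Finset.sum_div]
      push_cast
      refine Finset.sum_congr rfl fun n _ => ?_
      rw [hf, logMul_iterate]
      have : (x : ℂ) ≠ 0 := by exact_mod_cast hx0.ne'
      push_cast
      field_simp
    rw [e, norm_real, Real.norm_eq_abs, abs_div, abs_of_pos hx0, div_le_iff₀ hx0] at hs
    refine hs.trans (le_of_eq ?_)
    have : x ^ σ = x * Real.exp 1 := by
      rw [hσ, Real.rpow_add hx0, Real.rpow_one, Real.rpow_def_of_pos hx0]
      congr 2
      field_simp
    rw [this]
    ring
  · refine LSeriesSummable_of_abscissaOfAbsConv_lt_re ?_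
    rw [LSeries.absicssaOfAbsConv_logPowMul]
    exact hab' _ (by simpa using hσ1)
  · intro y
    rw [hderiv _ (by simpa using hσ1), norm_mul, norm_pow, norm_neg, norm_one, one_pow, one_mul]
    simpa using hK' ((σ : ℂ) + y * I) (by simpa using hσ1.le) (by simpa using hσ2)

end SmoothedPerron

section Unsmoothing

open Filter Topology

lemma le_sum_and_sum_le_of_neg_le {b : ℕ → ℝ} {x h L : ℝ} (hx : 0 ≤ x) (hh : 0 ≤ h) (hL : 0 ≤ L)
    (hb : ∀ n ∈ Finset.Ioc ⌊x⌋₊ ⌊x + h⌋₊, -L ≤ b n) :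
    h * ∑ n ∈ Finset.Ioc 0 ⌊x⌋₊, b n ≤
      (∑ n ∈ Finset.Ioc 0 ⌊x + h⌋₊, b n * (x + h - n)) -
        (∑ n ∈ Finset.Ioc 0 ⌊x⌋₊, b n * (x - n)) + h * (h + 1) * L ∧
    (∑ n ∈ Finset.Ioc 0 ⌊x + h⌋₊, b n * (x + h - n)) -
        (∑ n ∈ Finset.Ioc 0 ⌊x⌋₊, b n * (x - n)) - h * (h + 1) * L ≤
      h * ∑ n ∈ Finset.Ioc 0 ⌊x + h⌋₊, b n := by
  have hMN : ⌊x⌋₊ ≤ ⌊x + h⌋₊ := Nat.floor_mono (by linarith)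
  have hcard : (((Finset.Ioc ⌊x⌋₊ ⌊x + h⌋₊).card : ℕ) : ℝ) ≤ h + 1 := by
    rw [Nat.card_Ioc, Nat.cast_sub hMN]
    linarith [Nat.floor_le (by linarith : 0 ≤ x + h), Nat.lt_floor_add_one x]
  have hmem : ∀ n ∈ Finset.Ioc ⌊x⌋₊ ⌊x + h⌋₊, x < n ∧ (n : ℝ) ≤ x + h := by
    intro n hn
    rw [Finset.mem_Ioc] at hn
    exact ⟨(Nat.floor_lt hx).1 hn.1, (Nat.le_floor_iff (by linarith)).1 hn.2⟩
  have hbound : ∀ w : ℕ → ℝ, (∀ n ∈ Finset.Ioc ⌊x⌋₊ ⌊x + h⌋₊, 0 ≤ w n ∧ w n ≤ h) →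
      -(h * (h + 1) * L) ≤ ∑ n ∈ Finset.Ioc ⌊x⌋₊ ⌊x + h⌋₊, b n * w n := by
    intro w hw
    calc -(h * (h + 1) * L) ≤ (Finset.Ioc ⌊x⌋₊ ⌊x + h⌋₊).card • -(L * h) := by
          rw [nsmul_eq_mul]
          nlinarith [mul_nonneg hL hh]
      _ ≤ _ := by
          refine Finset.card_nsmul_le_sum _ _ _ fun n hn => ?_
          obtain ⟨h1, h2⟩ := hw n hn
          nlinarith [hb n hn, mul_le_mul_of_nonneg_left h2 hL]
  have e1 := Finset.sum_Ioc_consecutive (fun n => b n * (x + h - n)) (Nat.zero_le _) hMN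
  have e2 := Finset.sum_Ioc_consecutive b (Nat.zero_le _) hMN
  have e3 : ∑ n ∈ Finset.Ioc 0 ⌊x⌋₊, b n * (x + h - n) =
      ∑ n ∈ Finset.Ioc 0 ⌊x⌋₊, b n * (x - n) + h * ∑ n ∈ Finset.Ioc 0 ⌊x⌋₊, b n := by
    rw [Finset.mul_sum, ← Finset.sum_add_distrib]
    exact Finset.sum_congr rfl fun n _ => by ring
  have e4 : ∑ n ∈ Finset.Ioc ⌊x⌋₊ ⌊x + h⌋₊, b n * (x + h - n) =
      h * ∑ n ∈ Finset.Ioc ⌊x⌋₊ ⌊x + h⌋₊, b n -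
        ∑ n ∈ Finset.Ioc ⌊x⌋₊ ⌊x + h⌋₊, b n * (n - x) := by
    rw [Finset.mul_sum, ← Finset.sum_sub_distrib]
    exact Finset.sum_congr rfl fun n _ => by ring
  have b1 := hbound (fun n => x + h - n) fun n hn => by
    obtain ⟨h1, h2⟩ := hmem n hn
    constructor <;> linarith
  have b2 := hbound (fun n => n - x) fun n hn => by
    obtain ⟨h1, h2⟩ := hmem n hn
    constructor <;> linarith
  constructor
  · linarith
  · rw [← e2, mul_add]
    linarith

lemma eventually_log_pow_le (n : ℕ) : ∀ᶠ x : ℝ in atTop, Real.log x ^ n ≤ x := by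
  have h := (Real.isLittleO_pow_log_id_atTop (n := n)).bound one_pos
  filter_upwards [h, eventually_ge_atTop (0 : ℝ)] with x hx h0
  simpa [abs_of_nonneg h0] using (le_abs_self _).trans hx

lemma exists_abs_sum_vonMangoldt_sub_one_mul_log_pow_le_mul_log (j : ℕ) (hj : j ≠ 0) :
    ∃ C > 0, ∃ X : ℝ, 1 ≤ X ∧ ∀ x ≥ X,
      |∑ n ∈ Finset.Ioc 0 ⌊x⌋₊, (ArithmeticFunction.vonMangoldt n - 1) * Real.log n ^ (2 * j)| ≤
        C * (x * Real.log x ^ j) := by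
  obtain ⟨C, hC, h⟩ := exists_abs_sum_vonMangoldt_sub_one_mul_log_pow_le (2 * j)
  obtain ⟨X, hX⟩ := eventually_atTop.1 (eventually_log_pow_le j)
  refine ⟨5 * C + 2 * 2 ^ (2 * j), by positivity, max X (Real.exp 2),
    (Real.one_le_exp (by norm_num)).trans (le_max_right _ _), fun x hx => ?_⟩
  have hxe : Real.exp 2 ≤ x := (le_max_right _ _).trans hx
  have hxX := hX x ((le_max_left _ _).trans hx)
  have hx0 : 0 < x := (Real.exp_pos 2).trans_le hxe
  have hlog : 2 ≤ Real.log x := (Real.le_log_iff_exp_le hx0).2 hxe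
  have he2 : Real.exp 2 = Real.exp 1 * Real.exp 1 := by rw [← Real.exp_add]; norm_num
  have he1 : 2 ≤ Real.exp 1 := by linarith [Real.add_one_le_exp 1]
  set l := Real.log x ^ j with hl
  have hl2 : 2 ≤ l := hlog.trans (le_self_pow₀ (by linarith) hj)
  set b : ℕ → ℝ := fun n => (ArithmeticFunction.vonMangoldt n - 1) * Real.log n ^ (2 * j) with hb
  set H : ℝ := x / l with hH
  have hH0 : 0 < H := by positivity
  have hH1 : 1 ≤ H := by rwa [hH, one_le_div (by linarith)]
  have hH2 : H ≤ x / 2 := by rw [hH]; gcongr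
  have hHl : H * l = x := by rw [hH]; field_simp
  have hbL : ∀ (z : ℝ) (n : ℕ), n ≤ z → -(Real.log z ^ (2 * j)) ≤ b n := by
    intro z n hn
    rcases Nat.eq_zero_or_pos n with rfl | hn0
    · have : 0 ≤ Real.log z ^ (2 * j) := by rw [pow_mul]; positivity
      simpa [hb, hj] using this
    · have h1 : Real.log n ≤ Real.log z := Real.log_le_log (by exact_mod_cast hn0) hn
      have h0 : 0 ≤ Real.log n := Real.log_natCast_nonneg n
      have h2 : Real.log n ^ (2 * j) ≤ Real.log z ^ (2 * j) := by gcongr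
      have h3 := ArithmeticFunction.vonMangoldt_nonneg (n := n)
      have h4 : 0 ≤ Real.log n ^ (2 * j) := by positivity
      simp only [hb]
      nlinarith
  have hfl : ∀ z : ℝ, 0 ≤ z → ∀ a, ∀ n ∈ Finset.Ioc a ⌊z⌋₊, (n : ℝ) ≤ z := by
    intro z hz a n hn
    exact (Nat.le_floor_iff hz).1 (Finset.mem_Ioc.1 hn).2
  have up := (le_sum_and_sum_le_of_neg_le (b := b) (x := x) (h := H) (L := Real.log (x + H) ^ (2 * j))
    hx0.le hH0.le (by rw [pow_mul]; positivity)
    fun n hn => hbL _ _ (hfl _ (by linarith) _ n hn)).1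
  have lo := (le_sum_and_sum_le_of_neg_le (b := b) (x := x - H) (h := H)
    (L := Real.log (x - H + H) ^ (2 * j)) (by linarith) hH0.le (by rw [pow_mul]; positivity)
    fun n hn => hbL _ _ (hfl _ (by linarith) _ n hn)).2
  rw [sub_add_cancel] at lo
  have r1 := abs_le.1 (h x (by nlinarith))
  have r2 := abs_le.1 (h (x + H) (by nlinarith))
  have r3 := abs_le.1 (h (x - H) (by nlinarith))
  have hx2 : x ^ 2 = H * (x * l) := by rw [← hHl]; ring
  have q2 : (x + H) ^ 2 ≤ 4 * x ^ 2 := by nlinarith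
  have q3 : (x - H) ^ 2 ≤ x ^ 2 := by nlinarith
  have L1 : Real.log x ^ (2 * j) = l ^ 2 := by rw [hl, ← pow_mul, mul_comm]
  have L2 : Real.log (x + H) ^ (2 * j) ≤ 2 ^ (2 * j) * l ^ 2 := by
    rw [← L1, ← mul_pow]
    have : Real.log (x + H) ≤ 2 * Real.log x := by
      have : 2 * Real.log x = Real.log (x ^ 2) := by simp
      rw [this]
      exact Real.log_le_log (by linarith) (by nlinarith)
    have h0 : 0 ≤ Real.log (x + H) := Real.log_nonneg (by nlinarith)
    gcongr
  have e2 : (1 : ℝ) ≤ 2 ^ (2 * j) := one_le_pow₀ (by norm_num)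
  have hHl2 : H * (H + 1) * l ^ 2 ≤ 2 * (H * (x * l)) := by
    calc _ ≤ H * (2 * H) * l ^ 2 := by gcongr; linarith
      _ = 2 * (H * (H * l * l)) := by ring
      _ = _ := by rw [hHl]
  have hxl : 0 < x * l := by positivity
  have t1 : H * (H + 1) * Real.log (x + H) ^ (2 * j) ≤ 2 * 2 ^ (2 * j) * (H * (x * l)) := by
    calc _ ≤ H * (H + 1) * (2 ^ (2 * j) * l ^ 2) := by gcongr
      _ = 2 ^ (2 * j) * (H * (H + 1) * l ^ 2) := by ring
      _ ≤ 2 ^ (2 * j) * (2 * (H * (x * l))) := by gcongr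
      _ = _ := by ring
  have t2 : H * (H + 1) * Real.log x ^ (2 * j) ≤ 2 * 2 ^ (2 * j) * (H * (x * l)) := by
    rw [L1]
    refine hHl2.trans ?_
    rw [mul_assoc]
    have := le_mul_of_one_le_left (mul_pos hH0 hxl).le e2
    linarith
  have c2 : C * (x + H) ^ 2 ≤ 4 * (C * (H * (x * l))) := by
    rw [← hx2, mul_left_comm]
    exact mul_le_mul_of_nonneg_left q2 hC.le
  have c3 : C * (x - H) ^ 2 ≤ C * (H * (x * l)) := by
    rw [← hx2]
    exact mul_le_mul_of_nonneg_left q3 hC.le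
  have c1 : C * x ^ 2 = C * (H * (x * l)) := by rw [hx2]
  have c4 : 0 < C * (H * (x * l)) := by positivity
  rw [abs_le]
  constructor
  · refine le_of_mul_le_mul_left ?_ hH0
    have : H * -((5 * C + 2 * 2 ^ (2 * j)) * (x * l)) =
      -(5 * (C * (H * (x * l))) + 2 * 2 ^ (2 * j) * (H * (x * l))) := by ring
    rw [this]
    linarith [lo, r1.1, r3.2]
  · refine le_of_mul_le_mul_left ?_ hH0
    have : H * ((5 * C + 2 * 2 ^ (2 * j)) * (x * l)) =
      (5 * (C * (H * (x * l))) + 2 * 2 ^ (2 * j) * (H * (x * l))) := by ring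
    rw [this]
    linarith [up, r2.2, r1.1]

lemma abs_sum_mul_le_of_antitoneOn {b g : ℕ → ℝ} {M N : ℕ} {K : ℝ} (hMN : M ≤ N)
    (hb : ∀ n ∈ Finset.Icc M N, |∑ i ∈ Finset.Ioc M n, b i| ≤ K)
    (hg : AntitoneOn g (Set.Icc M N)) (hgN : 0 ≤ g N) :
    |∑ i ∈ Finset.Ioc M N, b i * g i| ≤ K * g M := by
  have key : ∀ n, M ≤ n → n ≤ N →
      |∑ i ∈ Finset.Ioc M n, b i * g i - (∑ i ∈ Finset.Ioc M n, b i) * g n| ≤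
        K * (g M - g n) := by
    intro n hn
    induction n, hn using Nat.le_induction with
    | base => simp
    | succ n hn ih =>
      intro hN
      have h1 := ih (by omega)
      have h2 := hb n (Finset.mem_Icc.2 ⟨hn, by omega⟩)
      have h3 : g (n + 1) ≤ g n := hg ⟨hn, by omega⟩ ⟨by omega, hN⟩ (by omega)
      rw [Finset.sum_Ioc_succ_top hn, Finset.sum_Ioc_succ_top hn]
      have e : ∑ i ∈ Finset.Ioc M n, b i * g i + b (n + 1) * g (n + 1) -
          (∑ i ∈ Finset.Ioc M n, b i + b (n + 1)) * g (n + 1) =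
          (∑ i ∈ Finset.Ioc M n, b i * g i - (∑ i ∈ Finset.Ioc M n, b i) * g n) +
          (∑ i ∈ Finset.Ioc M n, b i) * (g n - g (n + 1)) := by ring
      rw [e]
      refine (abs_add_le _ _).trans ?_
      rw [abs_mul, abs_of_nonneg (sub_nonneg.2 h3)]
      nlinarith [mul_le_mul_of_nonneg_right h2 (sub_nonneg.2 h3)]
  have h1 := key N hMN le_rfl
  have h2 := hb N (Finset.mem_Icc.2 ⟨hMN, le_rfl⟩)
  have h3 : |(∑ i ∈ Finset.Ioc M N, b i) * g N| ≤ K * g N := by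
    rw [abs_mul, abs_of_nonneg hgN]
    gcongr
  have := abs_add_le (∑ i ∈ Finset.Ioc M N, b i * g i - (∑ i ∈ Finset.Ioc M N, b i) * g N)
    ((∑ i ∈ Finset.Ioc M N, b i) * g N)
  rw [sub_add_cancel] at this
  linarith

/-- The prime number theorem with an error term saving an arbitrary power of the logarithm. -/
theorem exists_abs_theta_sub_le (j : ℕ) (hj : j ≠ 0) :
    ∃ C > 0, ∀ᶠ x : ℝ in atTop, |Chebyshev.theta x - x| ≤ C * (x / Real.log x ^ j) := by
  obtain ⟨C, hC, X, hX1, h⟩ := exists_abs_sum_vonMangoldt_sub_one_mul_log_pow_le_mul_log j hj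
  refine ⟨2 * C * 4 ^ (2 * j) + (Real.log 4 + 4 + 1 + 1 + 2), by positivity, ?_⟩
  filter_upwards [eventually_log_pow_le (2 * (j + 1)), eventually_ge_atTop ((X + 4) ^ 2)]
    with x hx1 hx2
  have hx16 : 16 ≤ x := by nlinarith
  have hx0 : 0 < x := by linarith
  have hlog : 1 ≤ Real.log x := by
    rw [Real.le_log_iff_exp_le hx0]
    linarith [Real.exp_one_lt_d9]
  have hs : Real.sqrt x ^ 2 = x := Real.sq_sqrt hx0.le
  set r := Real.sqrt x with hr
  have hr4 : X + 4 ≤ r := Real.le_sqrt_of_sq_le hx2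
  have hlr : Real.log x ^ (j + 1) ≤ r := by
    refine Real.le_sqrt_of_sq_le ?_
    rwa [← pow_mul, mul_comm (j + 1)]
  set l := Real.log x ^ j with hl
  have hl1 : 1 ≤ l := one_le_pow₀ hlog
  have hlr' : Real.log x * l ≤ r := by rwa [hl, ← pow_succ']
  have hrl : r * Real.log x ≤ x / l := by
    rw [le_div_iff₀ (by linarith)]
    nlinarith
  have hrx : r ≤ x / l := le_trans (by nlinarith) hrl
  set M := ⌊r⌋₊ with hM
  set N := ⌊x⌋₊ with hN
  have hMr : (M : ℝ) ≤ r := Nat.floor_le (by linarith)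
  have hMr' : r < M + 1 := Nat.lt_floor_add_one r
  have hNx : (N : ℝ) ≤ x := Nat.floor_le hx0.le
  have hNx' : x < N + 1 := Nat.lt_floor_add_one x
  have hMN : M ≤ N := Nat.floor_mono (by nlinarith)
  have hlogM : Real.log x / 4 ≤ Real.log M := by
    have h1 : Real.log x = 2 * Real.log r := by rw [← hs]; simp
    have h2 : Real.log r ≤ 2 * Real.log M := by
      have : 2 * Real.log M = Real.log ((M : ℝ) ^ 2) := by simp
      rw [this]
      exact Real.log_le_log (by linarith) (by nlinarith)
    linarith
  have hS : ∀ n : ℕ, M ≤ n → n ≤ N →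
      |∑ i ∈ Finset.Ioc 0 n, (ArithmeticFunction.vonMangoldt i - 1) * Real.log i ^ (2 * j)| ≤
        C * (x * l) := by
    intro n h1 h2
    have h1' : (M : ℝ) ≤ n := by exact_mod_cast h1
    have h2' : (n : ℝ) ≤ N := by exact_mod_cast h2
    have := h n (by linarith)
    rw [Nat.floor_natCast] at this
    refine this.trans ?_
    have h3 : 0 ≤ Real.log n := Real.log_natCast_nonneg n
    have h4 : Real.log n ≤ Real.log x := Real.log_le_log (by linarith) (by linarith)
    rw [hl]
    gcongr
    linarith
  have habel := abs_sum_mul_le_of_antitoneOn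
    (b := fun i => (ArithmeticFunction.vonMangoldt i - 1) * Real.log i ^ (2 * j))
    (g := fun i => (Real.log i ^ (2 * j))⁻¹) (K := 2 * (C * (x * l))) hMN ?_ ?_ ?_
  rotate_left
  · intro n hn
    rw [Finset.mem_Icc] at hn
    have h1 := abs_le.1 (hS n hn.1 hn.2)
    have h2 := abs_le.1 (hS M le_rfl hMN)
    rw [← Finset.sum_Ioc_consecutive _ (Nat.zero_le M) hn.1] at h1
    rw [abs_le]
    constructor <;> linarith [h1.1, h1.2, h2.1, h2.2]
  · intro m hm n hn hmn
    have h1 : (M : ℝ) ≤ m := by exact_mod_cast hm.1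
    have h2 : (m : ℝ) ≤ n := by exact_mod_cast hmn
    have h3 : 0 < Real.log m := Real.log_pos (by linarith)
    have h4 : Real.log m ≤ Real.log n := Real.log_le_log (by linarith) h2
    simp only
    gcongr
  · have : 0 ≤ Real.log N := Real.log_natCast_nonneg N
    positivity
  have hsum : ∑ i ∈ Finset.Ioc M N, (ArithmeticFunction.vonMangoldt i - 1) *
      Real.log i ^ (2 * j) * (Real.log i ^ (2 * j))⁻¹ =
      ∑ i ∈ Finset.Ioc M N, (ArithmeticFunction.vonMangoldt i - 1) := by
    refine Finset.sum_congr rfl fun i hi => ?_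
    have h1 : (M : ℝ) < i := by exact_mod_cast (Finset.mem_Ioc.1 hi).1
    have h3 : 0 < Real.log i := Real.log_pos (by linarith)
    exact mul_inv_cancel_right₀ (by positivity) _
  simp only [hsum] at habel
  have habel2 : |∑ i ∈ Finset.Ioc M N, (ArithmeticFunction.vonMangoldt i - 1)| ≤
      2 * C * 4 ^ (2 * j) * (x / l) := by
    refine habel.trans ?_
    have h0 : 0 < Real.log x / 4 := by positivity
    calc _ ≤ 2 * (C * (x * l)) * ((Real.log x / 4) ^ (2 * j))⁻¹ := by gcongr
      _ = _ := by
        rw [div_pow, mul_comm 2 j, pow_mul (Real.log x), ← hl]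
        field_simp
  have hψN : Chebyshev.psi x = ∑ i ∈ Finset.Ioc 0 N, ArithmeticFunction.vonMangoldt i := rfl
  have hψM : Chebyshev.psi r = ∑ i ∈ Finset.Ioc 0 M, ArithmeticFunction.vonMangoldt i := rfl
  have hψr := Chebyshev.psi_le_const_mul_self (x := r) (by linarith)
  have hψr0 := Chebyshev.psi_nonneg r
  have e1 := Finset.sum_Ioc_consecutive (fun i => ArithmeticFunction.vonMangoldt i)
    (Nat.zero_le M) hMN
  have e2 : ∑ i ∈ Finset.Ioc M N, (ArithmeticFunction.vonMangoldt i - 1) =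
      ∑ i ∈ Finset.Ioc M N, ArithmeticFunction.vonMangoldt i - (N - M) := by
    rw [Finset.sum_sub_distrib]
    simp [Nat.cast_sub hMN]
  have hth := Chebyshev.abs_psi_sub_theta_le_sqrt_mul_log (x := x) (by linarith)
  rw [← hr] at hth
  rw [e2] at habel2
  have h4 : 0 ≤ Real.log 4 + 4 := by positivity
  have h5 : (Real.log 4 + 4) * r ≤ (Real.log 4 + 4) * (x / l) := by gcongr
  rw [← hψN, ← hψM] at e1
  have t1 := abs_le.1 habel2
  have t2 := abs_le.1 hth
  rw [abs_le]
  constructor <;> linarith [t1.1, t1.2, t2.1, t2.2]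

end Unsmoothing

section VarianceIdentity

lemma card_filter_coprime_mod_eq {m : ℕ} (hm : 0 < m) (p : ℕ) :
    (((Finset.Icc 1 m).filter (fun ℓ => Nat.gcd ℓ m = 1)).filter
      (fun ℓ => p % m = ℓ % m)).card = if Nat.gcd p m = 1 then 1 else 0 := by
  split_ifs with h
  · rw [Finset.card_eq_one]
    refine ⟨if p % m = 0 then m else p % m, ?_⟩
    have hp : p % m < m := Nat.mod_lt _ hm
    ext ℓ
    simp only [Finset.mem_filter, Finset.mem_Icc, Finset.mem_singleton]
    constructor
    · rintro ⟨⟨⟨h1, h2⟩, -⟩, h4⟩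
      rcases h2.eq_or_lt with rfl | h2
      · simp [h4]
      · rw [Nat.mod_eq_of_lt h2] at h4
        rw [h4, if_neg (by omega)]
    · intro hl
      have hmod : p % m = ℓ % m := by
        rw [hl]
        split_ifs with h0
        · rw [h0, Nat.mod_self]
        · rw [Nat.mod_mod]
      refine ⟨⟨?_, ?_⟩, hmod⟩
      · rw [hl]
        split_ifs with h0 <;> omega
      · rw [← Nat.ModEq.gcd_eq (hmod : p ≡ ℓ [MOD m]), h]
  · rw [Finset.card_eq_zero, Finset.filter_eq_empty_iff]
    intro ℓ hl hmod
    rw [Finset.mem_filter] at hl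
    exact h (by rw [Nat.ModEq.gcd_eq (hmod : p ≡ ℓ [MOD m]), hl.2])

/-- The pairs of primes `p₁ < p₂ ≤ x` congruent modulo `m`, weighted by logarithms. -/
noncomputable def congruentPairSum (x : ℝ) (m : ℕ) : ℝ :=
  ∑ p₁ ∈ primesLe x, ∑ p₂ ∈ (primesLe x).filter (fun p₂ => p₁ < p₂ ∧ p₁ % m = p₂ % m),
    Real.log p₁ * Real.log p₂

lemma prime_of_mem_primesLe {x : ℝ} {p : ℕ} (hp : p ∈ primesLe x) : p.Prime :=
  (Finset.mem_filter.1 hp).2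

lemma gcd_eq_one_of_mod_eq {m p q : ℕ} (hp : p.Prime) (hq : q.Prime) (hpq : p ≠ q)
    (h : p % m = q % m) : Nat.gcd p m = 1 := by
  rw [← Nat.coprime_iff_gcd_eq_one, hp.coprime_iff_not_dvd]
  intro hd
  have : p ∣ q := (Nat.ModEq.dvd_iff (h : p ≡ q [MOD m]) hd).1 dvd_rfl
  exact hpq ((Nat.prime_dvd_prime_iff_eq hp hq).1 this)

lemma sum_sum_congruent_eq (x : ℝ) (m : ℕ) :
    ∑ p ∈ primesLe x, ∑ q ∈ primesLe x,
      (if p % m = q % m ∧ Nat.gcd p m = 1 then Real.log p * Real.log q else 0) =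
    2 * congruentPairSum x m +
      ∑ p ∈ (primesLe x).filter (fun p => Nat.gcd p m = 1), Real.log p ^ 2 := by
  set P := primesLe x with hP
  have hlt : ∑ p ∈ P, ∑ q ∈ P, (if p < q ∧ p % m = q % m then Real.log p * Real.log q else 0) =
      congruentPairSum x m := by
    simp only [congruentPairSum, Finset.sum_filter, ← hP]
  have hgt : ∑ p ∈ P, ∑ q ∈ P, (if q < p ∧ p % m = q % m then Real.log p * Real.log q else 0) =
      congruentPairSum x m := by
    rw [← hlt, Finset.sum_comm]
    refine Finset.sum_congr rfl fun p _ => Finset.sum_congr rfl fun q _ => ?_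
    simp only [mul_comm, eq_comm]
  have heq : ∑ p ∈ P, ∑ q ∈ P, (if p = q ∧ Nat.gcd p m = 1 then Real.log p * Real.log q else 0) =
      ∑ p ∈ P.filter (fun p => Nat.gcd p m = 1), Real.log p ^ 2 := by
    rw [Finset.sum_filter]
    refine Finset.sum_congr rfl fun p hp => ?_
    simp only [ite_and]
    rw [Finset.sum_ite_eq, if_pos hp, sq]
  rw [← heq, two_mul]
  nth_rewrite 1 [← hlt]
  rw [← hgt, ← Finset.sum_add_distrib, ← Finset.sum_add_distrib]
  refine Finset.sum_congr rfl fun p hp => ?_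
  rw [← Finset.sum_add_distrib, ← Finset.sum_add_distrib]
  refine Finset.sum_congr rfl fun q hq => ?_
  have hp' := prime_of_mem_primesLe hp
  have hq' := prime_of_mem_primesLe hq
  rcases lt_trichotomy p q with h | rfl | h
  · by_cases hm : p % m = q % m
    · simp [hm, h, h.ne, h.not_gt, gcd_eq_one_of_mod_eq hp' hq' h.ne hm]
    · simp [hm, h.ne]
  · simp
  · by_cases hm : p % m = q % m
    · simp [hm, h, h.ne', h.not_gt, gcd_eq_one_of_mod_eq hp' hq' h.ne' hm]
    · simp [hm, h.ne']

lemma sum_coprime_sum_filter_mod {m : ℕ} (hm : 0 < m) (P : Finset ℕ) (g : ℕ → ℝ) :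
    ∑ ℓ ∈ (Finset.Icc 1 m).filter (fun ℓ => Nat.gcd ℓ m = 1),
      ∑ p ∈ P.filter (fun p => p % m = ℓ % m), g p =
    ∑ p ∈ P.filter (fun p => Nat.gcd p m = 1), g p := by
  simp only [Finset.sum_filter (s := P)]
  rw [Finset.sum_comm]
  refine Finset.sum_congr rfl fun p _ => ?_
  rw [← Finset.sum_filter, Finset.sum_const, card_filter_coprime_mod_eq hm]
  split_ifs <;> simp

lemma card_coprime_Icc (m : ℕ) :
    ((Finset.Icc 1 m).filter (fun ℓ => Nat.gcd ℓ m = 1)).card = m.totient := by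
  rw [← Nat.filter_coprime_Ico_eq_totient m 1]
  congr 1
  ext ℓ
  simp only [Finset.mem_filter, Finset.mem_Icc, Finset.mem_Ico, Nat.coprime_comm (m := m),
    Nat.coprime_iff_gcd_eq_one]
  omega

lemma varSum_eq {x : ℝ} {m : ℕ} (hm : 0 < m) :
    varSum x m = 2 * congruentPairSum x m +
      ∑ p ∈ (primesLe x).filter (fun p => Nat.gcd p m = 1), Real.log p ^ 2 -
      2 * (x / m.totient) * ∑ p ∈ (primesLe x).filter (fun p => Nat.gcd p m = 1), Real.log p +
      x ^ 2 / m.totient := by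
  have hφ : (m.totient : ℝ) ≠ 0 := by exact_mod_cast (Nat.totient_pos.2 hm).ne'
  set R := (Finset.Icc 1 m).filter (fun ℓ => Nat.gcd ℓ m = 1) with hR
  set P := primesLe x with hP
  have hE : ∀ ℓ, Ef x m ℓ = ∑ p ∈ P.filter (fun p => p % m = ℓ % m), Real.log p -
      x / m.totient := by
    intro ℓ
    rw [Ef, hP, primesLe, Finset.filter_filter]
  have hsq : ∑ ℓ ∈ R, (∑ p ∈ P.filter (fun p => p % m = ℓ % m), Real.log p) ^ 2 =
      ∑ p ∈ P, ∑ q ∈ P,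
        (if p % m = q % m ∧ Nat.gcd p m = 1 then Real.log p * Real.log q else 0) := by
    have e : ∀ ℓ ∈ R, (∑ p ∈ P.filter (fun p => p % m = ℓ % m), Real.log p) ^ 2 =
        ∑ p ∈ P.filter (fun p => p % m = ℓ % m),
          ∑ q ∈ P, if p % m = q % m then Real.log p * Real.log q else 0 := by
      intro ℓ _
      rw [sq, Finset.sum_mul_sum]
      refine Finset.sum_congr rfl fun p hp => ?_
      rw [Finset.sum_filter]
      refine Finset.sum_congr rfl fun q _ => ?_
      rw [← (Finset.mem_filter.1 hp).2]
      simp only [eq_comm]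
    rw [Finset.sum_congr rfl e, sum_coprime_sum_filter_mod hm, Finset.sum_filter]
    refine Finset.sum_congr rfl fun p _ => ?_
    split_ifs with h <;> simp [h]
  have hcard : (R.card : ℝ) = m.totient := by rw [hR, card_coprime_Icc]
  rw [← sum_sum_congruent_eq, ← hP, ← hsq, ← sum_coprime_sum_filter_mod hm P, ← hR, varSum, ← hR,
    Finset.mul_sum, ← Finset.sum_sub_distrib]
  have : x ^ 2 / (m.totient : ℝ) = ∑ ℓ ∈ R, (x / m.totient) ^ 2 := by
    rw [Finset.sum_const, nsmul_eq_mul, hcard]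
    field_simp
  rw [this, ← Finset.sum_add_distrib]
  refine Finset.sum_congr rfl fun ℓ _ => ?_
  rw [hE]
  ring

lemma sum_log_primeFactors_le {m : ℕ} (hm : 0 < m) :
    ∑ p ∈ m.primeFactors, Real.log p ≤ Real.log m := by
  rw [← Real.log_prod (fun p hp => by
    exact_mod_cast (Nat.prime_of_mem_primeFactors hp).ne_zero), ← Nat.cast_prod]
  refine Real.log_le_log ?_ ?_
  · exact_mod_cast Finset.prod_pos fun p hp => (Nat.prime_of_mem_primeFactors hp).pos
  · exact_mod_cast Nat.le_of_dvd hm (Nat.prod_primeFactors_dvd m)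

lemma sum_primesLe_log (x : ℝ) : ∑ p ∈ primesLe x, Real.log p = Chebyshev.theta x := by
  rw [Chebyshev.theta_eq_sum_Icc, primesLe]
  congr 2
  ext n
  simp

lemma le_of_mem_primesLe {x : ℝ} (hx : 0 ≤ x) {p : ℕ} (hp : p ∈ primesLe x) : (p : ℝ) ≤ x := by
  have := (Finset.mem_filter.1 hp).1
  rw [Finset.mem_range, Nat.lt_succ_iff] at this
  exact (Nat.le_floor_iff hx).1 this

lemma sum_log_not_coprime_le {x : ℝ} {m : ℕ} (hm : 0 < m) :
    ∑ p ∈ (primesLe x).filter (fun p => ¬ Nat.gcd p m = 1), Real.log p ≤ Real.log m := by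
  refine le_trans ?_ (sum_log_primeFactors_le hm)
  refine Finset.sum_le_sum_of_subset_of_nonneg ?_ fun p _ _ => Real.log_natCast_nonneg p
  intro p hp
  rw [Finset.mem_filter] at hp
  have hpp := prime_of_mem_primesLe hp.1
  rw [← Nat.coprime_iff_gcd_eq_one, hpp.coprime_iff_not_dvd, not_not] at hp
  exact Nat.mem_primeFactors.2 ⟨hpp, hp.2, hm.ne'⟩

lemma abs_varSum_sub_le {x : ℝ} (hx : 1 ≤ x) {m : ℕ} (hm : 0 < m) :
    |varSum x m - (2 * congruentPairSum x m - x ^ 2 / m.totient +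
      ∑ p ∈ primesLe x, Real.log p ^ 2)| ≤
    Real.log x * Real.log m +
      2 * (x / m.totient) * (|Chebyshev.theta x - x| + Real.log m) := by
  have hD := sum_log_not_coprime_le (x := x) hm
  have hD0 : 0 ≤ ∑ p ∈ (primesLe x).filter (fun p => ¬ Nat.gcd p m = 1), Real.log p :=
    Finset.sum_nonneg fun p _ => Real.log_natCast_nonneg p
  have hsplit := Finset.sum_filter_add_sum_filter_not (primesLe x) (fun p => Nat.gcd p m = 1)
    (fun p => Real.log p)
  have hsplit2 := Finset.sum_filter_add_sum_filter_not (primesLe x) (fun p => Nat.gcd p m = 1)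
    (fun p => Real.log p ^ 2)
  rw [sum_primesLe_log] at hsplit
  have hL : 0 ≤ Real.log x := Real.log_nonneg hx
  have hQ : ∑ p ∈ (primesLe x).filter (fun p => ¬ Nat.gcd p m = 1), Real.log p ^ 2 ≤
      Real.log x * ∑ p ∈ (primesLe x).filter (fun p => ¬ Nat.gcd p m = 1), Real.log p := by
    rw [Finset.mul_sum]
    refine Finset.sum_le_sum fun p hp => ?_
    have hp := (Finset.mem_filter.1 hp).1
    have h1 := le_of_mem_primesLe (by linarith) hp
    have h2 : Real.log p ≤ Real.log x :=
      Real.log_le_log (by exact_mod_cast (prime_of_mem_primesLe hp).pos) h1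
    rw [sq]
    exact mul_le_mul_of_nonneg_right h2 (Real.log_natCast_nonneg p)
  have hQ0 : 0 ≤ ∑ p ∈ (primesLe x).filter (fun p => ¬ Nat.gcd p m = 1), Real.log p ^ 2 :=
    Finset.sum_nonneg fun p _ => sq_nonneg _
  set D := ∑ p ∈ (primesLe x).filter (fun p => ¬ Nat.gcd p m = 1), Real.log p
  set Qm := ∑ p ∈ (primesLe x).filter (fun p => ¬ Nat.gcd p m = 1), Real.log p ^ 2
  have e : varSum x m - (2 * congruentPairSum x m - x ^ 2 / m.totient +
      ∑ p ∈ primesLe x, Real.log p ^ 2) =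
      -Qm - 2 * (x / m.totient) * ((Chebyshev.theta x - x) - D) := by
    rw [varSum_eq hm, ← hsplit2, ← hsplit]
    ring
  rw [e]
  have hxφ : 0 ≤ 2 * (x / m.totient) := by positivity
  refine (abs_sub _ _).trans ?_
  rw [abs_neg, abs_of_nonneg hQ0, abs_mul, abs_of_nonneg hxφ]
  gcongr
  · exact hQ.trans (by gcongr)
  · refine (abs_sub _ _).trans ?_
    rw [abs_of_nonneg hD0]
    gcongr

end VarianceIdentity

section TotientBound

lemma prod_le_card_add_one_mul_prod_sub_one (s : Finset ℕ) (hs : ∀ a ∈ s, 2 ≤ a) :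
    ∏ a ∈ s, a ≤ (s.card + 1) * ∏ a ∈ s, (a - 1) := by
  induction s using Finset.induction_on_max with
  | empty => simp
  | insert a s hmax ih =>
    have ha : a ∉ s := fun h => lt_irrefl _ (hmax a h)
    have ih := ih fun b hb => hs b (Finset.mem_insert_of_mem hb)
    rw [Finset.prod_insert ha, Finset.prod_insert ha, Finset.card_insert_of_notMem ha]
    have hcard : s.card + 2 ≤ a := by
      have h2 := hs a (Finset.mem_insert_self a s)
      have : s ⊆ Finset.Ico 2 a := fun b hb =>
        Finset.mem_Ico.2 ⟨hs b (Finset.mem_insert_of_mem hb), hmax b hb⟩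
      have := Finset.card_le_card this
      rw [Nat.card_Ico] at this
      omega
    obtain ⟨d, rfl⟩ := Nat.exists_eq_add_of_le hcard
    have e : s.card + 2 + d - 1 = s.card + 1 + d := by omega
    rw [e]
    calc _ ≤ (s.card + 2 + d) * ((s.card + 1) * ∏ a ∈ s, (a - 1)) := by gcongr
      _ = ((s.card + 2 + d) * (s.card + 1)) * ∏ a ∈ s, (a - 1) := by ring
      _ ≤ ((s.card + 1 + 1) * (s.card + 1 + d)) * ∏ a ∈ s, (a - 1) := by
        gcongr ?_ * _
        nlinarith
      _ = _ := by ring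

lemma le_totient_mul_card_primeFactors_add_one (m : ℕ) :
    m ≤ m.totient * (m.primeFactors.card + 1) := by
  have h1 := Nat.totient_mul_prod_primeFactors m
  have h2 := prod_le_card_add_one_mul_prod_sub_one m.primeFactors fun p hp =>
    (Nat.prime_of_mem_primeFactors hp).two_le
  have h3 : 0 < ∏ p ∈ m.primeFactors, (p - 1) := Finset.prod_pos fun p hp =>
    Nat.sub_pos_of_lt (Nat.prime_of_mem_primeFactors hp).one_lt
  refine Nat.le_of_mul_le_mul_right ?_ h3
  rw [← h1, mul_assoc]
  gcongr

lemma card_primeFactors_le {m : ℕ} (hm : 0 < m) :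
    (m.primeFactors.card : ℝ) ≤ 2 * Real.log m := by
  have h1 : 2 ^ m.primeFactors.card ≤ m :=
    (Finset.pow_card_le_prod _ _ _ fun p hp => (Nat.prime_of_mem_primeFactors hp).two_le).trans
      (Nat.le_of_dvd hm (Nat.prod_primeFactors_dvd m))
  have h2 : Real.log ((2 : ℝ) ^ m.primeFactors.card) ≤ Real.log m :=
    Real.log_le_log (by positivity) (by exact_mod_cast h1)
  rw [Real.log_pow] at h2
  nlinarith [Real.log_two_gt_d9, show (0 : ℝ) ≤ m.primeFactors.card from Nat.cast_nonneg _]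

lemma one_div_totient_le {m : ℕ} (hm : 0 < m) :
    1 / (m.totient : ℝ) ≤ (2 * Real.log m + 1) / m := by
  have h1 : (m : ℝ) ≤ m.totient * (m.primeFactors.card + 1) := by
    exact_mod_cast le_totient_mul_card_primeFactors_add_one m
  have h2 := card_primeFactors_le hm
  have h3 : (0 : ℝ) < m.totient := by exact_mod_cast Nat.totient_pos.2 hm
  rw [div_le_div_iff₀ h3 (by exact_mod_cast hm), one_mul]
  calc (m : ℝ) ≤ m.totient * (m.primeFactors.card + 1) := h1
    _ ≤ m.totient * (2 * Real.log m + 1) := by gcongr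
    _ = _ := mul_comm _ _

end TotientBound

section PowerSum

lemma rpow_add_mul_sub_le {c a b : ℝ} (hc : 1 ≤ c) (ha : 0 < a) (hb : 0 ≤ b) :
    a ^ c + c * a ^ (c - 1) * (b - a) ≤ b ^ c := by
  have h := one_add_mul_self_le_rpow_one_add (s := b / a - 1) (by
    linarith [show 0 ≤ b / a by positivity]) hc
  rw [add_sub_cancel, Real.div_rpow hb ha.le, le_div_iff₀ (by positivity)] at h
  rw [Real.rpow_sub_one ha.ne']
  refine le_trans (le_of_eq ?_) h
  field_simp

lemma sum_mul_rpow_bounds {c : ℝ} (hc : 1 ≤ c) {M N : ℤ} (hM : 0 ≤ M) (hMN : M ≤ N) :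
    (N : ℝ) ^ c - (M : ℝ) ^ c ≤ ∑ k ∈ Finset.Ioc M N, c * (k : ℝ) ^ (c - 1) ∧
    ∑ k ∈ Finset.Ioc M N, c * (k : ℝ) ^ (c - 1) ≤ ((N : ℝ) + 1) ^ c - ((M : ℝ) + 1) ^ c := by
  induction N, hMN using Int.leInduction with
  | base => simp
  | succ n hn ih =>
    have hins : Finset.Ioc M (n + 1) = insert (n + 1) (Finset.Ioc M n) := by
      ext k
      simp only [Finset.mem_Ioc, Finset.mem_insert]
      omega
    rw [hins, Finset.sum_insert (by simp)]
    have hn0 : (0 : ℝ) ≤ n := by exact_mod_cast hM.trans hn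
    have h1 := rpow_add_mul_sub_le hc (a := (n : ℝ) + 1) (b := n) (by linarith) hn0
    have h2 := rpow_add_mul_sub_le hc (a := (n : ℝ) + 1) (b := (n : ℝ) + 1 + 1) (by linarith)
      (by linarith)
    push_cast
    constructor <;> linarith [ih.1, ih.2]

lemma abs_sum_mul_rpow_sub_le {c y₁ y : ℝ} (hc : 1 ≤ c) (hy₁ : 0 < y₁) (hy : y₁ ≤ y) :
    |∑ k ∈ Finset.Ioc ⌊y₁⌋ ⌊y⌋, c * (k : ℝ) ^ (c - 1) - y ^ c| ≤
      c * (y + 1) ^ (c - 1) + y₁ ^ c := by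
  have hy0 : 0 < y := hy₁.trans_le hy
  have hM : 0 ≤ ⌊y₁⌋ := Int.floor_nonneg.2 hy₁.le
  have hN : 0 ≤ ⌊y⌋ := Int.floor_nonneg.2 hy0.le
  have hM' : (0 : ℝ) ≤ (⌊y₁⌋ : ℝ) := by exact_mod_cast hM
  have hN' : (0 : ℝ) ≤ (⌊y⌋ : ℝ) := by exact_mod_cast hN
  obtain ⟨h1, h2⟩ := sum_mul_rpow_bounds hc hM (Int.floor_mono hy)
  have h3 : (⌊y₁⌋ : ℝ) ^ c ≤ y₁ ^ c :=
    Real.rpow_le_rpow hM' (Int.floor_le y₁) (by linarith)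
  have h4 : ((⌊y⌋ : ℝ) + 1) ^ c ≤ (y + 1) ^ c :=
    Real.rpow_le_rpow (by linarith) (by linarith [Int.floor_le y]) (by linarith)
  have h5 : 0 ≤ ((⌊y₁⌋ : ℝ) + 1) ^ c := Real.rpow_nonneg (by linarith) _
  have h6 := rpow_add_mul_sub_le hc hy0 hN'
  have h7 := rpow_add_mul_sub_le hc (a := y + 1) (by linarith) hy0.le
  have h8 : y ^ (c - 1) ≤ (y + 1) ^ (c - 1) :=
    Real.rpow_le_rpow hy0.le (by linarith) (by linarith)
  have h9 : 0 ≤ y ^ (c - 1) := Real.rpow_nonneg hy0.le _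
  have h10 : -(c * y ^ (c - 1)) ≤ c * y ^ (c - 1) * (⌊y⌋ - y) := by
    nlinarith [Int.sub_one_lt_floor y, mul_nonneg (by linarith : 0 ≤ c) h9]
  have h11 : c * y ^ (c - 1) ≤ c * (y + 1) ^ (c - 1) := by gcongr
  have h12 : 0 ≤ y₁ ^ c := Real.rpow_nonneg hy₁.le _
  rw [abs_le]
  constructor <;> linarith

lemma mul_rpow_sub_one_le {c x y l : ℝ} (hc : 1 ≤ c) (hy : 1 ≤ y) (hl : 0 < l) (hly : l ≤ y)
    (hx : y ^ c ≤ x) : c * (y + 1) ^ (c - 1) ≤ c * 2 ^ c * (x * l⁻¹) := by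
  have h1 : (y + 1) ^ c ≤ 2 ^ c * x := by
    calc (y + 1) ^ c ≤ (2 * y) ^ c :=
          Real.rpow_le_rpow (by linarith) (by linarith) (by linarith)
      _ = 2 ^ c * y ^ c := Real.mul_rpow (by norm_num) (by linarith)
      _ ≤ _ := by gcongr
  have hx0 : 0 ≤ x := (Real.rpow_nonneg (by linarith) _).trans hx
  rw [Real.rpow_sub_one (by linarith), mul_assoc, ← mul_assoc (2 ^ c), ← div_eq_mul_inv]
  have : (y + 1) ^ c / (y + 1) ≤ 2 ^ c * x / l := by gcongr; linarith
  gcongr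

end PowerSum

section Assembly

open Filter

lemma eventually_log_rpow_le (r : ℝ) : ∀ᶠ x : ℝ in atTop, Real.log x ^ r ≤ x := by
  have h := (isLittleO_log_rpow_rpow_atTop r one_pos).bound one_pos
  filter_upwards [h, eventually_ge_atTop (0 : ℝ)] with x hx h0
  simpa [abs_of_nonneg h0] using (le_abs_self _).trans hx

lemma sum_primesLe_log_sq_le {x : ℝ} (hx : 1 ≤ x) :
    ∑ p ∈ primesLe x, Real.log p ^ 2 ≤ 2 * (x * Real.log x) := by
  have hL : 0 ≤ Real.log x := Real.log_nonneg hx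
  have h4 : Real.log 4 ≤ 2 := by
    rw [show (4 : ℝ) = 2 ^ 2 by norm_num, Real.log_pow]
    norm_num
    linarith [Real.log_two_lt_d9]
  calc ∑ p ∈ primesLe x, Real.log p ^ 2 ≤ ∑ p ∈ primesLe x, Real.log x * Real.log p := by
        refine Finset.sum_le_sum fun p hp => ?_
        have h2 : Real.log p ≤ Real.log x :=
          Real.log_le_log (by exact_mod_cast (prime_of_mem_primesLe hp).pos)
            (le_of_mem_primesLe (by linarith) hp)
        rw [sq]
        exact mul_le_mul_of_nonneg_right h2 (Real.log_natCast_nonneg p)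
    _ = Real.log x * Chebyshev.theta x := by rw [← Finset.mul_sum, sum_primesLe_log]
    _ ≤ Real.log x * (2 * x) := by
        gcongr
        exact (Chebyshev.theta_le_log4_mul_x (by linarith)).trans (by gcongr)
    _ = _ := by ring

lemma Vprime_sub_eq (c x y₁ y : ℝ) :
    Vprime c x y₁ y - (2 * S0 c x y₁ y - x ^ 2 * PhiF c y₁ y +
      (⌊y ^ c⌋₊ : ℝ) * ∑ p ∈ primesLe x, Real.log p ^ 2) =
    ∑ k ∈ Finset.Ioc ⌊y₁⌋ ⌊y⌋, c * (k : ℝ) ^ (c - 1) *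
      (varSum x (fc c k) - (2 * congruentPairSum x (fc c k) - x ^ 2 / (fc c k).totient +
        ∑ p ∈ primesLe x, Real.log p ^ 2)) +
    (∑ k ∈ Finset.Ioc ⌊y₁⌋ ⌊y⌋, c * (k : ℝ) ^ (c - 1) - ⌊y ^ c⌋₊) *
      ∑ p ∈ primesLe x, Real.log p ^ 2 := by
  have hS : S0 c x y₁ y = ∑ k ∈ Finset.Ioc ⌊y₁⌋ ⌊y⌋, c * (k : ℝ) ^ (c - 1) *
    congruentPairSum x (fc c k) := rfl
  rw [hS, Vprime, PhiF, sub_mul, Finset.sum_mul]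
  simp only [mul_sub, mul_add, Finset.sum_sub_distrib, Finset.sum_add_distrib, Finset.mul_sum]
  have e1 : ∑ k ∈ Finset.Ioc ⌊y₁⌋ ⌊y⌋, 2 * (c * (k : ℝ) ^ (c - 1) * congruentPairSum x (fc c k)) =
    ∑ k ∈ Finset.Ioc ⌊y₁⌋ ⌊y⌋, c * (k : ℝ) ^ (c - 1) * (2 * congruentPairSum x (fc c k)) :=
    Finset.sum_congr rfl fun k _ => by ring
  have e2 : ∑ k ∈ Finset.Ioc ⌊y₁⌋ ⌊y⌋,
      x ^ 2 * (c * (k : ℝ) ^ (c - 1) / ((fc c k).totient : ℝ)) =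
    ∑ k ∈ Finset.Ioc ⌊y₁⌋ ⌊y⌋, c * (k : ℝ) ^ (c - 1) * (x ^ 2 / (fc c k).totient) :=
    Finset.sum_congr rfl fun k _ => by ring
  rw [e1, e2]
  ring

lemma abs_varSum_sub_le_of_le {x l T : ℝ} {m : ℕ} (hx : 1 ≤ x) (hL : 1 ≤ Real.log x)
    (hl : 0 < l) (hm : x * l⁻¹ / 2 ≤ m) (hmx : (m : ℝ) ≤ x)
    (hT : |Chebyshev.theta x - x| ≤ T) :
    |varSum x m - (2 * congruentPairSum x m - x ^ 2 / m.totient +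
      ∑ p ∈ primesLe x, Real.log p ^ 2)| ≤
    Real.log x ^ 2 + 12 * (l * Real.log x) * (T + Real.log x) := by
  have hx0 : 0 < x := by linarith
  have hm0' : (0 : ℝ) < m := lt_of_lt_of_le (by positivity) hm
  have hm0 : 0 < m := by exact_mod_cast hm0'
  have hlog : Real.log m ≤ Real.log x := Real.log_le_log hm0' hmx
  have hlog0 : 0 ≤ Real.log m := Real.log_natCast_nonneg m
  refine (abs_varSum_sub_le hx hm0).trans ?_
  have hφ : x / m.totient ≤ 6 * (l * Real.log x) := by
    calc x / (m.totient : ℝ) = x * (1 / m.totient) := by ring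
      _ ≤ x * ((2 * Real.log m + 1) / m) :=
        mul_le_mul_of_nonneg_left (one_div_totient_le hm0) hx0.le
      _ ≤ x * (3 * Real.log x / (x * l⁻¹ / 2)) := by
        gcongr
        linarith
      _ = _ := by
        field_simp
        norm_num
  calc _ ≤ Real.log x * Real.log x + 2 * (6 * (l * Real.log x)) * (T + Real.log x) := by
        gcongr
    _ = _ := by ring

lemma error_le {x A L C : ℝ} {j : ℕ} (hx : 0 ≤ x) (hA : 1 < A) (hC : 0 < C) (hL : 13 ≤ L)
    (hj : 2 * A + 2 ≤ j) (h1 : L ^ (2 * A + 4) ≤ x) :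
    L ^ 2 + 12 * (L ^ (A + 1) * L) * (C * (x / L ^ j) + L) ≤
      (1 + 12 * C) * (x * L ^ (-A)) := by
  have hL0 : 0 < L := by linarith
  have e1 : L ^ (A + 1) * L = L ^ (A + 2) := by
    rw [show A + 2 = A + 1 + 1 by ring, Real.rpow_add_one hL0.ne' (A + 1)]
  have e2 : L ^ (A + 2) * L = L ^ (A + 3) := by
    rw [show A + 3 = A + 2 + 1 by ring, Real.rpow_add_one hL0.ne' (A + 2)]
  have e3 : L ^ (A + 3) * L = L ^ (A + 4) := by
    rw [show A + 4 = A + 3 + 1 by ring, Real.rpow_add_one hL0.ne' (A + 3)]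
  have h2 : L ^ 2 ≤ L ^ (A + 3) := by
    rw [← Real.rpow_two]
    exact Real.rpow_le_rpow_of_exponent_le (by linarith) (by linarith)
  have h3 : L ^ (A + 4) ≤ x * L ^ (-A) := by
    have : L ^ (A + 4) = L ^ (2 * A + 4) * L ^ (-A) := by
      rw [← Real.rpow_add hL0]
      congr 1
      ring
    rw [this]
    gcongr
  have h4 : L ^ (A + 2) * (x / L ^ j) ≤ x * L ^ (-A) := by
    have h5 : L ^ (A + 2) * L ^ A ≤ L ^ j := by
      rw [← Real.rpow_add hL0, ← Real.rpow_natCast]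
      exact Real.rpow_le_rpow_of_exponent_le (by linarith) (by linarith)
    have h6 : 0 < L ^ A := by positivity
    rw [Real.rpow_neg hL0.le, ← div_eq_mul_inv, ← mul_div_assoc,
      div_le_div_iff₀ (by positivity) h6]
    nlinarith
  have h7 : 0 < L ^ (A + 3) := by positivity
  rw [e1]
  calc L ^ 2 + 12 * L ^ (A + 2) * (C * (x / L ^ j) + L) =
        L ^ 2 + 12 * (L ^ (A + 2) * L) + 12 * C * (L ^ (A + 2) * (x / L ^ j)) := by ring
    _ ≤ x * L ^ (-A) + 12 * C * (x * L ^ (-A)) := by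
      rw [e2]
      gcongr
      nlinarith
    _ = _ := by ring

end Assembly

theorem statement18 (c : ℝ) (hc : 1 < c) (hcne : ∀ n : ℤ, c ≠ (n : ℝ)) (A : ℝ) (hA : 1 < A) :
    ∃ B : ℝ, 0 < B ∧ ∃ κ > (0:ℝ), ∃ x₀ : ℝ, 2 ≤ x₀ ∧ ∀ x : ℝ, x₀ ≤ x →
      ∀ y₁ : ℝ, 0 < y₁ → y₁ ^ c = x * Real.log x ^ (-B) →
        ∀ y : ℝ, y₁ < y → y ^ c ≤ x →
          |Vprime c x y₁ y
              - (2 * S0 c x y₁ y - x ^ 2 * PhiF c y₁ y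
                  + (⌊y ^ c⌋₊ : ℝ) * ∑ p ∈ primesLe x, Real.log p ^ 2)|
            ≤ κ * x ^ 2 * Real.log x ^ (-A) := by
  obtain ⟨C, hC, hθ⟩ := exists_abs_theta_sub_le ⌈2 * A + 2⌉₊ (Nat.ceil_pos.2 (by linarith)).ne'
  set j := ⌈2 * A + 2⌉₊ with hj
  have hjA : 2 * A + 2 ≤ j := Nat.le_ceil _
  obtain ⟨X, hX⟩ := Filter.eventually_atTop.1 (hθ.and ((eventually_log_rpow_le (2 * A + 4)).and
    ((eventually_log_rpow_le ((A + 1) * (c + 1))).and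
      (Real.tendsto_log_atTop.eventually_ge_atTop 13))))
  set D : ℝ := c * 2 ^ c with hD
  have hD0 : 0 < D := by positivity
  refine ⟨A + 1, by linarith, (2 + D) * (1 + 12 * C) + 2 * (D + 2), by positivity, max X 2,
    le_max_right _ _, fun x hx y₁ hy₁ hy₁x y hy hyx => ?_⟩
  obtain ⟨hθx, hx1, hx2, hL⟩ := hX x ((le_max_left _ _).trans hx)
  have hx2' : 2 ≤ x := (le_max_right _ _).trans hx
  have hx0 : 0 < x := by linarith
  set L := Real.log x with hLdef
  have hL0 : 0 < L := by linarith
  set l := L ^ (A + 1) with hl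
  have hl0 : 0 < l := by positivity
  have hl1 : 1 ≤ l := Real.one_le_rpow (by linarith) (by linarith)
  rw [Real.rpow_neg hL0.le, ← hl] at hy₁x
  have hy0 : 0 < y := hy₁.trans hy
  have hlL : l * L ≤ x := by
    refine le_trans ?_ hx1
    rw [hl, ← Real.rpow_add_one hL0.ne']
    exact Real.rpow_le_rpow_of_exponent_le (by linarith) (by linarith)
  have hxl : L ≤ x * l⁻¹ := by
    rw [← div_eq_mul_inv, le_div_iff₀ hl0]
    linarith
  have hxlx : x * l⁻¹ ≤ x := mul_le_of_le_one_right hx0.le (inv_le_one_of_one_le₀ hl1)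
  have hly : l ≤ y := by
    refine le_trans ?_ hy.le
    refine (Real.rpow_le_rpow_iff hl0.le hy₁.le (by linarith : 0 < c)).1 ?_
    rw [hy₁x, ← div_eq_mul_inv, le_div_iff₀ hl0, ← Real.rpow_add_one hl0.ne', hl,
      ← Real.rpow_mul hL0.le]
    exact hx2
  have hW := abs_sum_mul_rpow_sub_le hc.le hy₁ hy.le
  have hW2 := mul_rpow_sub_one_le hc.le (hl1.trans hly) hl0 hly hyx
  rw [← hD] at hW2
  set W := ∑ k ∈ Finset.Ioc ⌊y₁⌋ ⌊y⌋, c * (k : ℝ) ^ (c - 1) with hWdef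
  rw [hy₁x] at hW
  have hWy := abs_le.1 (hW.trans (add_le_add_left hW2 _))
  have hWle : W ≤ (2 + D) * x := by
    have : D * (x * l⁻¹) ≤ D * x := by gcongr
    linarith [hWy.2]
  have hfloor : |W - ⌊y ^ c⌋₊| ≤ (D + 2) * (x * l⁻¹) := by
    have h1 := Nat.floor_le (Real.rpow_nonneg hy0.le c)
    have h2 := Nat.lt_floor_add_one (y ^ c)
    rw [abs_le]
    constructor <;> linarith [hWy.1, hWy.2]
  have hQ := sum_primesLe_log_sq_le (x := x) (by linarith)
  rw [← hLdef] at hQ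
  have hQ0 : 0 ≤ ∑ p ∈ primesLe x, Real.log p ^ 2 := Finset.sum_nonneg fun p _ => sq_nonneg _
  have hlA : l⁻¹ * L = L ^ (-A) := by
    rw [hl, ← Real.rpow_neg hL0.le, ← Real.rpow_add_one hL0.ne']
    congr 1
    ring
  have hterm : ∀ k ∈ Finset.Ioc ⌊y₁⌋ ⌊y⌋, |c * (k : ℝ) ^ (c - 1) *
      (varSum x (fc c k) - (2 * congruentPairSum x (fc c k) - x ^ 2 / (fc c k).totient +
        ∑ p ∈ primesLe x, Real.log p ^ 2))| ≤
      c * (k : ℝ) ^ (c - 1) * ((1 + 12 * C) * (x * L ^ (-A))) := by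
    intro k hk
    rw [Finset.mem_Ioc, Int.floor_lt, Int.le_floor] at hk
    have hk0 : (0 : ℝ) < k := hy₁.trans hk.1
    have hkc : 0 ≤ c * (k : ℝ) ^ (c - 1) := by positivity
    have h1 : x * l⁻¹ ≤ (k : ℝ) ^ c := by
      rw [← hy₁x]
      exact Real.rpow_le_rpow hy₁.le hk.1.le (by linarith)
    have h2 : (k : ℝ) ^ c ≤ x := (Real.rpow_le_rpow hk0.le hk.2 (by linarith)).trans hyx
    have h3 := Nat.floor_le (Real.rpow_nonneg hk0.le c)
    have h4 := Nat.lt_floor_add_one ((k : ℝ) ^ c)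
    rw [abs_mul, abs_of_nonneg hkc]
    refine mul_le_mul_of_nonneg_left ?_ hkc
    refine (abs_varSum_sub_le_of_le (l := l) (by linarith) (by linarith) hl0 ?_ ?_ hθx).trans
      (error_le hx0.le hA hC hL hjA hx1)
    · rw [fc]
      linarith
    · exact h3.trans h2
  rw [Vprime_sub_eq]
  have hxA : 0 ≤ x * L ^ (-A) := by positivity
  refine (abs_add_le _ _).trans ?_
  rw [abs_mul, abs_of_nonneg hQ0]
  calc _ ≤ W * ((1 + 12 * C) * (x * L ^ (-A))) + (D + 2) * (x * l⁻¹) * (2 * (x * L)) := by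
        refine add_le_add ((Finset.abs_sum_le_sum_abs _ _).trans ?_) ?_
        · rw [hWdef, Finset.sum_mul]
          exact Finset.sum_le_sum hterm
        · gcongr
    _ ≤ (2 + D) * x * ((1 + 12 * C) * (x * L ^ (-A))) + (D + 2) * (x * l⁻¹) * (2 * (x * L)) := by
        gcongr
    _ = (2 + D) * (1 + 12 * C) * (x ^ 2 * L ^ (-A)) + 2 * (D + 2) * (x ^ 2 * (l⁻¹ * L)) := by ring
    _ = _ := by
        rw [hlA]
        ring
end

section
/- Let c > 1 with c not an integer, F(t) = t^c, f(k) = ⌊F(k)⌋, and 𝔠 = Σ_{n=1}^{∞} μ(n)²/(n φ(n)). For every A > 1 there exist B > 0, κ > 0 and x₀ ≥ 2 (depending only on c and A) such that for all x ≥ x₀, with y₁ defined by y₁^c = x (log x)^{−B}, and all real z with y₁ < z and F(z) ≤ x, one has | Σ_{y₁ < k ≤ z} f(k)/φ(f(k)) − 𝔠 (z − y₁) | ≤ κ z (log x)^{−3A}, where k runs over integers. -/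
/-- `𝔠 = Σ_{n=1}^∞ μ(n)²/(n φ(n))` (the `n = 0` term vanishes). -/
noncomputable def frakc : ℝ :=
  ∑' n : ℕ, ((ArithmeticFunction.moebius n : ℝ)) ^ 2 / ((n : ℝ) * (Nat.totient n : ℝ))

section

open Finset

/-- The additive character `t ↦ exp (2πit)`. -/
noncomputable def addExp (t : ℝ) : ℂ := Complex.exp ((2 * Real.pi * t : ℝ) * Complex.I)

lemma norm_addExp (t : ℝ) : ‖addExp t‖ = 1 := Complex.norm_exp_ofReal_mul_I _

lemma addExp_add (s t : ℝ) : addExp (s + t) = addExp s * addExp t := by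
  unfold addExp
  rw [← Complex.exp_add]
  push_cast
  ring_nf

lemma conj_addExp (t : ℝ) : (starRingEnd ℂ) (addExp t) = addExp (-t) := by
  unfold addExp
  rw [← Complex.exp_conj, map_mul, Complex.conj_I, Complex.conj_ofReal]
  push_cast
  ring_nf

/-- The value of `1 / (1 - addExp t)`, written with a cotangent. -/
noncomputable def kernelInv (t : ℝ) : ℂ := ⟨1 / 2, Real.cot (Real.pi * t) / 2⟩

lemma kernelInv_mul {t : ℝ} (h0 : 0 < t) (h1 : t ≤ 1 / 2) :
    kernelInv t * (1 - addExp t) = 1 := by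
  have hs : Real.sin (Real.pi * t) ≠ 0 := by
    apply ne_of_gt
    apply Real.sin_pos_of_pos_of_lt_pi <;> nlinarith [Real.pi_pos]
  have e : addExp t = ⟨Real.cos (2 * (Real.pi * t)), Real.sin (2 * (Real.pi * t))⟩ := by
    unfold addExp
    apply Complex.ext
    · rw [Complex.exp_ofReal_mul_I_re]; ring_nf
    · rw [Complex.exp_ofReal_mul_I_im]; ring_nf
  rw [e, kernelInv, Real.cos_two_mul, Real.sin_two_mul, Real.cot_eq_cos_div_sin]
  have := Real.sin_sq_add_cos_sq (Real.pi * t)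
  apply Complex.ext
  · simp
    field_simp
    ring
  · simp
    field_simp
    linear_combination (-2) * Real.cos (Real.pi * t) * this

lemma cot_le {t : ℝ} (h0 : 0 < t) (h1 : t ≤ 1 / 2) : Real.cot (Real.pi * t) ≤ 1 / (2 * t) := by
  have hs : 2 * t ≤ Real.sin (Real.pi * t) := by
    have := Real.mul_le_sin (x := Real.pi * t) (by positivity) (by nlinarith [Real.pi_pos])
    have h : 2 / Real.pi * (Real.pi * t) = 2 * t := by field_simp
    rwa [h] at this
  rw [Real.cot_eq_cos_div_sin]
  exact div_le_div₀ (by norm_num) (Real.cos_le_one _) (by positivity) hs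

lemma cot_nonneg {t : ℝ} (h0 : 0 < t) (h1 : t ≤ 1 / 2) : 0 ≤ Real.cot (Real.pi * t) := by
  rw [Real.cot_eq_cos_div_sin]
  apply div_nonneg
  · apply Real.cos_nonneg_of_mem_Icc
    constructor <;> nlinarith [Real.pi_pos]
  · apply Real.sin_nonneg_of_nonneg_of_le_pi <;> nlinarith [Real.pi_pos]

lemma cot_anti {s t : ℝ} (h0 : 0 < s) (hst : s ≤ t) (h1 : t ≤ 1 / 2) :
    Real.cot (Real.pi * t) ≤ Real.cot (Real.pi * s) := by
  rw [Real.cot_eq_cos_div_sin, Real.cot_eq_cos_div_sin]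
  have hp := Real.pi_pos
  apply div_le_div₀
  · apply Real.cos_nonneg_of_mem_Icc
    constructor <;> nlinarith
  · apply Real.cos_le_cos_of_nonneg_of_le_pi <;> nlinarith
  · apply Real.sin_pos_of_pos_of_lt_pi <;> nlinarith
  · apply Real.sin_le_sin_of_le_of_le_pi_div_two <;> nlinarith

lemma norm_kernelInv_le {t : ℝ} (h0 : 0 < t) (h1 : t ≤ 1 / 2) : ‖kernelInv t‖ ≤ 1 / (2 * t) := by
  have h := Complex.norm_le_abs_re_add_abs_im (kernelInv t)
  have hc := cot_le h0 h1
  have hn := cot_nonneg h0 h1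
  have h2 : 1 ≤ 1 / (2 * t) := by rw [le_div_iff₀ (by positivity)]; linarith
  have : |(kernelInv t).re| + |(kernelInv t).im| = 1 / 2 + Real.cot (Real.pi * t) / 2 := by
    simp only [kernelInv]
    rw [abs_of_nonneg (by norm_num), abs_of_nonneg (by positivity)]
  linarith

lemma sum_addExp_eq (g : ℕ → ℝ) (N : ℕ)
    (hpos : ∀ n ≤ N, 0 < g (n + 1) - g n) (hle : ∀ n ≤ N, g (n + 1) - g n ≤ 1 / 2) :
    ∑ n ∈ range (N + 1), addExp (g n) =
      kernelInv (g 1 - g 0) * addExp (g 0) - kernelInv (g (N + 1) - g N) * addExp (g (N + 1)) +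
      ∑ n ∈ range N, (kernelInv (g (n + 2) - g (n + 1)) - kernelInv (g (n + 1) - g n)) *
        addExp (g (n + 1)) := by
  have key : ∀ n ≤ N, addExp (g n) =
      kernelInv (g (n + 1) - g n) * (addExp (g n) - addExp (g (n + 1))) := by
    intro n hn
    have h := kernelInv_mul (hpos n hn) (hle n hn)
    have h2 : addExp (g (n + 1)) = addExp (g n) * addExp (g (n + 1) - g n) := by
      rw [← addExp_add]; ring_nf
    rw [h2]
    linear_combination -addExp (g n) * h
  induction N with
  | zero =>
    have := key 0 le_rfl
    simp only [zero_add, range_one, sum_singleton, range_zero, sum_empty, add_zero] at *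
    linear_combination this
  | succ N ih =>
    rw [sum_range_succ, ih (fun n hn => hpos n (by omega)) (fun n hn => hle n (by omega))
      (fun n hn => key n (by omega)), sum_range_succ _ N]
    linear_combination key (N + 1) le_rfl

/-- The Kusmin–Landau inequality, for decreasing increments. -/
lemma norm_sum_addExp_le (g : ℕ → ℝ) (N : ℕ) {l : ℝ} (hl : 0 < l)
    (hge : ∀ n < N, l ≤ g (n + 1) - g n) (hle : ∀ n < N, g (n + 1) - g n ≤ 1 / 2)
    (hanti : ∀ n, n + 1 < N → g (n + 2) - g (n + 1) ≤ g (n + 1) - g n) :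
    ‖∑ n ∈ range N, addExp (g n)‖ ≤ 2 / l := by
  rcases N with _ | N
  · simpa using by positivity
  have hw : ∀ n ≤ N, ‖kernelInv (g (n + 1) - g n)‖ ≤ 1 / (2 * l) := by
    intro n hn
    have h1 := hge n (by omega)
    refine (norm_kernelInv_le (hl.trans_le h1) (hle n (by omega))).trans ?_
    gcongr
  have hd : ∀ n < N, ‖(kernelInv (g (n + 2) - g (n + 1)) - kernelInv (g (n + 1) - g n)) *
        addExp (g (n + 1))‖ ≤ Real.cot (Real.pi * (g (n + 2) - g (n + 1))) / 2 -
          Real.cot (Real.pi * (g (n + 1) - g n)) / 2 := by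
    intro n hn
    rw [norm_mul, norm_addExp, mul_one]
    have h := cot_anti (hl.trans_le (hge (n + 1) (by omega))) (hanti n (by omega))
      (hle n (by omega))
    have h' : kernelInv (g (n + 2) - g (n + 1)) - kernelInv (g (n + 1) - g n) =
        ((Real.cot (Real.pi * (g (n + 2) - g (n + 1))) / 2 -
          Real.cot (Real.pi * (g (n + 1) - g n)) / 2 : ℝ) : ℂ) * Complex.I := by
      apply Complex.ext <;> simp [kernelInv, -Complex.ofReal_cot, -Complex.ofReal_sub,
        -Complex.ofReal_mul, -Complex.ofReal_div, Complex.ofReal_re]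
    rw [h', norm_mul, Complex.norm_I, mul_one, Complex.norm_real, Real.norm_eq_abs,
      abs_of_nonneg (by linarith)]
  rw [sum_addExp_eq g N (fun n hn => hl.trans_le (hge n (by omega))) (fun n hn => hle n (by omega))]
  have h3 : ‖∑ n ∈ range N, (kernelInv (g (n + 2) - g (n + 1)) - kernelInv (g (n + 1) - g n)) *
        addExp (g (n + 1))‖ ≤ 1 / (2 * l) / 2 := by
    refine (norm_sum_le _ _).trans ((sum_le_sum fun n hn => hd n (mem_range.1 hn)).trans ?_)
    rw [sum_range_sub (fun n => Real.cot (Real.pi * (g (n + 1) - g n)) / 2)]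
    have h1 := hge N (by omega)
    have h2 := cot_le (hl.trans_le h1) (hle N (by omega))
    have h4 := cot_nonneg (hl.trans_le (hge 0 (by omega))) (hle 0 (by omega))
    have h5 : 1 / (2 * (g (N + 1) - g N)) ≤ 1 / (2 * l) := by gcongr
    linarith
  have h0 := hw 0 (by omega)
  have hN := hw N le_rfl
  refine (norm_add_le _ _).trans ((add_le_add (norm_sub_le _ _) h3).trans ?_)
  rw [norm_mul, norm_mul, norm_addExp, norm_addExp, mul_one, mul_one]
  have : 2 / l = 4 * (1 / (2 * l)) := by field_simp; norm_num
  have hp : 0 < 1 / (2 * l) := by positivity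
  rw [zero_add] at h0
  linarith

/-- Weyl–van der Corput inequality for a sequence supported in `[a, b)`. -/
lemma norm_sum_sq_le {u : ℤ → ℂ} {a b : ℤ} (hu : ∀ n, ‖u n‖ ≤ 1)
    (hsupp : ∀ n, n ∉ Ico a b → u n = 0) {N H : ℕ} (hN : b - a ≤ N) (hH : 1 ≤ H) (hHN : H ≤ N)
    {M : ℝ} (hM0 : 0 ≤ M) (hM : ∀ r : ℕ, 1 ≤ r → r < H →
      ‖∑ n ∈ Ico a (b - r), u (n + r) * (starRingEnd ℂ) (u n)‖ ≤ M) :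
    ‖∑ n ∈ Ico a b, u n‖ ^ 2 ≤ 4 * N ^ 2 / H + 2 * N * M := by
  have hcorr : ∀ r s : ℕ, r < H → s < r →
      ‖∑ n ∈ Ico (a - H) b, u (n + r) * (starRingEnd ℂ) (u (n + s))‖ ≤ M := by
    intro r s hr hs
    convert hM (r - s) (by omega) (by omega) using 2
    have : ∑ n ∈ Ico (a - s) (b - r), u (n + r) * (starRingEnd ℂ) (u (n + s)) =
        ∑ n ∈ Ico (a - H) b, u (n + r) * (starRingEnd ℂ) (u (n + s)) := by
      apply sum_subset
      · intro n; simp only [mem_Ico]; omega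
      · intro n _ hn
        simp only [mem_Ico] at hn
        by_cases h : n + r ∈ Ico a b
        · rw [hsupp (n + s) (by simp only [mem_Ico] at *; omega)]; simp
        · rw [hsupp _ h]; simp
    rw [← this]
    have h2 := sum_Ico_add' (fun n : ℤ => u (n + (r - s)) * (starRingEnd ℂ) (u n)) (a - s) (b - r) s
    rw [show a - (s : ℤ) + s = a by ring, show b - (r : ℤ) + s = b - ((r - s : ℕ) : ℤ) by omega]
      at h2
    rw [Nat.cast_sub hs.le] at h2 ⊢
    rw [← h2]
    refine sum_congr rfl fun n _ => ?_
    ring_nf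
  have hcard : ((Ico (a - H) b).card : ℝ) ≤ 2 * N := by
    rw [Int.card_Ico]
    have : (b - (a - H)).toNat ≤ 2 * N := by omega
    exact_mod_cast this
  have hall : ∀ r ∈ range H, ∀ s ∈ range H,
      ‖∑ n ∈ Ico (a - H) b, u (n + r) * (starRingEnd ℂ) (u (n + s))‖ ≤
        (if r = s then 2 * (N : ℝ) else 0) + M := by
    intro r hr s hs
    rw [mem_range] at hr hs
    rcases lt_trichotomy r s with h | h | h
    · rw [if_neg h.ne, zero_add]
      refine le_trans (le_of_eq ?_) (hcorr s r hs h)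
      rw [← Complex.norm_conj, map_sum]
      congr 1
      refine sum_congr rfl fun n _ => ?_
      rw [map_mul, Complex.conj_conj, mul_comm]
    · rw [if_pos h]
      have : ‖∑ n ∈ Ico (a - H) b, u (n + r) * (starRingEnd ℂ) (u (n + s))‖ ≤
          ∑ n ∈ Ico (a - H) b, (1 : ℝ) := by
        refine norm_sum_le_of_le _ fun n _ => ?_
        rw [norm_mul, Complex.norm_conj]
        exact mul_le_one₀ (hu _) (norm_nonneg _) (hu _)
      rw [sum_const, nsmul_eq_mul, mul_one] at this
      linarith
    · rw [if_neg h.ne', zero_add]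
      exact hcorr r s hr h
  have hshift : (H : ℂ) * ∑ n ∈ Ico a b, u n =
      ∑ n ∈ Ico (a - H) b, ∑ r ∈ range H, u (n + r) := by
    rw [sum_comm]
    have : ∀ r ∈ range H, ∑ n ∈ Ico (a - H) b, u (n + r) = ∑ n ∈ Ico a b, u n := by
      intro r hr
      rw [mem_range] at hr
      rw [sum_Ico_add' u]
      symm
      apply sum_subset
      · intro n; simp only [mem_Ico]; omega
      · intro n _ hn
        exact hsupp n hn
    rw [sum_congr rfl this]
    simp
  have hsq : (∑ n ∈ Ico (a - H) b, ‖∑ r ∈ range H, u (n + r)‖ ^ 2 : ℝ) ≤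
      H * (2 * N) + H ^ 2 * M := by
    have h1 : ((∑ n ∈ Ico (a - H) b, ‖∑ r ∈ range H, u (n + r)‖ ^ 2 : ℝ) : ℂ) =
        ∑ r ∈ range H, ∑ s ∈ range H, ∑ n ∈ Ico (a - H) b,
          u (n + r) * (starRingEnd ℂ) (u (n + s)) := by
      push_cast
      simp_rw [← Complex.mul_conj', map_sum, sum_mul_sum]
      rw [sum_comm]
      refine sum_congr rfl fun r _ => ?_
      rw [sum_comm]
    have h2 : (∑ n ∈ Ico (a - H) b, ‖∑ r ∈ range H, u (n + r)‖ ^ 2 : ℝ) ≤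
        ‖((∑ n ∈ Ico (a - H) b, ‖∑ r ∈ range H, u (n + r)‖ ^ 2 : ℝ) : ℂ)‖ := by
      rw [Complex.norm_real]
      exact le_abs_self _
    refine h2.trans ?_
    rw [h1]
    refine (norm_sum_le_of_le _ fun r hr => norm_sum_le_of_le _ fun s hs =>
      hall r hr s hs).trans (le_of_eq ?_)
    have : ∀ r ∈ range H, ∑ s ∈ range H, ((if r = s then 2 * (N : ℝ) else 0) + M) =
        2 * N + H * M := by
      intro r hr
      rw [sum_add_distrib, sum_ite_eq, if_pos hr]
      simp
    rw [sum_congr rfl this]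
    simp
    ring
  have hCS : ‖(H : ℂ) * ∑ n ∈ Ico a b, u n‖ ^ 2 ≤ 2 * N * (H * (2 * N) + H ^ 2 * M) := by
    rw [hshift]
    calc _ ≤ (∑ n ∈ Ico (a - H) b, ‖∑ r ∈ range H, u (n + r)‖) ^ 2 := by
          gcongr
          exact norm_sum_le _ _
      _ ≤ (Ico (a - H) b).card * ∑ n ∈ Ico (a - H) b, ‖∑ r ∈ range H, u (n + r)‖ ^ 2 :=
          sq_sum_le_card_mul_sum_sq
      _ ≤ _ := by gcongr
  have hH0 : (0 : ℝ) < H := by exact_mod_cast hH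
  rw [norm_mul, Complex.norm_natCast, mul_pow] at hCS
  have : 4 * (N : ℝ) ^ 2 / H + 2 * N * M = 2 * N * (H * (2 * N) + H ^ 2 * M) / H ^ 2 := by
    field_simp
    ring
  rw [this, le_div_iff₀ (by positivity)]
  linarith

lemma norm_sum_addExp_sq_le (g : ℤ → ℝ) {a b : ℤ} {N H : ℕ} (hN : b - a ≤ N) (hH : 1 ≤ H)
    (hHN : H ≤ N) {M : ℝ} (hM0 : 0 ≤ M) (hM : ∀ r : ℕ, 1 ≤ r → r < H →
      ‖∑ n ∈ Ico a (b - r), addExp (g (n + r) - g n)‖ ≤ M) :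
    ‖∑ n ∈ Ico a b, addExp (g n)‖ ^ 2 ≤ 4 * N ^ 2 / H + 2 * N * M := by
  have h := norm_sum_sq_le (u := fun n => if n ∈ Ico a b then addExp (g n) else 0) (a := a) (b := b)
    (N := N) (H := H) (M := M) (fun n => by split_ifs <;> simp [norm_addExp])
    (fun n hn => if_neg hn) hN hH hHN hM0 (fun r hr hrH => ?_)
  · rwa [sum_congr rfl fun n hn => if_pos hn] at h
  · convert hM r hr hrH using 2
    refine sum_congr rfl fun n hn => ?_
    rw [mem_Ico] at hn
    rw [if_pos (mem_Ico.2 (by omega)), if_pos (mem_Ico.2 (by omega)), conj_addExp, ← addExp_add]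
    rfl

/-- Iterated forward differences with the given list of shifts. -/
def iterDiff : List ℕ → (ℝ → ℝ) → ℝ → ℝ
  | [], f => f
  | r :: rs, f => iterDiff rs fun t => f (t + r) - f t

lemma iterDiff_sub (rs : List ℕ) (f g : ℝ → ℝ) (t : ℝ) :
    iterDiff rs (fun t => f t - g t) t = iterDiff rs f t - iterDiff rs g t := by
  induction rs generalizing f g with
  | nil => rfl
  | cons r rs ih =>
    simp only [iterDiff]
    rw [← ih]
    congr 1
    ext t
    ring

lemma iterDiff_shift (rs : List ℕ) (f : ℝ → ℝ) (r t : ℝ) :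
    iterDiff rs (fun t => f (t + r)) t = iterDiff rs f (t + r) := by
  induction rs generalizing f with
  | nil => rfl
  | cons s rs ih =>
    simp only [iterDiff]
    rw [← ih]
    congr 1
    ext t
    ring_nf

lemma iterDiff_cons (r : ℕ) (rs : List ℕ) (f : ℝ → ℝ) (t : ℝ) :
    iterDiff (r :: rs) f t = iterDiff rs f (t + r) - iterDiff rs f t := by
  rw [iterDiff, iterDiff_sub rs (fun t => f (t + r)), iterDiff_shift]

lemma iterDiff_const_mul (rs : List ℕ) (f : ℝ → ℝ) (θ t : ℝ) :
    iterDiff rs (fun t => θ * f t) t = θ * iterDiff rs f t := by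
  induction rs generalizing t with
  | nil => rfl
  | cons r rs ih => rw [iterDiff_cons, iterDiff_cons, ih, ih, mul_sub]

lemma hasDerivAt_iterDiff_rpow (rs : List ℕ) (s : ℝ) {t : ℝ} (ht : 0 < t) :
    HasDerivAt (iterDiff rs fun t => t ^ s) (s * iterDiff rs (fun t => t ^ (s - 1)) t) t := by
  induction rs generalizing t with
  | nil => exact Real.hasDerivAt_rpow_const (Or.inl ht.ne')
  | cons r rs ih =>
    have h1 := ih ht
    have h2 := (ih (t := t + r) (by positivity)).comp_add_const t r
    have h := h2.sub h1
    rw [iterDiff_cons, mul_sub]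
    refine h.congr_of_eventuallyEq (Filter.Eventually.of_forall fun t => ?_)
    rw [iterDiff_cons]
    rfl

lemma exists_iterDiff_rpow_eq (rs : List ℕ) (s : ℝ) {t : ℝ} (ht : 0 < t) :
    ∃ ξ ∈ Set.Icc t (t + (rs.sum : ℝ)), iterDiff rs (fun t => t ^ s) t =
      (rs.prod : ℝ) * (∏ i ∈ range rs.length, (s - i)) * ξ ^ (s - rs.length) := by
  induction rs generalizing s t with
  | nil => exact ⟨t, by simp, by simp [iterDiff]⟩
  | cons r rs ih =>
    have hmv : ∃ η ∈ Set.Icc t (t + r), iterDiff (r :: rs) (fun t => t ^ s) t =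
        r * (s * iterDiff rs (fun t => t ^ (s - 1)) η) := by
      rcases Nat.eq_zero_or_pos r with rfl | hr
      · exact ⟨t, by simp, by rw [iterDiff_cons]; simp⟩
      · have hr' : (0 : ℝ) < r := by exact_mod_cast hr
        obtain ⟨η, hη, h⟩ := exists_hasDerivAt_eq_slope (iterDiff rs fun t => t ^ s)
          (fun t => s * iterDiff rs (fun t => t ^ (s - 1)) t) (a := t) (b := t + r) (by linarith)
          (fun u hu => (hasDerivAt_iterDiff_rpow rs s
            (ht.trans_le hu.1)).continuousAt.continuousWithinAt)
          (fun u hu => hasDerivAt_iterDiff_rpow rs s (ht.trans hu.1))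
        refine ⟨η, Set.Ioo_subset_Icc_self hη, ?_⟩
        rw [h, iterDiff_cons, add_sub_cancel_left, mul_div_cancel₀ _ hr'.ne']
    obtain ⟨η, hη, h⟩ := hmv
    obtain ⟨ξ, hξ, h'⟩ := ih (s - 1) (ht.trans_le hη.1)
    refine ⟨ξ, ⟨hη.1.trans hξ.1, hξ.2.trans ?_⟩, ?_⟩
    · have := hη.2
      push_cast [List.sum_cons]
      linarith
    · rw [h, h', List.length_cons, prod_range_succ']
      push_cast [List.prod_cons]
      have : ∀ i ∈ range rs.length, s - ((i : ℝ) + 1) = s - 1 - i := fun i _ => by ring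
      rw [prod_congr rfl this, show s - ((rs.length : ℝ) + 1) = s - 1 - rs.length by ring]
      ring

lemma norm_sum_addExp_iterDiff_le {a : ℤ} {N H : ℕ} (hH : 1 ≤ H) (hHN : H ≤ N) (m : ℕ)
    (f : ℝ → ℝ) (b : ℤ) (hN : b - a ≤ N)
    (h : ∀ rs : List ℕ, rs.length = m → (∀ r ∈ rs, 1 ≤ r ∧ r < H) →
      ‖∑ n ∈ Ico a (b - rs.sum), addExp (iterDiff rs f n)‖ ≤ 6 * N / H) :
    ‖∑ n ∈ Ico a b, addExp (f n)‖ ≤ 6 * N * (H : ℝ) ^ (-(1 / 2 : ℝ) ^ m) := by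
  have hH0 : (0 : ℝ) < H := by exact_mod_cast hH
  induction m generalizing f b with
  | zero =>
    have := h [] rfl (by simp)
    simpa [iterDiff, Real.rpow_neg_one, div_eq_mul_inv] using this
  | succ m ih =>
    set Q := (H : ℝ) ^ (-(1 / 2 : ℝ) ^ m) with hQ
    have hQ0 : 0 < Q := by positivity
    have hsq := norm_sum_addExp_sq_le (fun n => f n) hN hH hHN (M := 6 * N * Q) (by positivity)
      (fun r hr hrH => by
        have := ih (fun t => f (t + r) - f t) (b - r) (by omega) (fun rs hrs hr' => by
          have := h (r :: rs) (by simp [hrs]) (by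
            intro x hx
            rcases List.mem_cons.1 hx with rfl | hx
            · exact ⟨hr, hrH⟩
            · exact hr' x hx)
          rw [List.sum_cons] at this
          push_cast at this ⊢
          rwa [sub_sub])
        push_cast
        exact this)
    have hHQ : 1 / (H : ℝ) ≤ Q := by
      rw [hQ, one_div, ← Real.rpow_neg_one]
      apply Real.rpow_le_rpow_of_exponent_le (by exact_mod_cast hH)
      have : (1 / 2 : ℝ) ^ m ≤ 1 := pow_le_one₀ (by norm_num) (by norm_num)
      linarith
    have hQ2 : ((H : ℝ) ^ (-(1 / 2 : ℝ) ^ (m + 1))) ^ 2 = Q := by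
      rw [← Real.rpow_natCast, ← Real.rpow_mul hH0.le, hQ]
      congr 1
      push_cast
      ring
    refine le_of_sq_le_sq ?_ (by positivity)
    rw [mul_pow, hQ2]
    refine hsq.trans ?_
    have : 4 * (N : ℝ) ^ 2 / H = 4 * N ^ 2 * (1 / H) := by ring
    rw [this]
    have h2 : 4 * (N : ℝ) ^ 2 * (1 / H) ≤ 4 * N ^ 2 * Q := by gcongr
    have h3 : 0 ≤ (N : ℝ) ^ 2 * Q := by positivity
    nlinarith

lemma floor_lt_of_ne_intCast {c : ℝ} (hc : 1 < c) (hcne : ∀ n : ℤ, c ≠ n) :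
    (⌊c⌋₊ : ℝ) < c ∧ c < ⌊c⌋₊ + 1 :=
  ⟨lt_of_le_of_ne (Nat.floor_le (by linarith)) fun h => hcne ⌊c⌋₊ (by exact_mod_cast h.symm),
    Nat.lt_floor_add_one c⟩

lemma prod_sub_pos {c : ℝ} {m : ℕ} (h : (m : ℝ) < c) :
    0 < ∏ i ∈ range (m + 1), (c - i) := by
  refine prod_pos fun i hi => ?_
  have : i ≤ m := by rw [mem_range] at hi; omega
  have : (i : ℝ) ≤ m := by exact_mod_cast this
  linarith

lemma sum_Ico_int_eq_sum_range (F : ℤ → ℂ) (a b : ℤ) :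
    ∑ n ∈ Ico a b, F n = ∑ i ∈ range (b - a).toNat, F (a + i) := by
  symm
  refine sum_bij (fun i _ => a + (i : ℤ)) ?_ ?_ ?_ ?_
  · intro i hi; simp only [mem_range, mem_Ico] at *; omega
  · intro i _ j _ h; omega
  · intro n hn
    simp only [mem_Ico] at hn
    exact ⟨(n - a).toNat, by simp only [mem_range]; omega, by omega⟩
  · intros; rfl

/-- Van der Corput's bound for `∑ e(θ n ^ c)` via `⌊c⌋` differencing steps. -/
lemma norm_sum_addExp_rpow_le {c : ℝ} {m : ℕ} (hm : (m : ℝ) < c) (hm' : c < m + 1)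
    {a b : ℤ} (ha : 1 ≤ a) {N H : ℕ} (hb : b ≤ N) (hH : 1 ≤ H) (hHN : H ≤ N) {θ : ℝ} (hθ : 0 < θ)
    (hup : θ * (H ^ m * (∏ i ∈ range (m + 1), (c - i)) * (a : ℝ) ^ (c - (m + 1))) ≤ 1 / 2)
    (hlow : 2 / (θ * ((∏ i ∈ range (m + 1), (c - i)) * (N : ℝ) ^ (c - (m + 1)))) ≤ 6 * N / H) :
    ‖∑ n ∈ Ico a b, addExp (θ * (n : ℝ) ^ c)‖ ≤ 6 * N * (H : ℝ) ^ (-(1 / 2 : ℝ) ^ m) := by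
  have hK := prod_sub_pos hm
  set K := ∏ i ∈ range (m + 1), (c - i) with hKdef
  have hN0 : (0 : ℝ) < N := by exact_mod_cast (by omega : 0 < N)
  refine norm_sum_addExp_iterDiff_le hH hHN m (fun t => θ * t ^ c) b (by omega)
    fun rs hlen hrs => ?_
  have ha0 : (0 : ℝ) < a := by exact_mod_cast (by omega : 0 < a)
  have hP1 : (1 : ℝ) ≤ (rs.prod : ℝ) := by
    exact_mod_cast Nat.succ_le_of_lt (List.prod_pos fun r hr => (hrs r hr).1)
  have hPH : (rs.prod : ℝ) ≤ (H : ℝ) ^ m := by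
    have := List.prod_le_pow_card rs H fun r hr => (hrs r hr).2.le
    rw [hlen] at this
    exact_mod_cast this
  have hinc : ∀ n : ℤ, a ≤ n → n + 1 + rs.sum ≤ b →
      θ * (K * (N : ℝ) ^ (c - (m + 1))) ≤ iterDiff (1 :: rs) (fun t => θ * t ^ c) n ∧
      iterDiff (1 :: rs) (fun t => θ * t ^ c) n ≤ 1 / 2 := by
    intro n hn hnb
    have hn' : (a : ℝ) ≤ n := by exact_mod_cast hn
    obtain ⟨ξ, hξ, h⟩ := exists_iterDiff_rpow_eq (1 :: rs) c (t := n) (by linarith)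
    have hξ0 : 0 < ξ := by linarith [hξ.1]
    have hξN : ξ ≤ N := by
      refine hξ.2.trans ?_
      rw [List.sum_cons]
      have : n + ((1 + rs.sum : ℕ) : ℤ) ≤ (N : ℤ) := by rw [Nat.cast_add, Nat.cast_one]; omega
      have := Int.cast_le (R := ℝ).2 this
      rwa [Int.cast_add, Int.cast_natCast, Int.cast_natCast] at this
    rw [List.prod_cons, one_mul, List.length_cons, hlen, ← hKdef, Nat.cast_add, Nat.cast_one] at h
    rw [iterDiff_const_mul, h]
    have e1 : (N : ℝ) ^ (c - (m + 1)) ≤ ξ ^ (c - (m + 1)) :=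
      Real.rpow_le_rpow_of_nonpos hξ0 hξN (by linarith)
    have e2 : ξ ^ (c - (m + 1)) ≤ (a : ℝ) ^ (c - (m + 1)) :=
      Real.rpow_le_rpow_of_nonpos ha0 (hn'.trans hξ.1) (by linarith)
    constructor
    · calc _ = θ * (1 * K * (N : ℝ) ^ (c - (m + 1))) := by ring
        _ ≤ _ := by gcongr
    · refine le_trans ?_ hup
      gcongr
  have hanti : ∀ n : ℤ, a ≤ n →
      iterDiff (1 :: 1 :: rs) (fun t => θ * t ^ c) n ≤ 0 := by
    intro n hn
    have hn' : (a : ℝ) ≤ n := by exact_mod_cast hn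
    obtain ⟨ξ, hξ, h⟩ := exists_iterDiff_rpow_eq (1 :: 1 :: rs) c (t := n) (by linarith)
    have hξ0 : 0 < ξ := by linarith [hξ.1]
    rw [List.prod_cons, List.prod_cons, one_mul, one_mul, List.length_cons, List.length_cons, hlen,
      prod_range_succ, ← hKdef] at h
    rw [iterDiff_const_mul, h]
    have e : c - ((m + 1 : ℕ) : ℝ) ≤ 0 := by push_cast; linarith
    refine mul_nonpos_of_nonneg_of_nonpos hθ.le ?_
    refine mul_nonpos_of_nonpos_of_nonneg ?_ (by positivity)
    refine mul_nonpos_of_nonneg_of_nonpos (by positivity) ?_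
    exact mul_nonpos_of_nonneg_of_nonpos hK.le e
  refine le_trans ?_ hlow
  rw [sum_Ico_int_eq_sum_range]
  have step : ∀ n : ℕ, iterDiff rs (fun t => θ * t ^ c) ((a + ((n + 1 : ℕ) : ℤ) : ℤ) : ℝ) -
      iterDiff rs (fun t => θ * t ^ c) ((a + (n : ℤ) : ℤ) : ℝ) =
      iterDiff (1 :: rs) (fun t => θ * t ^ c) ((a + (n : ℤ) : ℤ) : ℝ) := by
    intro n
    rw [iterDiff_cons]
    push_cast
    rw [add_assoc]
  refine norm_sum_addExp_le (fun n => iterDiff rs (fun t => θ * t ^ c) ((a + (n : ℤ) : ℤ) : ℝ)) _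
    (by positivity) ?_ ?_ ?_
  · intro n hn
    rw [step]
    exact (hinc _ (by omega) (by omega)).1
  · intro n hn
    rw [step]
    exact (hinc _ (by omega) (by omega)).2
  · intro n hn
    have h1 := hanti (a + n) (by omega)
    rw [iterDiff_cons] at h1
    rw [step, step]
    have : (((a + ((n + 1 : ℕ) : ℤ) : ℤ)) : ℝ) = ((a + (n : ℤ) : ℤ) : ℝ) + ((1 : ℕ) : ℝ) := by
      push_cast; ring
    rw [this]
    linarith

lemma fract_sq_sub_le (t : ℝ) {η : ℝ} (h0 : 0 ≤ η) (h1 : η ≤ 1) :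
    (Int.fract (t + η) ^ 2 - Int.fract (t + η)) - (Int.fract t ^ 2 - Int.fract t) ≤
      2 * η * (Int.fract t - 1 / 2) + η ^ 2 := by
  have a0 := Int.fract_nonneg t
  have a1 := Int.fract_lt_one t
  have e : Int.fract (t + η) = Int.fract (Int.fract t + η) := by
    conv_lhs => rw [← Int.floor_add_fract t, add_assoc, Int.fract_intCast_add]
  rw [e]
  set v := Int.fract t
  rcases lt_or_ge (v + η) 1 with h | h
  · rw [Int.fract_eq_self.2 ⟨by positivity, h⟩]
    nlinarith
  · have : Int.fract (v + η) = v + η - 1 := by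
      rw [Int.fract_eq_iff]
      exact ⟨by linarith, by linarith, 1, by push_cast; ring⟩
    rw [this]
    nlinarith

lemma le_fract_sq_sub (t : ℝ) {η : ℝ} (h0 : 0 ≤ η) (h1 : η ≤ 1) :
    2 * η * (Int.fract t - 1 / 2) - η ^ 2 ≤
    (Int.fract t ^ 2 - Int.fract t) - (Int.fract (t - η) ^ 2 - Int.fract (t - η)) := by
  have a0 := Int.fract_nonneg t
  have a1 := Int.fract_lt_one t
  have e : Int.fract (t - η) = Int.fract (Int.fract t - η) := by
    conv_lhs => rw [← Int.floor_add_fract t, add_sub_assoc, Int.fract_intCast_add]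
  rw [e]
  set v := Int.fract t
  rcases le_or_gt 0 (v - η) with h | h
  · rw [Int.fract_eq_self.2 ⟨h, by linarith⟩]
    nlinarith
  · have : Int.fract (v - η) = v - η + 1 := by
      rw [Int.fract_eq_iff]
      exact ⟨by linarith, by linarith, -1, by push_cast; ring⟩
    rw [this]
    nlinarith

lemma addExp_re (t : ℝ) : (addExp t).re = Real.cos (2 * Real.pi * t) := by
  unfold addExp
  rw [Complex.exp_ofReal_mul_I_re]

lemma hasSum_addExp_fract (t : ℝ) :
    HasSum (fun h : ℕ => 1 / (h : ℝ) ^ 2 * (addExp (h * t)).re)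
      (Real.pi ^ 2 * (Int.fract t ^ 2 - Int.fract t + 6⁻¹)) := by
  have h := hasSum_one_div_nat_pow_mul_cos (k := 1) one_ne_zero (x := Int.fract t)
    ⟨Int.fract_nonneg t, (Int.fract_lt_one t).le⟩
  have hb := bernoulliFun_two (Int.fract t)
  rw [bernoulliFun] at hb
  rw [mul_one, hb] at h
  convert h using 1
  · ext n
    rw [addExp_re]
    congr 1
    rw [← Real.cos_sub_int_mul_two_pi _ (n * ⌊t⌋), ← Int.self_sub_floor]
    congr 1
    push_cast
    ring
  · rw [Nat.factorial_two]
    push_cast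
    ring

/-- If the exponential sums `∑ e(h u_k)` are small on average, the fractional parts of `u_k`
have mean close to `1/2`. -/
lemma exists_abs_sum_fract_sub_le : ∃ C : ℝ, 0 < C ∧ ∀ (s : Finset ℤ) (u : ℤ → ℝ) (N Q : ℝ),
    0 < Q → Q ≤ 1 → (s.card : ℝ) ≤ N →
    (∀ h : ℕ, 1 ≤ h → ‖∑ k ∈ s, addExp (h * u k)‖ ≤ N * Q ^ 2 * √h) →
    |∑ k ∈ s, (Int.fract (u k) - 1 / 2)| ≤ C * N * Q := by
  have hsum : Summable fun h : ℕ => 1 / (h : ℝ) ^ (3 / 2 : ℝ) :=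
    Real.summable_one_div_nat_rpow.2 (by norm_num)
  set C₀ := ∑' h : ℕ, 1 / (h : ℝ) ^ (3 / 2 : ℝ) with hC₀
  have hC₀0 : 0 ≤ C₀ := tsum_nonneg fun h => by positivity
  refine ⟨1 + C₀, by positivity, ?_⟩
  intro s u N Q hQ hQ1 hcard hexp
  have hN : 0 ≤ N := le_trans (by positivity) hcard
  set β : ℝ → ℝ := fun t => Int.fract t ^ 2 - Int.fract t + 6⁻¹ with hβ
  have hB : ∀ t : ℝ, |∑ k ∈ s, β (u k + t)| ≤ C₀ * N * Q ^ 2 := by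
    intro t
    have h1 : HasSum (fun h : ℕ => ∑ k ∈ s, 1 / (h : ℝ) ^ 2 * (addExp (h * (u k + t))).re)
        (∑ k ∈ s, Real.pi ^ 2 * β (u k + t)) :=
      hasSum_sum fun k _ => hasSum_addExp_fract (u k + t)
    rw [← mul_sum] at h1
    have h2 : ∀ h : ℕ, ‖∑ k ∈ s, 1 / (h : ℝ) ^ 2 * (addExp (h * (u k + t))).re‖ ≤
        N * Q ^ 2 * (1 / (h : ℝ) ^ (3 / 2 : ℝ)) := by
      intro h
      rcases Nat.eq_zero_or_pos h with rfl | hh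
      · simp
      have hh' : (0 : ℝ) < h := by exact_mod_cast hh
      have e : ∑ k ∈ s, 1 / (h : ℝ) ^ 2 * (addExp (h * (u k + t))).re =
          1 / (h : ℝ) ^ 2 * ((∑ k ∈ s, addExp (h * u k)) * addExp (h * t)).re := by
        rw [sum_mul, Complex.re_sum, mul_sum]
        refine sum_congr rfl fun k _ => ?_
        rw [← addExp_add, mul_add]
      rw [e, norm_mul, Real.norm_of_nonneg (by positivity)]
      have h3 : ‖((∑ k ∈ s, addExp (h * u k)) * addExp (h * t)).re‖ ≤ N * Q ^ 2 * √h := by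
        refine (Complex.abs_re_le_norm _).trans ?_
        rw [norm_mul, norm_addExp, mul_one]
        exact hexp h hh
      have h4 : 1 / (h : ℝ) ^ (3 / 2 : ℝ) = 1 / (h : ℝ) ^ 2 * √h := by
        rw [Real.sqrt_eq_rpow, one_div, one_div, ← Real.rpow_natCast, ← Real.rpow_neg hh'.le,
          ← Real.rpow_neg hh'.le, ← Real.rpow_add hh']
        norm_num
      rw [h4]
      calc _ ≤ 1 / (h : ℝ) ^ 2 * (N * Q ^ 2 * √h) := by gcongr
        _ = _ := by ring
    have h5 := tsum_of_norm_bounded (hsum.hasSum.mul_left (N * Q ^ 2)) h2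
    rw [h1.tsum_eq, Real.norm_eq_abs, abs_mul, abs_of_pos (by positivity)] at h5
    have h6 : (1 : ℝ) ≤ Real.pi ^ 2 := by nlinarith [Real.pi_gt_three]
    have h7 := mul_le_mul_of_nonneg_right h6 (abs_nonneg (∑ k ∈ s, β (u k + t)))
    rw [← hC₀] at h5
    linarith
  have hup : ∑ k ∈ s, β (u k + Q) - ∑ k ∈ s, β (u k + 0) ≤
      2 * Q * ∑ k ∈ s, (Int.fract (u k) - 1 / 2) + s.card * Q ^ 2 := by
    rw [← sum_sub_distrib, mul_sum, ← nsmul_eq_mul, ← sum_const, ← sum_add_distrib]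
    refine sum_le_sum fun k _ => ?_
    have := fract_sq_sub_le (u k) hQ.le hQ1
    simp only [hβ, add_zero]
    linarith
  have hlo : 2 * Q * ∑ k ∈ s, (Int.fract (u k) - 1 / 2) - s.card * Q ^ 2 ≤
      ∑ k ∈ s, β (u k + 0) - ∑ k ∈ s, β (u k + -Q) := by
    rw [← sum_sub_distrib, mul_sum, ← nsmul_eq_mul, ← sum_const, ← sum_sub_distrib]
    refine sum_le_sum fun k _ => ?_
    have := le_fract_sq_sub (u k) hQ.le hQ1
    simp only [hβ, add_zero, ← sub_eq_add_neg]
    linarith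
  have b1 := abs_le.1 (hB Q)
  have b2 := abs_le.1 (hB 0)
  have b3 := abs_le.1 (hB (-Q))
  have hcQ : s.card * Q ^ 2 ≤ N * Q ^ 2 := by gcongr
  set X := ∑ k ∈ s, (Int.fract (u k) - 1 / 2)
  have hX : 2 * Q * |X| ≤ 2 * Q * ((1 + C₀) * N * Q) := by
    have h2Q : |2 * Q| = 2 * Q := abs_of_pos (by positivity)
    rw [← h2Q, ← abs_mul, h2Q, abs_le]
    have : 0 ≤ N * Q ^ 2 := by positivity
    constructor <;> nlinarith
  exact le_of_mul_le_mul_left hX (by positivity)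

lemma ediv_sub_sub_one_ediv (n : ℤ) {d : ℤ} (hd : 0 < d) :
    n / d - (n - 1) / d = if d ∣ n then 1 else 0 := by
  have h1 := Int.mul_ediv_add_emod n d
  have h2 := Int.emod_nonneg n hd.ne'
  have h3 := Int.emod_lt_of_pos n hd
  split_ifs with h
  · have h4 := Int.emod_eq_zero_of_dvd h
    have : (n - 1) / d = n / d - 1 := by
      rw [Int.ediv_eq_iff_of_pos hd]
      constructor <;> nlinarith
    omega
  · have h4 : n % d ≠ 0 := fun h' => h (Int.dvd_of_emod_eq_zero h')
    have h5 : 1 ≤ n % d := by omega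
    have : (n - 1) / d = n / d := by
      rw [Int.ediv_eq_iff_of_pos hd]
      constructor <;> nlinarith
    omega

lemma ite_dvd_floor {v : ℝ} (hv : 0 ≤ v) {d : ℕ} (hd : 0 < d) :
    (if d ∣ ⌊v⌋₊ then (1 : ℝ) else 0) =
      1 / d - (Int.fract (v / d) - 1 / 2) + (Int.fract ((v - 1) / d) - 1 / 2) := by
  have hf : ∀ w : ℝ, ⌊w / d⌋ = ⌊w⌋ / (d : ℤ) := fun w => Int.floor_div_natCast w d
  have h := ediv_sub_sub_one_ediv ⌊v⌋ (d := d) (by exact_mod_cast hd)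
  have h1 : ⌊v⌋ - 1 = ⌊v - 1⌋ := (Int.floor_sub_one v).symm
  rw [h1, ← hf, ← hf] at h
  have h2 : ((d : ℤ) ∣ ⌊v⌋) ↔ d ∣ ⌊v⌋₊ := by
    rw [← Int.natCast_floor_eq_floor hv, Int.natCast_dvd_natCast]
  have h3 := congrArg (Int.cast : ℤ → ℝ) h
  simp only [h2] at h3
  push_cast at h3
  rw [← h3, ← Int.self_sub_floor, ← Int.self_sub_floor]
  field_simp
  ring

lemma exists_abs_sum_ite_dvd_floor_sub_le : ∃ C : ℝ, 0 < C ∧ ∀ (s : Finset ℤ) (v : ℤ → ℝ)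
    (N Q : ℝ) (d : ℕ), 0 < d → (∀ k ∈ s, 0 ≤ v k) → 0 < Q → Q ≤ 1 → (s.card : ℝ) ≤ N →
    (∀ h : ℕ, 1 ≤ h → ‖∑ k ∈ s, addExp (h / d * v k)‖ ≤ N * Q ^ 2 * √h) →
    |∑ k ∈ s, (if d ∣ ⌊v k⌋₊ then (1 : ℝ) else 0) - s.card / d| ≤ C * N * Q := by
  obtain ⟨C, hC, h⟩ := exists_abs_sum_fract_sub_le
  refine ⟨2 * C, by positivity, ?_⟩
  intro s v N Q d hd hv hQ hQ1 hcard hexp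
  have h1 := h s (fun k => v k / d) N Q hQ hQ1 hcard fun m hm => by
    simp_rw [← mul_div_assoc, mul_div_right_comm]
    exact hexp m hm
  have h2 := h s (fun k => (v k - 1) / d) N Q hQ hQ1 hcard fun m hm => by
    have e : ∀ k, addExp (m * ((v k - 1) / d)) = addExp (m / d * v k) * addExp (-(m / d)) := by
      intro k
      rw [← addExp_add]
      congr 1
      ring
    simp_rw [e]
    rw [← sum_mul, norm_mul, norm_addExp, mul_one]
    exact hexp m hm
  rw [sum_congr rfl fun k hk => ite_dvd_floor (hv k hk) hd, sum_add_distrib, sum_sub_distrib,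
    sum_const, nsmul_eq_mul]
  rw [abs_le] at *
  have : (s.card : ℝ) * (1 / d) = s.card / d := by ring
  constructor <;> linarith

lemma eventually_const_mul_rpow_le (C : ℝ) {p q : ℝ} (hpq : p < q) :
    ∀ᶠ x : ℝ in Filter.atTop, C * x ^ p ≤ x ^ q := by
  filter_upwards [(tendsto_rpow_atTop (sub_pos.2 hpq)).eventually_ge_atTop C,
    Filter.eventually_gt_atTop 0] with x hx hx0
  calc C * x ^ p ≤ x ^ (q - p) * x ^ p := by gcongr
    _ = x ^ q := by rw [← Real.rpow_add hx0, sub_add_cancel]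

lemma exists_norm_sum_addExp_le {c : ℝ} (hc : 1 < c) (hcne : ∀ n : ℤ, c ≠ n) :
    ∃ ε σ : ℝ, 0 < ε ∧ ε ≤ 1 ∧ 0 < σ ∧ σ ≤ 1 / 2 ∧ ∃ N₀ : ℕ, ∀ N P : ℕ, N₀ ≤ N → 1 ≤ P →
      (P : ℝ) ≤ (N : ℝ) ^ ε → ∀ a b : ℤ, (N : ℝ) ^ (1 / 2 : ℝ) ≤ a → b ≤ N →
      ∀ h d : ℕ, 1 ≤ h → h ≤ P → 1 ≤ d → d ≤ P →
        ‖∑ n ∈ Ico a b, addExp (h / d * (n : ℝ) ^ c)‖ ≤ 6 * N * (P : ℝ) ^ (-σ) := by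
  obtain ⟨hm, hm'⟩ := floor_lt_of_ne_intCast hc hcne
  set m := ⌊c⌋₊
  have hK := prod_sub_pos hm
  set K := ∏ i ∈ range (m + 1), (c - i) with hKdef
  set ε : ℝ := min (c - m) (m + 1 - c) / (4 * (m + 1)) with hε
  have hmin : 0 < min (c - m) (m + 1 - c) := lt_min (by linarith) (by linarith)
  have hmin1 : min (c - m) (m + 1 - c) ≤ c - m := min_le_left _ _
  have hmin2 : min (c - m) (m + 1 - c) ≤ m + 1 - c := min_le_right _ _
  have hm0 : (0 : ℝ) ≤ m := Nat.cast_nonneg m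
  have hε0 : 0 < ε := by positivity
  have hεm : ε * (m + 1) = min (c - m) (m + 1 - c) / 4 := by rw [hε]; field_simp
  have hεle : ε ≤ min (c - m) (m + 1 - c) / 4 := by rw [← hεm]; nlinarith
  have e1 := eventually_const_mul_rpow_le (2 * K)
    (p := ε * (m + 1)) (q := (m + 1 - c) / 2) (by linarith)
  have e2 := eventually_const_mul_rpow_le (1 / (3 * K)) (p := 2 * ε) (q := c - m) (by linarith)
  obtain ⟨N₀, hN₀⟩ := Filter.eventually_atTop.1 (tendsto_natCast_atTop_atTop.eventually (e1.and e2))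
  refine ⟨ε, (1 / 2) ^ m, hε0, by linarith, by positivity, ?_, N₀ + 1, ?_⟩
  · have hm1 : 1 ≤ m := Nat.le_floor (by simpa using hc.le)
    simpa using pow_le_pow_of_le_one (by norm_num : (0 : ℝ) ≤ 1 / 2) (by norm_num) hm1
  intro N P hN hP hPN a b ha hb h d hh hhP hd hdP
  obtain ⟨f1, f2⟩ := hN₀ N (by omega)
  have hN1 : (1 : ℝ) ≤ N := by exact_mod_cast (by omega : 1 ≤ N)
  have hN0 : (0 : ℝ) < N := by linarith
  have hP0 : (0 : ℝ) < P := by exact_mod_cast hP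
  have hh0 : (0 : ℝ) < h := by exact_mod_cast hh
  have hd0 : (0 : ℝ) < d := by exact_mod_cast hd
  have hdP' : (d : ℝ) ≤ P := by exact_mod_cast hdP
  have hhP' : (h : ℝ) ≤ P := by exact_mod_cast hhP
  have hd1 : (1 : ℝ) ≤ d := by exact_mod_cast hd
  have hh1 : (1 : ℝ) ≤ h := by exact_mod_cast hh
  have ha1 : (1 : ℝ) ≤ a := (Real.one_le_rpow hN1 (by norm_num)).trans ha
  have hθ : (h : ℝ) / d ≤ P := (div_le_self hh0.le hd1).trans hhP'
  have hθ' : 1 / (P : ℝ) ≤ h / d := by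
    rw [div_le_div_iff₀ hP0 hd0]; nlinarith
  have hPN' : P ≤ N := by
    have : (P : ℝ) ≤ N := hPN.trans (by
      simpa using Real.rpow_le_rpow_of_exponent_le hN1 (show ε ≤ 1 by linarith))
    exact_mod_cast this
  refine norm_sum_addExp_rpow_le hm hm' (by exact_mod_cast ha1) hb hP hPN' (by positivity) ?_ ?_
  · have g1 : (a : ℝ) ^ (c - (m + 1)) ≤ (N : ℝ) ^ (-((m + 1 - c) / 2)) := by
      calc (a : ℝ) ^ (c - (m + 1)) ≤ ((N : ℝ) ^ (1 / 2 : ℝ)) ^ (c - (m + 1)) :=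
            Real.rpow_le_rpow_of_nonpos (by positivity) ha (by linarith)
        _ = _ := by
          rw [← Real.rpow_mul hN0.le]
          congr 1
          ring
    have g2 : (P : ℝ) ^ (m + 1) ≤ (N : ℝ) ^ (ε * (m + 1)) := by
      rw [Real.rpow_mul hN0.le]
      calc (P : ℝ) ^ (m + 1) ≤ ((N : ℝ) ^ ε) ^ (m + 1) := by gcongr
        _ = _ := by rw [← Real.rpow_natCast]; push_cast; rfl
    calc _ ≤ P * (P ^ m * K * (N : ℝ) ^ (-((m + 1 - c) / 2))) := by gcongr
      _ = (P : ℝ) ^ (m + 1) * K * (N : ℝ) ^ (-((m + 1 - c) / 2)) := by ring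
      _ ≤ (N : ℝ) ^ (ε * (m + 1)) * K * (N : ℝ) ^ (-((m + 1 - c) / 2)) := by gcongr
      _ = (2 * K * (N : ℝ) ^ (ε * (m + 1))) * (N : ℝ) ^ (-((m + 1 - c) / 2)) / 2 := by ring
      _ ≤ (N : ℝ) ^ ((m + 1 - c) / 2) * (N : ℝ) ^ (-((m + 1 - c) / 2)) / 2 := by gcongr
      _ = 1 / 2 := by rw [← Real.rpow_add hN0, add_neg_cancel, Real.rpow_zero]
  · rw [← hKdef]
    have g3 : (P : ℝ) ^ 2 ≤ 3 * K * (N : ℝ) ^ (c - m) := by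
      calc (P : ℝ) ^ 2 ≤ ((N : ℝ) ^ ε) ^ 2 := by gcongr
        _ = (N : ℝ) ^ (2 * ε) := by
          rw [← Real.rpow_natCast, ← Real.rpow_mul hN0.le]
          congr 1
          push_cast
          ring
        _ = 3 * K * (1 / (3 * K) * (N : ℝ) ^ (2 * ε)) := by field_simp
        _ ≤ _ := by gcongr
    have g4 : (N : ℝ) ^ (c - m) = N ^ (c - (m + 1)) * N := by
      rw [← Real.rpow_add_one hN0.ne']
      congr 1
      ring
    calc 2 / (h / d * (K * (N : ℝ) ^ (c - (m + 1)))) ≤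
        2 / (1 / P * (K * (N : ℝ) ^ (c - (m + 1)))) := by gcongr
      _ ≤ 6 * N / P := by
        rw [div_le_div_iff₀ (by positivity) hP0]
        have : 6 * (N : ℝ) * (1 / P * (K * (N : ℝ) ^ (c - (m + 1)))) =
          2 * (3 * K * (N : ℝ) ^ (c - m)) / P := by rw [g4]; ring
        rw [this, le_div_iff₀ hP0]
        linarith

/-- Equidistribution of `⌊k ^ c⌋` in the zero residue class, uniformly in small moduli. -/
lemma exists_abs_sum_ite_dvd_sub_le {c : ℝ} (hc : 1 < c) (hcne : ∀ n : ℤ, c ≠ n) :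
    ∃ ε σ C : ℝ, 0 < ε ∧ ε ≤ 1 ∧ 0 < σ ∧ σ ≤ 1 ∧ 0 < C ∧ ∃ N₀ : ℕ, ∀ N P : ℕ, N₀ ≤ N → 1 ≤ P →
      (P : ℝ) ≤ (N : ℝ) ^ ε → ∀ a b : ℤ, (N : ℝ) ^ (1 / 2 : ℝ) ≤ a → b ≤ N →
      ∀ d : ℕ, 1 ≤ d → d ≤ P →
        |∑ k ∈ Ico a b, (if d ∣ ⌊(k : ℝ) ^ c⌋₊ then (1 : ℝ) else 0) - (Ico a b).card / d| ≤
          C * N * (P : ℝ) ^ (-σ) := by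
  obtain ⟨ε, σ, hε0, hε1, hσ0, hσ1, N₀, h⟩ := exists_norm_sum_addExp_le hc hcne
  obtain ⟨C, hC, h'⟩ := exists_abs_sum_ite_dvd_floor_sub_le
  refine ⟨ε, σ / 2, 3 * (C + 1), hε0, hε1, by positivity, by linarith, by positivity, N₀, ?_⟩
  intro N P hN hP hPN a b ha hb d hd hdP
  have ha0 : (0 : ℝ) ≤ a := (by positivity : (0 : ℝ) ≤ (N : ℝ) ^ (1 / 2 : ℝ)).trans ha
  have ha0' : 0 ≤ a := by exact_mod_cast ha0
  have hcard : ((Ico a b).card : ℝ) ≤ N := by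
    rw [Int.card_Ico]
    exact_mod_cast (by omega : (b - a).toNat ≤ N)
  have hP0 : (0 : ℝ) < P := by exact_mod_cast hP
  have hP1 : (1 : ℝ) ≤ P := by exact_mod_cast hP
  have hd1 : (1 : ℝ) ≤ d := by exact_mod_cast hd
  set Q := 3 * (P : ℝ) ^ (-(σ / 2)) with hQ
  have hQ0 : 0 < Q := by positivity
  have hQ2 : Q ^ 2 = 9 * (P : ℝ) ^ (-σ) := by
    rw [hQ, mul_pow, ← Real.rpow_natCast, ← Real.rpow_natCast, ← Real.rpow_mul hP0.le]
    norm_num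
  have hgoal : 3 * (C + 1) * N * (P : ℝ) ^ (-(σ / 2)) = (C + 1) * N * Q := by rw [hQ]; ring
  rw [hgoal]
  rcases le_or_gt Q 1 with hQ1 | hQ1
  · refine (h' (Ico a b) (fun k => (k : ℝ) ^ c) N Q d hd ?_ hQ0 hQ1 hcard ?_).trans ?_
    · intro k hk
      have : 0 ≤ k := ha0'.trans (mem_Ico.1 hk).1
      have : (0 : ℝ) ≤ k := by exact_mod_cast this
      positivity
    · intro j hj
      have hj1 : (1 : ℝ) ≤ j := by exact_mod_cast hj
      rcases le_or_gt j P with hjP | hjP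
      · refine (h N P hN hP hPN a b ha hb j d hj hjP hd hdP).trans ?_
        rw [hQ2]
        have h1 : 1 ≤ √(j : ℝ) := Real.one_le_sqrt.2 hj1
        have h2 : 0 ≤ (N : ℝ) * (P : ℝ) ^ (-σ) := by positivity
        nlinarith
      · have h1 : ‖∑ k ∈ Ico a b, addExp (j / d * (k : ℝ) ^ c)‖ ≤ N := by
          refine (norm_sum_le _ _).trans ?_
          simp only [norm_addExp, sum_const, nsmul_eq_mul, mul_one]
          exact hcard
        refine h1.trans ?_
        have h2 : 1 ≤ Q ^ 2 * √(j : ℝ) := by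
          have hjP' : (P : ℝ) ≤ j := by exact_mod_cast hjP.le
          have h3 : (P : ℝ) ^ (-(1 / 2) : ℝ) ≤ (P : ℝ) ^ (-σ) :=
            Real.rpow_le_rpow_of_exponent_le hP1 (by linarith)
          have h4 : √(P : ℝ) ≤ √(j : ℝ) := Real.sqrt_le_sqrt hjP'
          rw [Real.sqrt_eq_rpow] at h4
          rw [hQ2]
          have h5 : (1 : ℝ) ≤ 9 * ((P : ℝ) ^ (-(1 / 2) : ℝ) * (P : ℝ) ^ (1 / 2 : ℝ)) := by
            rw [← Real.rpow_add hP0]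
            norm_num
          refine h5.trans ?_
          rw [mul_assoc]
          gcongr
        rw [mul_assoc]
        exact le_mul_of_one_le_right (by positivity) h2
    · gcongr
      linarith
  · have hs : |∑ k ∈ Ico a b, (if d ∣ ⌊(k : ℝ) ^ c⌋₊ then (1 : ℝ) else 0) - (Ico a b).card / d| ≤
        (Ico a b).card := by
      have h1 : ∑ k ∈ Ico a b, (if d ∣ ⌊(k : ℝ) ^ c⌋₊ then (1 : ℝ) else 0) ≤ (Ico a b).card := by
        rw [← nsmul_one, ← sum_const]
        refine sum_le_sum fun k _ => ?_
        split_ifs <;> norm_num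
      have h2 : 0 ≤ ∑ k ∈ Ico a b, (if d ∣ ⌊(k : ℝ) ^ c⌋₊ then (1 : ℝ) else 0) :=
        sum_nonneg fun k _ => by split_ifs <;> norm_num
      have h3 : ((Ico a b).card : ℝ) / d ≤ (Ico a b).card := div_le_self (by positivity) hd1
      have h4 : 0 ≤ ((Ico a b).card : ℝ) / d := by positivity
      rw [abs_le]
      constructor <;> linarith
    refine hs.trans (hcard.trans ?_)
    have : 0 ≤ C * N := by positivity
    have : 0 ≤ (N : ℝ) := by positivity
    nlinarith

/-- The function `μ(d)² / φ(d)`, whose sum over the divisors of `n` is `n / φ(n)`. -/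
noncomputable def sqfreeInvTotient (d : ℕ) : ℝ :=
  if Squarefree d then 1 / (Nat.totient d : ℝ) else 0

lemma sqfreeInvTotient_nonneg (d : ℕ) : 0 ≤ sqfreeInvTotient d := by
  unfold sqfreeInvTotient
  split_ifs <;> positivity

lemma sqfreeInvTotient_le_one (d : ℕ) : sqfreeInvTotient d ≤ 1 := by
  unfold sqfreeInvTotient
  split_ifs
  · rcases Nat.eq_zero_or_pos (Nat.totient d) with h | h
    · simp [h]
    · exact div_le_one_of_le₀ (by exact_mod_cast h) (by positivity)
  · norm_num

lemma frakc_eq : frakc = ∑' n : ℕ, sqfreeInvTotient n / n := by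
  unfold frakc sqfreeInvTotient
  refine tsum_congr fun n => ?_
  have h := ArithmeticFunction.moebius_sq (n := n)
  have h' : ((ArithmeticFunction.moebius n : ℤ) : ℝ) ^ 2 = if Squarefree n then 1 else 0 := by
    exact_mod_cast congrArg (Int.cast : ℤ → ℝ) h
  rw [h']
  split_ifs
  · rw [div_div, mul_comm]
  · simp

lemma sum_divisors_squarefree_eq {n : ℕ} (hn : n ≠ 0) (f : ℕ → ℝ) :
    ∑ d ∈ n.divisors with Squarefree d, f d =
      ∑ S ∈ n.primeFactors.powerset, f (∏ p ∈ S, p) := by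
  rw [Nat.sum_divisors_filter_squarefree hn, Nat.factors_eq]
  refine sum_congr rfl fun S _ => ?_
  rw [prod_eq_multiset_prod, Multiset.map_id']

lemma totient_eq_prod_of_primes {S : Finset ℕ} (hS : ∀ p ∈ S, p.Prime) :
    Nat.totient (∏ p ∈ S, p) = ∏ p ∈ S, (p - 1) := by
  have h := Nat.totient_mul_prod_primeFactors (∏ p ∈ S, p)
  rw [Nat.primeFactors_prod hS, mul_comm] at h
  exact Nat.eq_of_mul_eq_mul_left (prod_pos fun p hp => (hS p hp).pos) h

lemma div_totient_eq_prod {n : ℕ} (hn : n ≠ 0) :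
    (n : ℝ) / Nat.totient n = ∏ p ∈ n.primeFactors, (1 + 1 / ((p - 1 : ℕ) : ℝ)) := by
  have h := congrArg (Nat.cast : ℕ → ℝ) (Nat.totient_mul_prod_primeFactors n)
  push_cast at h
  have hφ : (Nat.totient n : ℝ) ≠ 0 := by
    exact_mod_cast (Nat.totient_pos.2 (Nat.pos_of_ne_zero hn)).ne'
  have h1 : ∀ p ∈ n.primeFactors, ((p - 1 : ℕ) : ℝ) ≠ 0 := fun p hp => by
    have := (Nat.prime_of_mem_primeFactors hp).two_le
    exact_mod_cast (by omega : p - 1 ≠ 0)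
  have h2 : ∀ p ∈ n.primeFactors, 1 + 1 / ((p - 1 : ℕ) : ℝ) = (p : ℝ) / ((p - 1 : ℕ) : ℝ) := by
    intro p hp
    have h3 := h1 p hp
    have h4 : (p : ℝ) = ((p - 1 : ℕ) : ℝ) + 1 := by
      have := (Nat.prime_of_mem_primeFactors hp).two_le
      exact_mod_cast (by omega : p = p - 1 + 1)
    rw [eq_div_iff h3, one_add_mul, one_div_mul_cancel h3]
    exact h4.symm
  rw [prod_congr rfl h2, prod_div_distrib, div_eq_div_iff hφ (prod_ne_zero_iff.2 h1)]
  linarith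

lemma div_totient_eq_sum_divisors {n : ℕ} (hn : n ≠ 0) :
    (n : ℝ) / Nat.totient n = ∑ d ∈ n.divisors, sqfreeInvTotient d := by
  unfold sqfreeInvTotient
  rw [← sum_filter, sum_divisors_squarefree_eq hn, div_totient_eq_prod hn, prod_one_add]
  refine sum_congr rfl fun S hS => ?_
  rw [totient_eq_prod_of_primes fun p hp =>
    Nat.prime_of_mem_primeFactors (mem_powerset.1 hS hp)]
  push_cast
  rw [prod_div_distrib, prod_const_one]

lemma exists_two_pow_card_primeFactors_le {η : ℝ} (hη : 0 < η) :
    ∃ C : ℝ, 0 < C ∧ ∀ n : ℕ, n ≠ 0 → (2 : ℝ) ^ n.primeFactors.card ≤ C * (n : ℝ) ^ η := by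
  set M : ℝ := 2 ^ (1 / η) with hM
  refine ⟨2 ^ ⌈M⌉₊, by positivity, fun n hn => ?_⟩
  have h1 : ∀ p ∈ n.primeFactors, (2 : ℝ) ≤ (if (p : ℝ) < M then 2 else 1) * (p : ℝ) ^ η := by
    intro p hp
    have hp1 : (1 : ℝ) ≤ p := by exact_mod_cast (Nat.prime_of_mem_primeFactors hp).one_le
    split_ifs with h
    · have := Real.one_le_rpow hp1 hη.le
      linarith
    · have h2 : M ^ η ≤ (p : ℝ) ^ η := by
        gcongr
        exact not_lt.1 h
      rw [hM, ← Real.rpow_mul (by norm_num), one_div_mul_cancel hη.ne', Real.rpow_one] at h2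
      linarith
  rw [← prod_const]
  refine (prod_le_prod (fun _ _ => by norm_num) h1).trans ?_
  rw [prod_mul_distrib]
  have h3 : ∏ p ∈ n.primeFactors, (if (p : ℝ) < M then (2 : ℝ) else 1) ≤ 2 ^ ⌈M⌉₊ := by
    rw [← prod_filter, prod_const]
    refine pow_le_pow_right₀ (by norm_num) ?_
    rw [← card_range ⌈M⌉₊]
    refine card_le_card fun p hp => ?_
    rw [mem_range]
    exact Nat.lt_ceil.2 (mem_filter.1 hp).2
  have h4 : ∏ p ∈ n.primeFactors, (p : ℝ) ^ η ≤ (n : ℝ) ^ η := by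
    rw [Real.finsetProd_rpow _ _ (fun p _ => by positivity)]
    gcongr
    rw [← Nat.cast_prod]
    exact_mod_cast Nat.le_of_dvd (Nat.pos_of_ne_zero hn) (Nat.prod_primeFactors_dvd n)
  gcongr

lemma exists_sqfreeInvTotient_le :
    ∃ C : ℝ, 0 < C ∧ ∀ d : ℕ, d ≠ 0 → sqfreeInvTotient d ≤ C * (d : ℝ) ^ (-(1 / 2) : ℝ) := by
  obtain ⟨C, hC, h⟩ := exists_two_pow_card_primeFactors_le (η := 1 / 2) (by norm_num)
  refine ⟨C, hC, fun d hd => ?_⟩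
  have hd0 : (0 : ℝ) < d := by exact_mod_cast Nat.pos_of_ne_zero hd
  have h1 : (d : ℝ) / Nat.totient d ≤ 2 ^ d.primeFactors.card := by
    rw [div_totient_eq_prod hd, ← prod_const]
    refine prod_le_prod (fun p _ => by positivity) fun p hp => ?_
    have h2 : (1 : ℝ) ≤ ((p - 1 : ℕ) : ℝ) := by
      have := (Nat.prime_of_mem_primeFactors hp).two_le
      exact_mod_cast (by omega : 1 ≤ p - 1)
    have : 1 / ((p - 1 : ℕ) : ℝ) ≤ 1 := div_le_one_of_le₀ h2 (by positivity)
    linarith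
  unfold sqfreeInvTotient
  split_ifs
  · have h3 := h1.trans (h d hd)
    have h4 : (d : ℝ) ^ (1 / 2 : ℝ) = d * (d : ℝ) ^ (-(1 / 2) : ℝ) := by
      rw [← Real.rpow_one_add' hd0.le (by norm_num)]
      norm_num
    rw [h4] at h3
    have h5 : (d : ℝ) / Nat.totient d = d * (1 / Nat.totient d) := by ring
    rw [h5] at h3
    exact le_of_mul_le_mul_left (by linarith) hd0
  · positivity

lemma exists_abs_frakc_sub_sum_le :
    ∃ C : ℝ, 0 < C ∧ ∀ D : ℕ, 1 ≤ D →
      |∑ d ∈ Icc 1 D, sqfreeInvTotient d / d - frakc| ≤ C * (D : ℝ) ^ (-(1 / 4) : ℝ) := by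
  obtain ⟨C, hC, h⟩ := exists_sqfreeInvTotient_le
  have hle : ∀ d : ℕ, sqfreeInvTotient d / d ≤ C * (1 / (d : ℝ) ^ (3 / 2 : ℝ)) := by
    intro d
    rcases Nat.eq_zero_or_pos d with rfl | hd
    · simp
    have hd0 : (0 : ℝ) < d := by exact_mod_cast hd
    rw [div_le_iff₀ hd0]
    refine (h d hd.ne').trans (le_of_eq ?_)
    rw [mul_assoc]
    congr 1
    rw [one_div ((d : ℝ) ^ (3 / 2 : ℝ)), ← Real.rpow_neg hd0.le, ← Real.rpow_add_one hd0.ne']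
    norm_num
  have hs1 : Summable fun d : ℕ => 1 / (d : ℝ) ^ (3 / 2 : ℝ) :=
    Real.summable_one_div_nat_rpow.2 (by norm_num)
  have hs2 : Summable fun d : ℕ => 1 / (d : ℝ) ^ (5 / 4 : ℝ) :=
    Real.summable_one_div_nat_rpow.2 (by norm_num)
  have hs : Summable fun d : ℕ => sqfreeInvTotient d / d :=
    Summable.of_nonneg_of_le (fun d => div_nonneg (sqfreeInvTotient_nonneg d) (by positivity)) hle
      (hs1.mul_left C)
  set C' := ∑' d : ℕ, 1 / (d : ℝ) ^ (5 / 4 : ℝ) with hC'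
  have hC'0 : 0 ≤ C' := tsum_nonneg fun d => by positivity
  refine ⟨C * (C' + 1), by positivity, fun D hD => ?_⟩
  have hD0 : (0 : ℝ) < D := by exact_mod_cast hD
  have hfin : HasSum (fun d : ℕ => if d ∈ Icc 1 D then sqfreeInvTotient d / d else 0)
      (∑ d ∈ Icc 1 D, sqfreeInvTotient d / d) := by
    have e : ∑ d ∈ Icc 1 D, (if d ∈ Icc 1 D then sqfreeInvTotient d / (d : ℝ) else 0) =
        ∑ d ∈ Icc 1 D, sqfreeInvTotient d / d := sum_congr rfl fun d hd => if_pos hd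
    rw [← e]
    exact hasSum_sum_of_ne_finset_zero fun d hd => if_neg hd
  have hsub := hs.hasSum.sub hfin
  rw [← frakc_eq] at hsub
  have hb : ∀ d : ℕ, ‖sqfreeInvTotient d / d -
      (if d ∈ Icc 1 D then sqfreeInvTotient d / d else 0)‖ ≤
      C * (D : ℝ) ^ (-(1 / 4) : ℝ) * (1 / (d : ℝ) ^ (5 / 4 : ℝ)) := by
    intro d
    split_ifs with hd
    · rw [sub_self, norm_zero]; positivity
    · rw [sub_zero, Real.norm_of_nonneg (div_nonneg (sqfreeInvTotient_nonneg d) (by positivity))]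
      rcases Nat.eq_zero_or_pos d with rfl | hd1
      · simp
      have hd0 : (0 : ℝ) < d := by exact_mod_cast hd1
      have hDd : (D : ℝ) ≤ d := by
        rw [mem_Icc] at hd
        exact_mod_cast (by omega : D ≤ d)
      refine (hle d).trans ?_
      rw [mul_assoc]
      gcongr
      have h1 : (d : ℝ) ^ (-(1 / 4) : ℝ) ≤ (D : ℝ) ^ (-(1 / 4) : ℝ) :=
        Real.rpow_le_rpow_of_nonpos hD0 hDd (by norm_num)
      calc 1 / (d : ℝ) ^ (3 / 2 : ℝ) = (d : ℝ) ^ (-(1 / 4) : ℝ) * (1 / (d : ℝ) ^ (5 / 4 : ℝ)) := by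
            rw [one_div ((d : ℝ) ^ (3 / 2 : ℝ)), one_div ((d : ℝ) ^ (5 / 4 : ℝ)),
              ← Real.rpow_neg hd0.le, ← Real.rpow_neg hd0.le,
              ← Real.rpow_add hd0]
            norm_num
        _ ≤ _ := by gcongr
  have h6 := tsum_of_norm_bounded (hs2.hasSum.mul_left (C * (D : ℝ) ^ (-(1 / 4) : ℝ))) hb
  rw [hsub.tsum_eq, Real.norm_eq_abs, ← hC'] at h6
  rw [abs_sub_comm]
  refine h6.trans ?_
  have : 0 ≤ C * (D : ℝ) ^ (-(1 / 4) : ℝ) := by positivity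
  linarith

lemma exists_abs_div_totient_sub_sum_le {η : ℝ} (hη : 0 < η) :
    ∃ C : ℝ, 0 < C ∧ ∀ n D : ℕ, n ≠ 0 → 1 ≤ D →
      |(n : ℝ) / Nat.totient n - ∑ d ∈ Icc 1 D, (if d ∣ n then sqfreeInvTotient d else 0)| ≤
        C * (D : ℝ) ^ (-(1 / 2) : ℝ) * (n : ℝ) ^ η := by
  obtain ⟨C₁, hC₁, h₁⟩ := exists_sqfreeInvTotient_le
  obtain ⟨C₂, hC₂, h₂⟩ := exists_two_pow_card_primeFactors_le hη
  refine ⟨C₁ * C₂, by positivity, fun n D hn hD => ?_⟩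
  have hD0 : (0 : ℝ) < D := by exact_mod_cast hD
  have e : (n : ℝ) / Nat.totient n - ∑ d ∈ Icc 1 D, (if d ∣ n then sqfreeInvTotient d else 0) =
      ∑ d ∈ n.divisors with ¬ d ≤ D, sqfreeInvTotient d := by
    rw [div_totient_eq_sum_divisors hn, ← sum_filter_add_sum_filter_not _ (· ≤ D), ← sum_filter]
    have : (Icc 1 D).filter (· ∣ n) = n.divisors.filter (· ≤ D) := by
      ext d
      simp only [mem_filter, mem_Icc, Nat.mem_divisors]
      constructor
      · rintro ⟨⟨_, h⟩, h'⟩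
        exact ⟨⟨h', hn⟩, h⟩
      · rintro ⟨⟨h', _⟩, h⟩
        exact ⟨⟨Nat.pos_of_dvd_of_pos h' (Nat.pos_of_ne_zero hn), h⟩, h'⟩
    rw [this]
    ring
  rw [e, abs_of_nonneg (sum_nonneg fun d _ => sqfreeInvTotient_nonneg d)]
  have hcard : ∑ d ∈ n.divisors with Squarefree d, (1 : ℝ) = 2 ^ n.primeFactors.card := by
    rw [sum_divisors_squarefree_eq hn (fun _ => 1)]
    simp
  calc ∑ d ∈ n.divisors with ¬ d ≤ D, sqfreeInvTotient d
      ≤ ∑ d ∈ n.divisors, (if Squarefree d then C₁ * (D : ℝ) ^ (-(1 / 2) : ℝ) else 0) := by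
        rw [sum_filter]
        refine sum_le_sum fun d hd => ?_
        split_ifs with h h' h'
        · positivity
        · exact le_rfl
        · have hd0 : d ≠ 0 := (Nat.pos_of_mem_divisors hd).ne'
          refine (h₁ d hd0).trans ?_
          gcongr C₁ * ?_
          exact Real.rpow_le_rpow_of_nonpos hD0 (by exact_mod_cast (not_le.1 h).le) (by norm_num)
        · simp [sqfreeInvTotient, h']
    _ = C₁ * (D : ℝ) ^ (-(1 / 2) : ℝ) * 2 ^ n.primeFactors.card := by
        rw [← sum_filter, ← hcard, mul_sum, mul_one]
    _ ≤ C₁ * (D : ℝ) ^ (-(1 / 2) : ℝ) * (C₂ * (n : ℝ) ^ η) := by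
        gcongr
        exact h₂ n hn
    _ = _ := by ring

lemma half_le_floor {x : ℝ} (hx : 1 ≤ x) : x / 2 ≤ (⌊x⌋₊ : ℝ) := by
  have h1 : (1 : ℝ) ≤ ⌊x⌋₊ := by exact_mod_cast (Nat.one_le_floor_iff x).2 hx
  have := Nat.lt_floor_add_one x
  linarith

lemma exists_abs_sum_div_totient_sub_le {c : ℝ} (hc : 1 < c) (hcne : ∀ n : ℤ, c ≠ n) :
    ∃ δ C : ℝ, 0 < δ ∧ δ ≤ 1 ∧ 0 < C ∧ ∃ N₀ : ℕ, ∀ N : ℕ, N₀ ≤ N →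
      ∀ a b : ℤ, (N : ℝ) ^ (1 / 2 : ℝ) ≤ a → b ≤ N →
        |∑ k ∈ Ico a b, (⌊(k : ℝ) ^ c⌋₊ : ℝ) / (Nat.totient ⌊(k : ℝ) ^ c⌋₊ : ℝ) -
          frakc * (Ico a b).card| ≤ C * N * (N : ℝ) ^ (-δ) := by
  obtain ⟨ε, σ, C, hε, hε1, hσ, hσ1, hC, N₀, h⟩ := exists_abs_sum_ite_dvd_sub_le hc hcne
  set τ := ε * σ / 2 with hτ
  have hτ0 : 0 < τ := by positivity
  have hτ1 : τ ≤ 1 := by nlinarith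
  obtain ⟨C₁, hC₁, h₁⟩ := exists_abs_frakc_sub_sum_le
  obtain ⟨C₂, hC₂, h₂⟩ := exists_abs_div_totient_sub_sum_le (η := τ / (4 * c)) (by positivity)
  refine ⟨τ / 4, 4 * C₂ + C * 4 + C₁ * 4, by positivity, by linarith, by positivity, N₀ + 1,
    fun N hN a b ha hb => ?_⟩
  have hN1 : (1 : ℝ) ≤ N := by exact_mod_cast (by omega : 1 ≤ N)
  have hN0 : (0 : ℝ) < N := by linarith
  have hP1 : 1 ≤ ⌊(N : ℝ) ^ ε⌋₊ := (Nat.one_le_floor_iff _).2 (Real.one_le_rpow hN1 hε.le)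
  have hPle : (⌊(N : ℝ) ^ ε⌋₊ : ℝ) ≤ (N : ℝ) ^ ε := Nat.floor_le (by positivity)
  have hPge := half_le_floor (Real.one_le_rpow hN1 hε.le)
  set P := ⌊(N : ℝ) ^ ε⌋₊ with hP
  have hP1' : (1 : ℝ) ≤ P := by exact_mod_cast hP1
  have hQ1 : 1 ≤ (P : ℝ) ^ (σ / 2) := Real.one_le_rpow hP1' (by positivity)
  have hDle : (⌊(P : ℝ) ^ (σ / 2)⌋₊ : ℝ) ≤ (P : ℝ) ^ (σ / 2) := Nat.floor_le (by positivity)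
  have hD1 : 1 ≤ ⌊(P : ℝ) ^ (σ / 2)⌋₊ := (Nat.one_le_floor_iff _).2 hQ1
  have hDge := half_le_floor hQ1
  set D := ⌊(P : ℝ) ^ (σ / 2)⌋₊ with hD
  have hD1' : (1 : ℝ) ≤ D := by exact_mod_cast hD1
  have hDP : D ≤ P := by
    have : (P : ℝ) ^ (σ / 2) ≤ (P : ℝ) ^ (1 : ℝ) :=
      Real.rpow_le_rpow_of_exponent_le hP1' (by linarith)
    rw [Real.rpow_one] at this
    exact_mod_cast hDle.trans this
  have hDN : (N : ℝ) ^ τ / 4 ≤ D := by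
    have e1 : ((N : ℝ) ^ ε / 2) ^ (σ / 2) ≤ (P : ℝ) ^ (σ / 2) := by gcongr
    rw [Real.div_rpow (by positivity) (by norm_num), ← Real.rpow_mul hN0.le,
      show ε * (σ / 2) = τ by rw [hτ]; ring] at e1
    have e2 : (2 : ℝ) ^ (σ / 2) ≤ 2 ^ (1 : ℝ) :=
      Real.rpow_le_rpow_of_exponent_le (by norm_num) (by linarith)
    rw [Real.rpow_one] at e2
    have e3 : (N : ℝ) ^ τ / 2 ≤ (N : ℝ) ^ τ / 2 ^ (σ / 2) := by gcongr
    linarith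
  have hDs : ∀ s : ℝ, 0 ≤ s → s ≤ 1 → (D : ℝ) ^ (-s) ≤ 4 * (N : ℝ) ^ (-(τ * s)) := by
    intro s hs0 hs1
    have e1 : (D : ℝ) ^ (-s) ≤ ((N : ℝ) ^ τ / 4) ^ (-s) :=
      Real.rpow_le_rpow_of_nonpos (by positivity) hDN (by linarith)
    rw [Real.div_rpow (by positivity) (by norm_num), ← Real.rpow_mul hN0.le,
      Real.rpow_neg (by norm_num : (0 : ℝ) ≤ 4), div_inv_eq_mul, mul_comm, mul_neg] at e1
    have e2 : (4 : ℝ) ^ s ≤ 4 ^ (1 : ℝ) :=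
      Real.rpow_le_rpow_of_exponent_le (by norm_num) hs1
    rw [Real.rpow_one] at e2
    exact e1.trans (by gcongr)
  have ha1 : (1 : ℝ) ≤ a := (Real.one_le_rpow hN1 (by norm_num)).trans ha
  have ha1' : 1 ≤ a := by exact_mod_cast ha1
  have hcard : ((Ico a b).card : ℝ) ≤ N := by
    rw [Int.card_Ico]
    exact_mod_cast (by omega : (b - a).toNat ≤ N)
  set m : ℝ := ((Ico a b).card : ℝ) with hm
  have hδ : (D : ℝ) ^ (-(1 / 4) : ℝ) ≤ 4 * (N : ℝ) ^ (-(τ / 4)) := by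
    have := hDs (1 / 4) (by norm_num) (by norm_num)
    rwa [mul_one_div] at this
  have b1 : |∑ k ∈ Ico a b, (⌊(k : ℝ) ^ c⌋₊ : ℝ) / (Nat.totient ⌊(k : ℝ) ^ c⌋₊ : ℝ) -
      ∑ k ∈ Ico a b, ∑ d ∈ Icc 1 D, (if d ∣ ⌊(k : ℝ) ^ c⌋₊ then sqfreeInvTotient d else 0)| ≤
      4 * C₂ * N * (N : ℝ) ^ (-(τ / 4)) := by
    rw [← sum_sub_distrib]
    refine (abs_sum_le_sum_abs _ _).trans ?_
    have : ∀ k ∈ Ico a b, |(⌊(k : ℝ) ^ c⌋₊ : ℝ) / (Nat.totient ⌊(k : ℝ) ^ c⌋₊ : ℝ) -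
        ∑ d ∈ Icc 1 D, (if d ∣ ⌊(k : ℝ) ^ c⌋₊ then sqfreeInvTotient d else 0)| ≤
        4 * C₂ * (N : ℝ) ^ (-(τ / 4)) := by
      intro k hk
      rw [mem_Ico] at hk
      have hk1 : (1 : ℝ) ≤ k := by exact_mod_cast ha1'.trans hk.1
      have hkN : (k : ℝ) ≤ N := by exact_mod_cast (by omega : k ≤ N)
      have hn0 : ⌊(k : ℝ) ^ c⌋₊ ≠ 0 := by
        have := (Nat.one_le_floor_iff _).2 (Real.one_le_rpow hk1 (by linarith : 0 ≤ c))
        omega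
      have hn : (⌊(k : ℝ) ^ c⌋₊ : ℝ) ≤ (N : ℝ) ^ c :=
        (Nat.floor_le (by positivity)).trans (by gcongr)
      have hn' : (⌊(k : ℝ) ^ c⌋₊ : ℝ) ^ (τ / (4 * c)) ≤ (N : ℝ) ^ (τ / 4) := by
        calc _ ≤ ((N : ℝ) ^ c) ^ (τ / (4 * c)) := by gcongr
          _ = _ := by
            rw [← Real.rpow_mul hN0.le]
            congr 1
            field_simp
      calc _ ≤ C₂ * (D : ℝ) ^ (-(1 / 2) : ℝ) * (⌊(k : ℝ) ^ c⌋₊ : ℝ) ^ (τ / (4 * c)) :=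
            h₂ _ D hn0 hD1
        _ ≤ C₂ * (4 * (N : ℝ) ^ (-(τ * (1 / 2)))) * (N : ℝ) ^ (τ / 4) := by
            gcongr
            exact hDs (1 / 2) (by norm_num) (by norm_num)
        _ = 4 * C₂ * ((N : ℝ) ^ (-(τ * (1 / 2))) * (N : ℝ) ^ (τ / 4)) := by ring
        _ = _ := by
            rw [← Real.rpow_add hN0]
            congr 2
            ring
    refine (sum_le_card_nsmul _ _ _ this).trans ?_
    rw [nsmul_eq_mul]
    calc m * (4 * C₂ * (N : ℝ) ^ (-(τ / 4))) ≤ N * (4 * C₂ * (N : ℝ) ^ (-(τ / 4))) := by gcongr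
      _ = _ := by ring
  have b2 : |∑ k ∈ Ico a b, ∑ d ∈ Icc 1 D,
      (if d ∣ ⌊(k : ℝ) ^ c⌋₊ then sqfreeInvTotient d else 0) -
      (∑ d ∈ Icc 1 D, sqfreeInvTotient d / d) * m| ≤ C * 4 * N * (N : ℝ) ^ (-(τ / 4)) := by
    rw [sum_comm, sum_mul, ← sum_sub_distrib]
    refine (abs_sum_le_sum_abs _ _).trans ?_
    have : ∀ d ∈ Icc 1 D,
        |∑ k ∈ Ico a b, (if d ∣ ⌊(k : ℝ) ^ c⌋₊ then sqfreeInvTotient d else 0) -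
          sqfreeInvTotient d / d * m| ≤ C * N * (P : ℝ) ^ (-σ) := by
      intro d hd
      rw [mem_Icc] at hd
      have e : ∑ k ∈ Ico a b, (if d ∣ ⌊(k : ℝ) ^ c⌋₊ then sqfreeInvTotient d else 0) -
          sqfreeInvTotient d / d * m = sqfreeInvTotient d *
          (∑ k ∈ Ico a b, (if d ∣ ⌊(k : ℝ) ^ c⌋₊ then (1 : ℝ) else 0) - m / d) := by
        rw [mul_sub, mul_sum]
        congr 1
        · exact sum_congr rfl fun k _ => by split_ifs <;> simp
        · ring
      rw [e, abs_mul, abs_of_nonneg (sqfreeInvTotient_nonneg d)]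
      refine (mul_le_of_le_one_left (abs_nonneg _) (sqfreeInvTotient_le_one d)).trans ?_
      exact h N P (by omega) hP1 hPle a b ha hb d hd.1 (hd.2.trans hDP)
    refine (sum_le_card_nsmul _ _ _ this).trans ?_
    rw [nsmul_eq_mul, Nat.card_Icc, Nat.add_sub_cancel]
    have hDP' : D * (P : ℝ) ^ (-σ) ≤ 4 * (N : ℝ) ^ (-(τ / 4)) := by
      calc D * (P : ℝ) ^ (-σ) ≤ (P : ℝ) ^ (σ / 2) * (P : ℝ) ^ (-σ) := by gcongr
        _ = ((P : ℝ) ^ (σ / 2)) ^ (-1 : ℝ) := by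
            rw [← Real.rpow_add (by linarith), ← Real.rpow_mul (by linarith)]
            congr 1
            ring
        _ ≤ (D : ℝ) ^ (-1 : ℝ) := Real.rpow_le_rpow_of_nonpos (by linarith) hDle (by norm_num)
        _ ≤ (D : ℝ) ^ (-(1 / 4) : ℝ) := Real.rpow_le_rpow_of_exponent_le hD1' (by norm_num)
        _ ≤ _ := hδ
    calc D * (C * N * (P : ℝ) ^ (-σ)) = C * N * (D * (P : ℝ) ^ (-σ)) := by ring
      _ ≤ C * N * (4 * (N : ℝ) ^ (-(τ / 4))) := by gcongr
      _ = _ := by ring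
  have b3 : |(∑ d ∈ Icc 1 D, sqfreeInvTotient d / d) * m - frakc * m| ≤
      C₁ * 4 * N * (N : ℝ) ^ (-(τ / 4)) := by
    rw [← sub_mul, abs_mul, abs_of_nonneg (by positivity : 0 ≤ m)]
    calc _ ≤ (C₁ * (4 * (N : ℝ) ^ (-(τ / 4)))) * N := by
          gcongr
          exact (h₁ D hD1).trans (by gcongr)
      _ = _ := by ring
  refine (abs_sub_le _ _ _).trans ((add_le_add b1 ((abs_sub_le _ _ _).trans
    (add_le_add b2 b3))).trans (le_of_eq (by ring)))

end

lemma frakc_nonneg : 0 ≤ frakc := tsum_nonneg fun _ => by positivity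

theorem statement19 (c : ℝ) (hc : 1 < c) (hcne : ∀ n : ℤ, c ≠ (n : ℝ)) (A : ℝ) (hA : 1 < A) :
    ∃ B : ℝ, 0 < B ∧ ∃ κ > (0:ℝ), ∃ x₀ : ℝ, 2 ≤ x₀ ∧ ∀ x : ℝ, x₀ ≤ x →
      ∀ y₁ : ℝ, 0 < y₁ → y₁ ^ c = x * Real.log x ^ (-B) →
        ∀ z : ℝ, y₁ < z → z ^ c ≤ x →
          |(∑ k ∈ Finset.Ioc ⌊y₁⌋ ⌊z⌋,
                (⌊(k : ℝ) ^ c⌋₊ : ℝ) / (Nat.totient ⌊(k : ℝ) ^ c⌋₊ : ℝ))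
              - frakc * (z - y₁)|
            ≤ κ * z * Real.log x ^ (-(3 * A)) := by
  obtain ⟨δ, C, hδ, hδ1, hC, N₀, h⟩ := exists_abs_sum_div_totient_sub_le hc hcne
  have hc0 : 0 < c := by linarith
  have ev1 : ∀ᶠ x : ℝ in Filter.atTop, 2 ^ (c / 2) * Real.log x ≤ x ^ (1 / 2 : ℝ) := by
    have := (isLittleO_log_rpow_atTop (by norm_num : (0 : ℝ) < 1 / 2)).bound
      (inv_pos.2 (by positivity : (0 : ℝ) < 2 ^ (c / 2)))
    filter_upwards [this, Filter.eventually_ge_atTop 2] with x hx hx2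
    rw [Real.norm_of_nonneg (Real.log_nonneg (by linarith)),
      Real.norm_of_nonneg (by positivity)] at hx
    rwa [← le_inv_mul_iff₀ (by positivity)]
  have ev2 : ∀ᶠ x : ℝ in Filter.atTop, Real.log x ^ (3 * A) ≤ x ^ (1 / (2 * c) * δ) := by
    have := (isLittleO_log_rpow_rpow_atTop (3 * A)
      (by positivity : 0 < 1 / (2 * c) * δ)).bound one_pos
    filter_upwards [this, Filter.eventually_ge_atTop 2] with x hx hx2
    have hl : 0 ≤ Real.log x := Real.log_nonneg (by linarith)
    rwa [Real.norm_of_nonneg (by positivity), Real.norm_of_nonneg (by positivity), one_mul] at hx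
  have ev3 : ∀ᶠ x : ℝ in Filter.atTop, (N₀ : ℝ) ≤ x ^ (1 / (2 * c)) :=
    (tendsto_rpow_atTop (by positivity)).eventually_ge_atTop _
  obtain ⟨x₁, hx₁⟩ := Filter.eventually_atTop.1 (ev1.and (ev2.and ev3))
  refine ⟨1, one_pos, 2 * C + frakc, by have := frakc_nonneg; positivity, max 2 x₁,
    le_max_left _ _, fun x hx y hy hyx z hyz hzx => ?_⟩
  obtain ⟨h1, h2, h3⟩ := hx₁ x ((le_max_right _ _).trans hx)
  have hx2 : 2 ≤ x := (le_max_left _ _).trans hx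
  have hl : 0 < Real.log x := Real.log_pos (by linarith)
  have hz : 0 < z := hy.trans hyz
  rw [Real.rpow_neg_one, ← div_eq_mul_inv] at hyx
  have hyc : 2 ^ (c / 2) * x ^ (1 / 2 : ℝ) ≤ y ^ c := by
    rw [hyx, le_div_iff₀ hl]
    calc 2 ^ (c / 2) * x ^ (1 / 2 : ℝ) * Real.log x
        = x ^ (1 / 2 : ℝ) * (2 ^ (c / 2) * Real.log x) := by ring
      _ ≤ x ^ (1 / 2 : ℝ) * x ^ (1 / 2 : ℝ) := by gcongr
      _ = x := by
        rw [← Real.rpow_add (by linarith)]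
        norm_num
  have hxy : x ^ (1 / (2 * c)) ≤ y := by
    rw [← Real.rpow_le_rpow_iff (by positivity) hy.le hc0, ← Real.rpow_mul (by linarith)]
    have e : 1 / (2 * c) * c = 1 / 2 := by field_simp
    rw [e]
    refine (le_mul_of_one_le_left (by positivity) ?_).trans hyc
    exact Real.one_le_rpow (by norm_num) (by positivity)
  have hzy : (2 * z) ^ (1 / 2 : ℝ) ≤ y := by
    rw [← Real.rpow_le_rpow_iff (by positivity) hy.le hc0, ← Real.rpow_mul (by positivity),
      Real.mul_rpow (by norm_num) hz.le, one_div_mul_eq_div]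
    refine le_trans ?_ hyc
    gcongr
    rw [div_eq_mul_one_div, Real.rpow_mul hz.le]
    gcongr
  have hx1 : 1 ≤ x ^ (1 / (2 * c)) := Real.one_le_rpow (by linarith) (by positivity)
  have hz1 : 1 ≤ z := by linarith
  have hNz : z ≤ (⌊z⌋₊ + 1 : ℕ) := by
    push_cast
    exact (Nat.lt_floor_add_one z).le
  have hN2 : ((⌊z⌋₊ + 1 : ℕ) : ℝ) ≤ 2 * z := by
    have := Nat.floor_le hz.le
    push_cast
    linarith
  have hay := (Int.lt_floor_add_one y).le
  have hNN : N₀ ≤ ⌊z⌋₊ + 1 := by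
    exact_mod_cast h3.trans (hxy.trans (hyz.le.trans hNz))
  have key := h (⌊z⌋₊ + 1) hNN (⌊y⌋ + 1) (⌊z⌋ + 1)
    (by
      push_cast
      refine le_trans ?_ (hzy.trans hay)
      gcongr
      exact_mod_cast hN2)
    (by
      rw [← Int.natCast_floor_eq_floor hz.le]
      push_cast
      exact le_rfl)
  have hI : Finset.Ico (⌊y⌋ + 1) (⌊z⌋ + 1) = Finset.Ioc ⌊y⌋ ⌊z⌋ := by
    ext k
    simp only [Finset.mem_Ico, Finset.mem_Ioc]
    omega
  rw [hI] at key
  set N := ⌊z⌋₊ + 1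
  have hlog : z ^ (-δ) ≤ Real.log x ^ (-(3 * A)) := by
    rw [Real.rpow_neg hz.le, Real.rpow_neg hl.le]
    gcongr
    refine h2.trans ?_
    rw [Real.rpow_mul (by linarith)]
    gcongr
    linarith
  have k1 : C * N * (N : ℝ) ^ (-δ) ≤ C * (2 * z) * Real.log x ^ (-(3 * A)) := by
    gcongr
    exact (Real.rpow_le_rpow_of_nonpos hz hNz (by linarith)).trans hlog
  have k2 : 1 ≤ z * Real.log x ^ (-(3 * A)) := by
    have e : z * z ^ (-δ) = z ^ (1 + -δ) := by rw [Real.rpow_add hz, Real.rpow_one]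
    calc (1 : ℝ) ≤ z ^ (1 + -δ) := Real.one_le_rpow hz1 (by linarith)
      _ = z * z ^ (-δ) := e.symm
      _ ≤ _ := by gcongr
  have hcard : ((Finset.Ioc ⌊y⌋ ⌊z⌋).card : ℝ) = (⌊z⌋ : ℝ) - ⌊y⌋ := by
    rw [Int.card_Ioc]
    have : ((⌊z⌋ - ⌊y⌋).toNat : ℤ) = ⌊z⌋ - ⌊y⌋ :=
      Int.toNat_of_nonneg (sub_nonneg.2 (Int.floor_le_floor hyz.le))
    exact_mod_cast congrArg (Int.cast : ℤ → ℝ) this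
  have k3 : |frakc * ((Finset.Ioc ⌊y⌋ ⌊z⌋).card : ℝ) - frakc * (z - y)| ≤
      frakc * (z * Real.log x ^ (-(3 * A))) := by
    rw [← mul_sub, abs_mul, abs_of_nonneg frakc_nonneg, hcard]
    refine mul_le_mul_of_nonneg_left (le_trans ?_ k2) frakc_nonneg
    have := Int.floor_le y
    have := Int.floor_le z
    have := Int.lt_floor_add_one y
    have := Int.lt_floor_add_one z
    rw [abs_le]
    constructor <;> linarith
  refine (abs_sub_le _ _ _).trans ((add_le_add (key.trans k1) k3).trans (le_of_eq (by ring)))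
end
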